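/- Let m ≥ 2. Every non-negative Legendrian isotopy {Λ_t}_{t∈[0,1]} in E = J¹(S^{m-1}) with Λ_0 = Λ_1 = Λ^0 (the zero section) is constant: Λ_t = Λ^0 for every t ∈ [0,1]. -/

import Mathlib

/-!
STATEMENT 7: Every non-negative Legendrian isotopy in `E = J¹(S^{m-1})` connecting the
zero section `Λ⁰` to itself is constant: `Λ_t = Λ⁰` for every `t ∈ [0,1]`
(Corollary 5.6 of the paper for `L = S^{m-1}`).

Conventions for representing Legendrian isotopies and the 1-jet space
`E = {(q,p,u) ∈ S^{m-1} × ℝ^m × ℝ : ⟨p,q⟩ = 0}` are as in Statement 5: an isotopy is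
recorded by a smooth ambient map `F : ℝ^m × ℝ → ℝ^m × ℝ^m × ℝ` parameterised by the
sphere (with `F₀` the inclusion of the zero section), whose time slices are embedded
Legendrian submanifolds.
-/

noncomputable section

open Set Metric
open scoped RealInnerProductSpace

/-- The unit sphere `S^{m-1} ⊂ ℝ^m`. -/
def sph (m : ℕ) : Set (EuclideanSpace ℝ (Fin m)) := Metric.sphere (0 : EuclideanSpace ℝ (Fin m)) 1

/-- Ambient model `ℝ^m × ℝ^m × ℝ` of the 1-jet space `J¹(S^{m-1})`. -/
abbrev JetSp (m : ℕ) := EuclideanSpace ℝ (Fin m) × EuclideanSpace ℝ (Fin m) × ℝ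

/-- `F : ℝ^m × ℝ → ℝ^m × ℝ^m × ℝ` represents a Legendrian isotopy `{Λ_t}_{t∈[0,1]}` in
`E = J¹(S^{m-1})` parameterised by the sphere: it is smooth, maps `S^{m-1} × [0,1]` into
`E`, each `F_t|_{S^{m-1}}` is an injective immersion (hence an embedding of the compact
sphere) onto `Λ_t`, and each `Λ_t` is Legendrian: every tangent vector `(w,v,a)` of
`Λ_t` satisfies `a = ⟨p,w⟩`. -/
structure IsLegIsotopyJet (m : ℕ) (F : EuclideanSpace ℝ (Fin m) × ℝ → JetSp m) : Prop where
  smooth : ContDiff ℝ (⊤ : ℕ∞) F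
  mem_sphere : ∀ s ∈ sph m, ∀ t ∈ Icc (0:ℝ) 1, (F (s, t)).1 ∈ sph m
  mem_jet : ∀ s ∈ sph m, ∀ t ∈ Icc (0:ℝ) 1, ⟪(F (s, t)).2.1, (F (s, t)).1⟫ = 0
  inj : ∀ t ∈ Icc (0:ℝ) 1, InjOn (fun s => F (s, t)) (sph m)
  imm : ∀ t ∈ Icc (0:ℝ) 1, ∀ s ∈ sph m, ∀ v : EuclideanSpace ℝ (Fin m),
    ⟪v, s⟫ = 0 → v ≠ 0 → fderiv ℝ (fun s' => F (s', t)) s v ≠ 0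
  leg : ∀ t ∈ Icc (0:ℝ) 1, ∀ s ∈ sph m, ∀ v : EuclideanSpace ℝ (Fin m), ⟪v, s⟫ = 0 →
    (fderiv ℝ (fun s' => F (s', t)) s v).2.2
      = ⟪(F (s, t)).2.1, (fderiv ℝ (fun s' => F (s', t)) s v).1⟫

/-- Non-negativity of the Legendrian isotopy: `∂u/∂t - ⟨p, ∂q/∂t⟩ ≥ 0`. -/
def NonnegJet (m : ℕ) (F : EuclideanSpace ℝ (Fin m) × ℝ → JetSp m) : Prop :=
  ∀ s ∈ sph m, ∀ t ∈ Icc (0:ℝ) 1,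
    0 ≤ deriv (fun t' => (F (s, t')).2.2) t
        - ⟪(F (s, t)).2.1, deriv (fun t' => (F (s, t')).1) t⟫

/-- The gradient of `f` along the sphere (round metric): tangential part of the ambient
gradient; it depends only on `f|_{S^{m-1}}`. -/
def sphGrad (m : ℕ) (f : EuclideanSpace ℝ (Fin m) → ℝ) (q : EuclideanSpace ℝ (Fin m)) :
    EuclideanSpace ℝ (Fin m) :=
  gradient f q - ⟪gradient f q, q⟫ • q

/-- The 1-jet graph `Λ^f = {(q, ∇f(q), f(q)) : q ∈ S^{m-1}} ⊂ E`. -/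
def jetGraph (m : ℕ) (f : EuclideanSpace ℝ (Fin m) → ℝ) : Set (JetSp m) :=
  (fun q => (q, sphGrad m f q, f q)) '' sph m

/-- The slice `Λ_t = F_t(S^{m-1})` of the isotopy. -/
def jetSlice (m : ℕ) (F : EuclideanSpace ℝ (Fin m) × ℝ → JetSp m) (t : ℝ) : Set (JetSp m) :=
  (fun s => F (s, t)) '' sph m

/-- The zero section `Λ⁰ = {(q,0,0) : q ∈ S^{m-1}} ⊂ E`. -/
def zeroSection (m : ℕ) : Set (JetSp m) :=
  (fun q => (q, (0 : EuclideanSpace ℝ (Fin m)), (0 : ℝ))) '' sph m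

namespace LegendrianIsotopy

section Brouwer

open MeasureTheory Polynomial in
/-- Value at `1` of a polynomial of degree at most `n` recovered from small nodes. -/
lemma exists_interpolation_weights (n : ℕ) {t₀ : ℝ} (ht₀ : 0 < t₀) :
    ∃ τ w : Fin (n + 1) → ℝ, (∀ j, 0 < τ j ∧ τ j < t₀) ∧
      ∀ p : ℝ[X], p.natDegree ≤ n → p.eval 1 = ∑ j, w j * p.eval (τ j) := by
  set τ : Fin (n + 1) → ℝ := fun j => t₀ / (j + 2) with hτ
  have hinj : Function.Injective τ := by
    intro i j hij
    have h1 : (0 : ℝ) < (i : ℝ) + 2 := by positivity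
    have h2 : (0 : ℝ) < (j : ℝ) + 2 := by positivity
    have h3 : t₀ / ((i : ℝ) + 2) = t₀ / ((j : ℝ) + 2) := hij
    rw [div_eq_div_iff h1.ne' h2.ne'] at h3
    have h4 := mul_left_cancel₀ ht₀.ne' h3
    have h5 : (i : ℝ) = j := by linarith
    exact Fin.ext (by exact_mod_cast h5)
  refine ⟨τ, fun j => (Lagrange.basis Finset.univ τ j).eval 1, fun j => ⟨by positivity, ?_⟩, ?_⟩
  · exact div_lt_self ht₀ (by have : (0 : ℝ) ≤ (j : ℝ) := by positivity
                              linarith)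
  · intro p hp
    have hdeg : p.degree < (Finset.univ : Finset (Fin (n + 1))).card := by
      rw [Finset.card_univ, Fintype.card_fin]
      exact lt_of_le_of_lt degree_le_natDegree (by exact_mod_cast Nat.lt_succ_of_le hp)
    conv_lhs => rw [Lagrange.eq_interpolate hinj.injOn hdeg, Lagrange.interpolate_apply]
    simp [eval_finsetSum, mul_comm]

variable {E : Type*} [NormedAddCommGroup E] [NormedSpace ℝ E] [FiniteDimensional ℝ E]

open Polynomial in
lemma exists_polynomial_det_one_add_smul (A : E →L[ℝ] E) :
    ∃ p : ℝ[X], p.natDegree ≤ Module.finrank ℝ E ∧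
      ∀ t : ℝ, p.eval t = (ContinuousLinearMap.id ℝ E + t • A).det := by
  set b := Module.finBasis ℝ E
  set M := LinearMap.toMatrix b b (A : E →ₗ[ℝ] E)
  refine ⟨Matrix.det ((X : ℝ[X]) • M.map C + (1 : Matrix _ _ ℝ).map C), ?_, fun t => ?_⟩
  · simpa using natDegree_det_X_add_C_le M 1
  · rw [ContinuousLinearMap.det, ← LinearMap.det_toMatrix b]
    have : LinearMap.toMatrix b b ((ContinuousLinearMap.id ℝ E + t • A : E →L[ℝ] E) : E →ₗ[ℝ] E)
        = t • M + 1 := by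
      have h : ((ContinuousLinearMap.id ℝ E + t • A : E →L[ℝ] E) : E →ₗ[ℝ] E)
        = LinearMap.id + t • (A : E →ₗ[ℝ] E) := by ext; simp
      rw [h, map_add, map_smul, LinearMap.toMatrix_id, add_comm]
    rw [this, ← coe_evalRingHom, RingHom.map_det]
    congr 1
    ext i j
    change (evalRingHom t) (((X : ℝ[X]) • M.map C + (1 : Matrix _ _ ℝ).map C : Matrix _ _ ℝ[X]) i j)
      = t * M i j + (1 : Matrix _ _ ℝ) i j
    simp only [Matrix.add_apply, Matrix.smul_apply, Matrix.map_apply, smul_eq_mul, map_add,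
      map_mul, coe_evalRingHom, eval_X, eval_C]

omit [FiniteDimensional ℝ E] in
lemma exists_pos_forall_det_one_add_pos (K : ℝ) :
    ∃ t₀ > 0, ∀ t : ℝ, 0 < t → t < t₀ → ∀ A : E →L[ℝ] E, ‖A‖ ≤ K →
      0 < (ContinuousLinearMap.id ℝ E + t • A).det := by
  have hc : ContinuousAt (fun A : E →L[ℝ] E => (ContinuousLinearMap.id ℝ E + A).det) 0 :=
    (ContinuousLinearMap.continuous_det.comp (continuous_const.add continuous_id)).continuousAt
  have h0 : 0 < (ContinuousLinearMap.id ℝ E + (0 : E →L[ℝ] E)).det := by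
    simp [ContinuousLinearMap.det]
  obtain ⟨ε, hε, h⟩ := Metric.eventually_nhds_iff.1 (hc.eventually (lt_mem_nhds h0))
  refine ⟨ε / (|K| + 1), by positivity, fun t ht htt A hA => h ?_⟩
  rw [dist_zero_right, norm_smul, Real.norm_of_nonneg ht.le]
  calc t * ‖A‖ ≤ t * (|K| + 1) := by
        gcongr; linarith [le_abs_self K]
    _ < ε := by rwa [lt_div_iff₀ (by positivity)] at htt

open MeasureTheory in
/-- A perturbation of the identity which is trivial outside a ball cannot have everywhere
degenerate derivative inside the ball. -/
lemma exists_det_ne_zero_of_eq_zero_off_ball {u : E → E} {u' : E → E →L[ℝ] E} {K : NNReal}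
    {ρ : ℝ} (hρ : 0 < ρ) (hu : LipschitzWith K u) (h0 : ∀ x, x ∉ ball (0 : E) ρ → u x = 0)
    (hu' : ∀ x ∈ ball (0 : E) ρ, HasFDerivAt u (u' x) x) :
    ∃ x ∈ ball (0 : E) ρ, (ContinuousLinearMap.id ℝ E + u' x).det ≠ 0 := by
  let _ : MeasurableSpace E := borel E
  have _ : BorelSpace E := ⟨rfl⟩
  by_contra! hcon
  set μ : Measure E := Measure.addHaar
  rcases subsingleton_or_nontrivial E with hE | hE
  · have h1 := hcon 0 (by simpa using hρ)
    have : (ContinuousLinearMap.id ℝ E + u' 0) = ContinuousLinearMap.id ℝ E := Subsingleton.elim _ _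
    rw [this] at h1
    exact absurd h1 (by rw [ContinuousLinearMap.det]; simp [Module.finrank_zero_of_subsingleton])
  obtain ⟨t₁, ht₁, hdet⟩ := exists_pos_forall_det_one_add_pos (E := E) K
  set t₂ := min t₁ (1 / ((K : ℝ) + 1)) with ht₂
  have ht₂pos : 0 < t₂ := by positivity
  have key : ∀ t : ℝ, 0 < t → t < t₂ →
      IntegrableOn (fun x => (ContinuousLinearMap.id ℝ E + t • u' x).det) (ball 0 ρ) μ ∧
      ∫ x in ball 0 ρ, (ContinuousLinearMap.id ℝ E + t • u' x).det ∂μ = μ.real (ball 0 ρ) := by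
    intro t ht htt
    set f : E → E := fun x => x + t • u x with hf
    have hK : ∀ x ∈ ball (0 : E) ρ, ‖u' x‖ ≤ K := fun x hx =>
      (hu' x hx).le_of_lipschitz hu
    have hpos : ∀ x ∈ ball (0 : E) ρ, 0 < (ContinuousLinearMap.id ℝ E + t • u' x).det :=
      fun x hx => hdet t ht (htt.trans_le (min_le_left _ _)) _ (hK x hx)
    have happ : ApproximatesLinearOn f ((ContinuousLinearEquiv.refl ℝ E : E ≃L[ℝ] E) : E →L[ℝ] E)
        univ (⟨t, ht.le⟩ * K) := by
      intro x _ y _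
      have : f x - f y - ((ContinuousLinearEquiv.refl ℝ E : E ≃L[ℝ] E) : E →L[ℝ] E) (x - y)
          = t • (u x - u y) := by
        simp [hf, smul_sub]; abel
      rw [this, norm_smul, Real.norm_of_nonneg ht.le]
      have := hu.dist_le_mul x y
      rw [dist_eq_norm, dist_eq_norm] at this
      calc t * ‖u x - u y‖ ≤ t * (K * ‖x - y‖) := by gcongr
        _ = _ := by rw [← mul_assoc]; rfl
    have hsmall : (⟨t, ht.le⟩ * K : NNReal) <
        (‖((ContinuousLinearEquiv.refl ℝ E).symm : E →L[ℝ] E)‖₊)⁻¹ := by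
      have h1 : ‖((ContinuousLinearEquiv.refl ℝ E).symm : E →L[ℝ] E)‖₊ = 1 := by
        simp
      rw [h1, inv_one, ← NNReal.coe_lt_coe]
      have h2 : t < 1 / ((K : ℝ) + 1) := htt.trans_le (min_le_right _ _)
      rw [lt_div_iff₀ (by positivity)] at h2
      change t * (K : ℝ) < 1
      nlinarith
    have hinj : Function.Injective f := by
      have := happ.injOn (Or.inr hsmall)
      exact fun x y hxy => this (mem_univ x) (mem_univ y) hxy
    have hsurj : Function.Surjective f := happ.surjective (Or.inr hsmall)
    have hout : ∀ x, x ∉ ball (0 : E) ρ → f x = x := fun x hx => by simp [hf, h0 x hx]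
    have himg : f '' ball 0 ρ = ball 0 ρ := by
      apply Subset.antisymm
      · rintro _ ⟨x, hx, rfl⟩
        by_contra hfx
        have := hout _ hfx
        exact hfx ((hinj this).symm ▸ hx)
      · intro y hy
        obtain ⟨x, rfl⟩ := hsurj y
        by_contra hx
        have hxb : x ∉ ball (0 : E) ρ := fun h => hx ⟨x, h, rfl⟩
        exact hxb (hout x hxb ▸ hy)
    have hderiv : ∀ x ∈ ball (0 : E) ρ,
        HasFDerivWithinAt f (ContinuousLinearMap.id ℝ E + t • u' x) (ball 0 ρ) x := fun x hx =>
      ((hasFDerivAt_id x).add ((hu' x hx).const_smul t)).hasFDerivWithinAt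
    have hinteg := integrableOn_image_iff_integrableOn_abs_det_fderiv_smul μ measurableSet_ball
      hderiv hinj.injOn (fun _ => (1 : ℝ))
    have heq := integral_image_eq_integral_abs_det_fderiv_smul μ measurableSet_ball
      hderiv hinj.injOn (fun _ => (1 : ℝ))
    rw [himg] at hinteg heq
    have hcongr : EqOn (fun x => |(ContinuousLinearMap.id ℝ E + t • u' x).det| • (1 : ℝ))
        (fun x => (ContinuousLinearMap.id ℝ E + t • u' x).det) (ball 0 ρ) := fun x hx => by
      simp [abs_of_pos (hpos x hx)]
    refine ⟨(integrableOn_congr_fun hcongr measurableSet_ball).1 (hinteg.1 ?_), ?_⟩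
    · exact integrableOn_const (measure_ball_lt_top.ne)
    · rw [← setIntegral_congr_fun measurableSet_ball hcongr, ← heq]
      simp
  obtain ⟨τ, w, hτ, hw⟩ := exists_interpolation_weights (Module.finrank ℝ E) ht₂pos
  have hsum : ∑ j, w j = 1 := by
    have := hw 1 (by simp)
    simpa using this.symm
  have hzero : ∀ x ∈ ball (0 : E) ρ,
      ∑ j, w j * (ContinuousLinearMap.id ℝ E + τ j • u' x).det = 0 := by
    intro x hx
    obtain ⟨p, hp, hpe⟩ := exists_polynomial_det_one_add_smul (u' x)
    have := hw p hp
    simp only [hpe, one_smul] at this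
    rw [← this, hcon x hx]
  have h1 : ∫ x in ball (0 : E) ρ,
      ∑ j, w j * (ContinuousLinearMap.id ℝ E + τ j • u' x).det ∂μ = μ.real (ball 0 ρ) := by
    rw [integral_finsetSum _ fun j _ => (key (τ j) (hτ j).1 (hτ j).2).1.const_mul (w j)]
    simp_rw [integral_const_mul, (key _ (hτ _).1 (hτ _).2).2, ← Finset.sum_mul, hsum, one_mul]
  rw [setIntegral_congr_fun measurableSet_ball hzero] at h1
  simp only [integral_zero] at h1
  have h2 : 0 < μ.real (ball (0 : E) ρ) :=
    ENNReal.toReal_pos (measure_ball_pos μ 0 hρ).ne' measure_ball_lt_top.ne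
  exact h2.ne h1

omit [FiniteDimensional ℝ E] in
lemma lipschitzWith_indicator_ball {f : E → E} {K : NNReal} {ρ : ℝ}
    (hf : LipschitzOnWith K f (closedBall 0 ρ)) (h0 : ∀ x ∈ sphere (0 : E) ρ, f x = 0) :
    LipschitzWith K ((ball (0 : E) ρ).indicator f) := by
  have hmix : ∀ x ∈ ball (0 : E) ρ, ∀ y ∉ ball (0 : E) ρ, ‖f x‖ ≤ K * ‖x - y‖ := by
    intro x hx y hy
    obtain ⟨z, hz, hzρ⟩ : ∃ z ∈ segment ℝ x y, ‖z‖ = ρ := by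
      have := (convex_segment x y).isPreconnected.intermediate_value (left_mem_segment ℝ x y)
        (right_mem_segment ℝ x y) continuous_norm.continuousOn
      exact this ⟨(mem_ball_zero_iff.1 hx).le, by simpa using hy⟩
    have h1 := hf.dist_le_mul x (ball_subset_closedBall hx) z (by simp [hzρ])
    rw [h0 z (by simp [hzρ]), dist_zero_right] at h1
    refine h1.trans (mul_le_mul_of_nonneg_left ?_ K.2)
    rw [dist_eq_norm, norm_sub_rev x y, norm_sub_rev x z]
    exact norm_sub_le_of_mem_segment hz
  refine LipschitzWith.of_dist_le_mul fun x y => ?_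
  rw [dist_eq_norm, dist_eq_norm]
  by_cases hx : x ∈ ball (0 : E) ρ <;> by_cases hy : y ∈ ball (0 : E) ρ
  · rw [indicator_of_mem hx, indicator_of_mem hy, ← dist_eq_norm, ← dist_eq_norm]
    exact hf.dist_le_mul x (ball_subset_closedBall hx) y (ball_subset_closedBall hy)
  · rw [indicator_of_mem hx, indicator_of_notMem hy, sub_zero]
    exact hmix x hx y hy
  · rw [indicator_of_notMem hx, indicator_of_mem hy, zero_sub, norm_neg, norm_sub_rev]
    exact hmix y hy x hx
  · rw [indicator_of_notMem hx, indicator_of_notMem hy, sub_zero, norm_zero]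
    positivity

end Brouwer

section Zero

variable {W : Type*} [NormedAddCommGroup W] [InnerProductSpace ℝ W] [FiniteDimensional ℝ W]

lemma not_forall_ne_zero_of_contDiff {g : W → W} (hg : ContDiff ℝ 1 g) {ρ : ℝ} (hρ : 0 < ρ)
    (hid : ∀ y, ‖y‖ = ρ → g y = y) : ¬ ∀ y, g y ≠ 0 := by
  intro hne
  set r : W → W := fun y => (ρ / ‖g y‖) • g y with hr
  have hrs : ContDiff ℝ 1 r :=
    (contDiff_const.div (hg.norm ℝ hne) fun y => norm_ne_zero_iff.2 (hne y)).smul hg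
  have hrn : ∀ y, ‖r y‖ = ρ := fun y => by
    rw [hr, norm_smul, norm_div, norm_norm, Real.norm_of_nonneg hρ.le,
      div_mul_cancel₀ _ (norm_ne_zero_iff.2 (hne y))]
  have hrid : ∀ y ∈ sphere (0 : W) ρ, r y - y = 0 := by
    intro y hy
    have hy' : ‖y‖ = ρ := by simpa using hy
    simp only [hr, hid y hy', hy', div_self hρ.ne', one_smul, sub_self]
  have hloc : LocallyLipschitz fun y => r y - y := (hrs.sub contDiff_id).locallyLipschitz
  obtain ⟨K, hK⟩ :=
    (hloc.locallyLipschitzOn (s := closedBall (0 : W) ρ)).exists_lipschitzOnWith_of_compact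
      (isCompact_closedBall 0 ρ)
  obtain ⟨x, hx, hdet⟩ := exists_det_ne_zero_of_eq_zero_off_ball
    (u' := fun x => fderiv ℝ r x - ContinuousLinearMap.id ℝ W) hρ
    (lipschitzWith_indicator_ball hK hrid) (fun x hx => indicator_of_notMem hx _)
    (fun x hx => by
      have h1 : HasFDerivAt (fun y => r y - y) (fderiv ℝ r x - ContinuousLinearMap.id ℝ W) x :=
        (hrs.differentiable one_ne_zero x).hasFDerivAt.sub (hasFDerivAt_id x)
      refine h1.congr_of_eventuallyEq ?_
      filter_upwards [isOpen_ball.mem_nhds hx] with y hy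
      exact indicator_of_mem hy _)
  rw [add_sub_cancel] at hdet
  have hdr := (hrs.differentiable one_ne_zero x).hasFDerivAt
  have horth : ∀ v, ⟪r x, fderiv ℝ r x v⟫ = 0 := by
    intro v
    have h1 := hdr.norm_sq
    have h2 : (fun y => ‖r y‖ ^ 2) = fun _ => ρ ^ 2 := by ext y; rw [hrn]
    rw [h2] at h1
    have h3 := congrArg (fun L : W →L[ℝ] ℝ => L v) (h1.unique (hasFDerivAt_const _ _))
    simpa using h3
  obtain ⟨v, hv⟩ := (LinearMap.equivOfDetNeZero _ hdet).surjective (r x)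
  have h4 := horth v
  have h5 : fderiv ℝ r x v = r x := hv
  rw [h5, real_inner_self_eq_norm_sq, hrn] at h4
  exact (pow_pos hρ 2).ne' h4

open scoped Manifold ContDiff in
/-- A continuous self-map at bounded distance from the identity has a zero. -/
lemma exists_eq_zero_of_norm_sub_le {g : W → W} (hg : Continuous g) {R : ℝ}
    (hR : ∀ y, ‖g y - y‖ ≤ R) : ∃ y, g y = 0 := by
  by_contra! hne
  have hR0 : 0 ≤ R := (norm_nonneg _).trans (hR 0)
  obtain ⟨y₀, -, hy₀⟩ := (isCompact_closedBall (0 : W) (R + 1)).exists_isMinOn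
    ⟨0, by simp; linarith⟩ hg.norm.continuousOn
  set δ := min 1 ‖g y₀‖ with hδ
  have hδ0 : 0 < δ := lt_min one_pos (norm_pos_iff.2 (hne _))
  have hδg : ∀ y, δ ≤ ‖g y‖ := by
    intro y
    by_cases hy : y ∈ closedBall (0 : W) (R + 1)
    · exact (min_le_right _ _).trans (hy₀ hy)
    · have h1 : R + 1 < ‖y‖ := by simpa using hy
      have h2 := norm_sub_norm_le y (g y)
      rw [norm_sub_rev] at h2
      exact (min_le_left _ _).trans (by linarith [hR y])
  obtain ⟨g₁, hg₁⟩ := exists_contMDiffMap_forall_mem_convex_of_local_const (n := (⊤ : ℕ∞)) 𝓘(ℝ, W)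
    (t := fun x => ball (g x) (δ / 2)) (fun x => convex_ball _ _)
    (fun x => ⟨g x, by
      filter_upwards [hg.continuousAt.eventually (ball_mem_nhds (g x) (half_pos hδ0))] with y hy
      exact mem_ball_comm.1 hy⟩)
  have hg₁s : ContDiff ℝ 1 g₁ := g₁.contMDiff.contDiff.of_le (by exact_mod_cast le_top)
  set R' := R + 1 with hR'
  have hb : ∀ y, ‖g₁ y - y‖ ≤ R' := by
    intro y
    have h1 : ‖g₁ y - g y‖ < δ / 2 := by simpa [dist_eq_norm] using hg₁ y
    have h2 := norm_sub_le_norm_sub_add_norm_sub (g₁ y) (g y) y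
    linarith [hR y, min_le_left 1 ‖g y₀‖]
  have hg₁ne : ∀ y, g₁ y ≠ 0 := by
    intro y hy
    have h1 : ‖g₁ y - g y‖ < δ / 2 := by simpa [dist_eq_norm] using hg₁ y
    rw [hy, zero_sub, norm_neg] at h1
    linarith [hδg y]
  let χ : ContDiffBump (0 : W) := ⟨R' + 1, R' + 2, by linarith, by linarith⟩
  refine not_forall_ne_zero_of_contDiff (g := fun y => y + χ y • (g₁ y - y)) (ρ := R' + 2)
    (contDiff_id.add (χ.contDiff.smul (hg₁s.sub contDiff_id))) (by linarith) ?_ ?_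
  · intro y hy
    rw [χ.zero_of_le_dist (by rw [dist_zero_right, hy]), zero_smul, add_zero]
  · intro y
    rcases le_or_gt ‖y‖ (R' + 1) with hy | hy
    · rw [χ.one_of_mem_closedBall (by simpa using hy)]
      simpa using hg₁ne y
    · intro h0
      have h1 : ‖χ y • (g₁ y - y)‖ ≤ R' := by
        rw [norm_smul, Real.norm_of_nonneg χ.nonneg]
        exact (mul_le_of_le_one_left (norm_nonneg _) χ.le_one).trans (hb y)
      rw [← norm_neg, ← eq_neg_of_add_eq_zero_left h0] at h1
      linarith

end Zero

section Minimax

variable {V W : Type*} [NormedAddCommGroup V] [InnerProductSpace ℝ V] [FiniteDimensional ℝ V]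
  [NormedAddCommGroup W] [InnerProductSpace ℝ W] [FiniteDimensional ℝ W]

/-- A family of triples over `W` linking the antidiagonal: at bounded distance from
`w ↦ (w, -w)` in the last two components. -/
structure IsLinked (a : W → V) (b c : W → W) : Prop where
  cont_a : Continuous a
  cont_b : Continuous b
  cont_c : Continuous c
  norm_a : ∀ w, ‖a w‖ = 1
  bdd : ∃ R, ∀ w, ‖b w - w‖ ≤ R ∧ ‖c w + w‖ ≤ R

/-- Upper bounds of `Φ` along linking families. -/
def linkedBounds (Φ : V → W → W → ℝ) : Set ℝ :=
  {M | ∃ (a : W → V) (b c : W → W), IsLinked a b c ∧ ∀ w, Φ (a w) (b w) (c w) ≤ M}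

/-- The minimax value of `Φ` over linking families. -/
def minimax (Φ : V → W → W → ℝ) : ℝ := sInf (linkedBounds Φ)

omit [InnerProductSpace ℝ V] [FiniteDimensional ℝ V] in
lemma IsLinked.exists_eq {a : W → V} {b c : W → W} (h : IsLinked a b c) : ∃ w, b w = c w := by
  obtain ⟨R, hR⟩ := h.bdd
  obtain ⟨w, hw⟩ := exists_eq_zero_of_norm_sub_le
    (g := fun w => (1 / 2 : ℝ) • (b w - c w)) (by have := h.cont_b; have := h.cont_c; fun_prop)
    (R := R) (fun w => by
      have h1 : (1 / 2 : ℝ) • (b w - c w) - w = (1 / 2 : ℝ) • ((b w - w) - (c w + w)) := by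
        module
      rw [h1, norm_smul, Real.norm_of_nonneg (by norm_num)]
      linarith [norm_sub_le (b w - w) (c w + w), (hR w).1, (hR w).2])
  refine ⟨w, sub_eq_zero.1 ?_⟩
  simpa using hw

omit [InnerProductSpace ℝ V] [FiniteDimensional ℝ V] in
lemma le_of_mem_linkedBounds {Φ : V → W → W → ℝ} {c M : ℝ}
    (hΦ : ∀ v y η, ‖v‖ = 1 → ⟪y, η⟫ + c ≤ Φ v y η) (hM : M ∈ linkedBounds Φ) : c ≤ M := by
  obtain ⟨a, b, d, hl, hM⟩ := hM
  obtain ⟨w, hw⟩ := hl.exists_eq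
  have h1 := hΦ (a w) (b w) (d w) (hl.norm_a w)
  rw [← hw, real_inner_self_eq_norm_sq] at h1
  have h2 := hM w
  rw [← hw] at h2
  linarith [sq_nonneg ‖b w‖]

omit [InnerProductSpace ℝ V] [FiniteDimensional ℝ V] [FiniteDimensional ℝ W] in
lemma linkedBounds_nonempty {Φ : V → W → W → ℝ} {L : ℝ} {e : V} (he : ‖e‖ = 1)
    (hΦ : ∀ v y η, ‖v‖ = 1 → Φ v y η ≤ ⟪y, η⟫ + L) : (linkedBounds Φ).Nonempty := by
  refine ⟨L, fun _ => e, id, fun w => -w, ⟨continuous_const, continuous_id, continuous_neg,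
    fun _ => he, 0, fun w => by simp⟩, fun w => (hΦ _ _ _ he).trans ?_⟩
  simp only [id, inner_neg_right, real_inner_self_eq_norm_sq]
  linarith [sq_nonneg ‖w‖]

omit [InnerProductSpace ℝ V] [FiniteDimensional ℝ V] in
lemma le_minimax {Φ : V → W → W → ℝ} {c L : ℝ} {e : V} (he : ‖e‖ = 1)
    (hΦ : ∀ v y η, ‖v‖ = 1 → ⟪y, η⟫ + c ≤ Φ v y η)
    (hL : ∀ v y η, ‖v‖ = 1 → Φ v y η ≤ ⟪y, η⟫ + L) : c ≤ minimax Φ :=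
  le_csInf (linkedBounds_nonempty he hL) fun _ => le_of_mem_linkedBounds hΦ

omit [InnerProductSpace ℝ V] [FiniteDimensional ℝ V] in
lemma minimax_le_minimax {Φ Φ' : V → W → W → ℝ} {c L : ℝ} {e : V} (he : ‖e‖ = 1)
    (hΦ : ∀ v y η, ‖v‖ = 1 → ⟪y, η⟫ + c ≤ Φ v y η)
    (hL : ∀ v y η, ‖v‖ = 1 → Φ' v y η ≤ ⟪y, η⟫ + L)
    (hle : ∀ v y η, ‖v‖ = 1 → Φ e y η ≤ Φ' v y η) : minimax Φ ≤ minimax Φ' := by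
  refine csInf_le_csInf ⟨c, fun _ => le_of_mem_linkedBounds hΦ⟩ (linkedBounds_nonempty he hL) ?_
  rintro M ⟨a, b, d, hl, hM⟩
  exact ⟨fun _ => e, b, d, ⟨continuous_const, hl.cont_b, hl.cont_c, fun _ => he, hl.bdd⟩,
    fun w => (hle _ _ _ (hl.norm_a w)).trans (hM w)⟩

/-- Functions that differ from `⟪y, η⟫` by a bounded amount, with gradient data and a one-sided
second order bound. -/
structure IsTame (L : ℝ) (Φ : V → W → W → ℝ) (gv : V → W → W → V) (gy gη : V → W → W → W) :
    Prop where
  cont : Continuous fun z : V × W × W => Φ z.1 z.2.1 z.2.2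
  cont_gv : Continuous fun z : V × W × W => gv z.1 z.2.1 z.2.2
  cont_gy : Continuous fun z : V × W × W => gy z.1 z.2.1 z.2.2
  cont_gη : Continuous fun z : V × W × W => gη z.1 z.2.1 z.2.2
  bound : ∀ v y η, ‖v‖ = 1 → |Φ v y η - ⟪y, η⟫| ≤ L
  bound_gv : ∀ v y η, ‖v‖ = 1 → ‖gv v y η‖ ≤ L
  bound_gy : ∀ v y η, ‖v‖ = 1 → ‖gy v y η - η‖ ≤ L
  bound_gη : ∀ v y η, ‖v‖ = 1 → ‖gη v y η - y‖ ≤ L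
  quad : ∀ v y η v' y' η', ‖v‖ = 1 → ‖v'‖ = 1 → Φ v' y' η' ≤ Φ v y η + ⟪gv v y η, v' - v⟫
    + ⟪gy v y η, y' - y⟫ + ⟪gη v y η, η' - η⟫
    + L * (‖v' - v‖ ^ 2 + ‖y' - y‖ ^ 2 + ‖η' - η‖ ^ 2)

omit [FiniteDimensional ℝ V] in
/-- Moving along a tangent direction and projecting back to the unit sphere. -/
lemma normalize_sub_estimates {v w : V} (hv : ‖v‖ = 1) (hvw : ⟪v, w⟫ = 0) (θ : ℝ) :
    ‖‖v - θ • w‖⁻¹ • (v - θ • w)‖ = 1 ∧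
    ‖‖v - θ • w‖⁻¹ • (v - θ • w) - (v - θ • w)‖ ≤ θ ^ 2 * ‖w‖ ^ 2 ∧
    ‖‖v - θ • w‖⁻¹ • (v - θ • w) - v‖ ^ 2 ≤ 4 * (θ ^ 2 * ‖w‖ ^ 2) := by
  set u := v - θ • w with hu
  have hsq : ‖u‖ ^ 2 = 1 + θ ^ 2 * ‖w‖ ^ 2 := by
    rw [hu, norm_sub_sq_real, inner_smul_right, hvw, hv, norm_smul, mul_pow, Real.norm_eq_abs,
      sq_abs]
    ring
  have hu1 : 1 ≤ ‖u‖ := by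
    have : 0 ≤ θ ^ 2 * ‖w‖ ^ 2 := by positivity
    nlinarith [norm_nonneg u]
  have hne : ‖u‖ ≠ 0 := by positivity
  have h1 : ‖‖u‖⁻¹ • u - u‖ = ‖u‖ - 1 := by
    have : ‖u‖⁻¹ • u - u = (‖u‖⁻¹ - 1) • u := by module
    rw [this, norm_smul, Real.norm_of_nonpos (by linarith [inv_le_one_of_one_le₀ hu1])]
    field_simp
    ring
  refine ⟨by rw [norm_smul, norm_inv, norm_norm, inv_mul_cancel₀ hne], ?_, ?_⟩
  · rw [h1]; nlinarith
  · have h2 : ‖u - v‖ = |θ| * ‖w‖ := by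
      rw [hu, sub_sub_cancel_left, norm_neg, norm_smul, Real.norm_eq_abs]
    have h3 : ‖u‖ - 1 ≤ ‖u - v‖ := by rw [← hv]; exact norm_sub_norm_le u v
    have h4 := norm_sub_le_norm_sub_add_norm_sub (‖u‖⁻¹ • u) u v
    rw [h1] at h4
    have h5 : ‖‖u‖⁻¹ • u - v‖ ≤ 2 * (|θ| * ‖w‖) := by linarith
    calc _ ≤ (2 * (|θ| * ‖w‖)) ^ 2 := by gcongr
      _ = _ := by rw [mul_pow, mul_pow, sq_abs]; ring

variable {L : ℝ} {Φ : V → W → W → ℝ} {gv : V → W → W → V} {gy gη : V → W → W → W}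

/-- The component of the gradient `gv` tangent to the unit sphere. -/
def tang (gv : V → W → W → V) (v : V) (y η : W) : V := gv v y η - ⟪gv v y η, v⟫ • v

/-- Squared norm of the gradient along `sphere × W × W`. -/
def sqGrad (gv : V → W → W → V) (gy gη : V → W → W → W) (v : V) (y η : W) : ℝ :=
  ‖tang gv v y η‖ ^ 2 + ‖gy v y η‖ ^ 2 + ‖gη v y η‖ ^ 2

omit [FiniteDimensional ℝ V] [FiniteDimensional ℝ W] in
/-- One gradient step. -/
lemma IsTame.step (h : IsTame L Φ gv gy gη) {v : V} {y η : W} (hv : ‖v‖ = 1) {θ : ℝ}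
    (hθ : 0 ≤ θ) (hθL : 10 * L * θ ≤ 1) :
    Φ (‖v - θ • tang gv v y η‖⁻¹ • (v - θ • tang gv v y η)) (y - θ • gy v y η) (η - θ • gη v y η)
      ≤ Φ v y η - θ * sqGrad gv gy gη v y η / 2 := by
  have hL : 0 ≤ L := (norm_nonneg _).trans (h.bound_gv v y η hv)
  set w := tang gv v y η with hw
  have hvw : ⟪v, w⟫ = 0 := by
    rw [hw, tang, inner_sub_right, inner_smul_right, real_inner_self_eq_norm_sq, hv,
      real_inner_comm]
    ring
  have hgw : ⟪gv v y η, w⟫ = ‖w‖ ^ 2 := by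
    have : gv v y η = w + ⟪gv v y η, v⟫ • v := by rw [hw, tang]; module
    conv_lhs => rw [this, inner_add_left, inner_smul_left, hvw, real_inner_self_eq_norm_sq]
    ring
  obtain ⟨h1, h2, h3⟩ := normalize_sub_estimates hv hvw θ
  set v' := ‖v - θ • w‖⁻¹ • (v - θ • w) with hv'
  have hq := h.quad v y η v' (y - θ • gy v y η) (η - θ • gη v y η) hv h1
  have e1 : ⟪gv v y η, v' - v⟫ ≤ -θ * ‖w‖ ^ 2 + L * (θ ^ 2 * ‖w‖ ^ 2) := by
    have : v' - v = (v' - (v - θ • w)) - θ • w := by abel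
    rw [this, inner_sub_right, inner_smul_right, hgw]
    have h4 := real_inner_le_norm (gv v y η) (v' - (v - θ • w))
    have h5 : ‖gv v y η‖ * ‖v' - (v - θ • w)‖ ≤ L * (θ ^ 2 * ‖w‖ ^ 2) := by
      gcongr; exact h.bound_gv v y η hv
    linarith
  have e2 : ∀ g x : W, ⟪g, x - θ • g - x⟫ = -θ * ‖g‖ ^ 2 := fun g x => by
    rw [sub_sub_cancel_left, inner_neg_right, inner_smul_right, real_inner_self_eq_norm_sq]; ring
  have e3 : ∀ g x : W, ‖x - θ • g - x‖ ^ 2 = θ ^ 2 * ‖g‖ ^ 2 := fun g x => by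
    rw [sub_sub_cancel_left, norm_neg, norm_smul, mul_pow, Real.norm_eq_abs, sq_abs]
  rw [e2, e2, e3, e3] at hq
  refine hq.trans ?_
  rw [sqGrad, ← hw]
  set A := ‖w‖ ^ 2
  set B := ‖gy v y η‖ ^ 2
  set C := ‖gη v y η‖ ^ 2
  have hA : 0 ≤ A := by positivity
  have hB : 0 ≤ B := by positivity
  have hC : 0 ≤ C := by positivity
  have e4 : L * ‖v' - v‖ ^ 2 ≤ L * (4 * (θ ^ 2 * A)) := by gcongr
  have e5 : 10 * L * θ * (θ * A) ≤ 1 * (θ * A) := by gcongr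
  have e6 : 10 * L * θ * (θ * B) ≤ 1 * (θ * B) := by gcongr
  have e7 : 10 * L * θ * (θ * C) ≤ 1 * (θ * C) := by gcongr
  nlinarith [mul_nonneg hθ hA, mul_nonneg hθ hB, mul_nonneg hθ hC]

omit [FiniteDimensional ℝ V] [FiniteDimensional ℝ W] in
lemma IsTame.continuous_tang (h : IsTame L Φ gv gy gη) :
    Continuous fun z : V × W × W => tang gv z.1 z.2.1 z.2.2 :=
  h.cont_gv.sub ((h.cont_gv.inner continuous_fst).smul continuous_fst)

omit [FiniteDimensional ℝ V] [FiniteDimensional ℝ W] in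
lemma IsTame.continuous_sqGrad (h : IsTame L Φ gv gy gη) :
    Continuous fun z : V × W × W => sqGrad gv gy gη z.1 z.2.1 z.2.2 :=
  ((h.continuous_tang.norm.pow 2).add (h.cont_gy.norm.pow 2)).add (h.cont_gη.norm.pow 2)

lemma IsTame.exists_pos_le (h : IsTame L Φ gv gy gη) {e : V} (he : ‖e‖ = 1) {c : ℝ}
    (hne : ∀ v y η, ‖v‖ = 1 → Φ v y η = c → sqGrad gv gy gη v y η ≠ 0) :
    ∃ δ > 0, ∀ v y η, ‖v‖ = 1 → δ ≤ |Φ v y η - c| + sqGrad gv gy gη v y η := by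
  have hL : 0 ≤ L := (norm_nonneg _).trans (h.bound_gv e 0 0 he)
  have hnn : ∀ v y η, 0 ≤ sqGrad gv gy gη v y η := fun v y η => by rw [sqGrad]; positivity
  obtain ⟨z₀, hz₀, hmin⟩ := ((isCompact_sphere (0 : V) 1).prod
    ((isCompact_closedBall (0 : W) (L + 1)).prod
      (isCompact_closedBall (0 : W) (L + 1)))).exists_isMinOn
    (f := fun z : V × W × W => |Φ z.1 z.2.1 z.2.2 - c| + sqGrad gv gy gη z.1 z.2.1 z.2.2)
    ⟨(e, 0, 0), by simp [he]; linarith⟩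
    (((h.cont.sub continuous_const).abs).add h.continuous_sqGrad).continuousOn
  have hpos : 0 < |Φ z₀.1 z₀.2.1 z₀.2.2 - c| + sqGrad gv gy gη z₀.1 z₀.2.1 z₀.2.2 := by
    by_cases hc : Φ z₀.1 z₀.2.1 z₀.2.2 = c
    · have := (hnn z₀.1 z₀.2.1 z₀.2.2).lt_of_ne'
        (hne _ _ _ (by simpa using hz₀.1) hc)
      positivity
    · exact add_pos_of_pos_of_nonneg (abs_pos.2 (sub_ne_zero.2 hc)) (hnn _ _ _)
  refine ⟨_, lt_min one_pos hpos, fun v y η hv => ?_⟩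
  by_cases hz : (v, y, η) ∈
      sphere (0 : V) 1 ×ˢ closedBall (0 : W) (L + 1) ×ˢ closedBall (0 : W) (L + 1)
  · exact (min_le_right _ _).trans (hmin hz)
  · refine (min_le_left _ _).trans (le_add_of_nonneg_of_le (abs_nonneg _) ?_)
    rw [sqGrad]
    by_cases hy : ‖y‖ ≤ L + 1
    · have hη : L + 1 < ‖η‖ := by
        by_contra! hη
        exact hz ⟨by simpa using hv, by simpa using hy, by simpa using hη⟩
      have h1 := norm_sub_norm_le η (gy v y η)
      rw [norm_sub_rev] at h1
      have h2 : 1 ≤ ‖gy v y η‖ := by linarith [h.bound_gy v y η hv]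
      nlinarith [sq_nonneg ‖tang gv v y η‖, sq_nonneg ‖gη v y η‖]
    · have h1 := norm_sub_norm_le y (gη v y η)
      rw [norm_sub_rev] at h1
      have h2 : 1 ≤ ‖gη v y η‖ := by linarith [h.bound_gη v y η hv]
      nlinarith [sq_nonneg ‖tang gv v y η‖, sq_nonneg ‖gy v y η‖]

/-- The minimax value is a critical value. -/
theorem IsTame.exists_critical (h : IsTame L Φ gv gy gη) {e : V} (he : ‖e‖ = 1) :
    ∃ v y η, ‖v‖ = 1 ∧ Φ v y η = minimax Φ ∧ tang gv v y η = 0 ∧ gy v y η = 0 ∧ gη v y η = 0 := by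
  by_contra! hcon
  have hL : 0 ≤ L := (norm_nonneg _).trans (h.bound_gv e 0 0 he)
  have hnn : ∀ v y η, 0 ≤ sqGrad gv gy gη v y η := fun v y η => by rw [sqGrad]; positivity
  obtain ⟨δ, hδ, hle⟩ := h.exists_pos_le he (c := minimax Φ) (by
    intro v y η hv hc h0
    rw [sqGrad] at h0
    have h1 := sq_nonneg ‖tang gv v y η‖
    have h2 := sq_nonneg ‖gy v y η‖
    have h3 := sq_nonneg ‖gη v y η‖
    exact hcon v y η hv hc (norm_eq_zero.1 (pow_eq_zero_iff two_ne_zero |>.1 (by linarith)))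
      (norm_eq_zero.1 (pow_eq_zero_iff two_ne_zero |>.1 (by linarith)))
      (norm_eq_zero.1 (pow_eq_zero_iff two_ne_zero |>.1 (by linarith))))
  set τ : ℝ := 1 / (10 * L + 1) with hτ
  have hτ0 : 0 < τ := by positivity
  have hτ1 : τ ≤ 1 := by rw [hτ, div_le_one (by positivity)]; linarith
  have hτL : 10 * L * τ ≤ 1 := by
    rw [hτ, mul_one_div, div_le_one (by positivity)]; linarith
  set κ := (δ / 2) / (1 + δ / 2) with hκ
  have hκ0 : 0 < κ := by positivity
  set ε := min (δ / 2) (τ * κ / 2) / 2 with hε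
  have hε0 : 0 < ε := by positivity
  have hε1 : ε < δ / 2 := by
    have : min (δ / 2) (τ * κ / 2) ≤ δ / 2 := min_le_left _ _
    rw [hε]; linarith
  have hε2 : ε < τ * κ / 2 := by
    have h1 : min (δ / 2) (τ * κ / 2) ≤ τ * κ / 2 := min_le_right _ _
    have h2 : 0 < τ * κ / 2 := by positivity
    rw [hε]; linarith
  have hbelow : BddBelow (linkedBounds Φ) := ⟨-L, fun M => le_of_mem_linkedBounds
    fun v y η hv => by linarith [(abs_le.1 (h.bound v y η hv)).1]⟩
  have hnon : (linkedBounds Φ).Nonempty := linkedBounds_nonempty he (L := L)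
    fun v y η hv => by linarith [(abs_le.1 (h.bound v y η hv)).2]
  obtain ⟨M, ⟨a, b, c, hl, hM⟩, hMlt⟩ := exists_lt_of_csInf_lt hnon
    (show sInf (linkedBounds Φ) < minimax Φ + ε by rw [minimax]; linarith)
  set θ : W → ℝ := fun w => τ * (1 + sqGrad gv gy gη (a w) (b w) (c w))⁻¹ with hθ
  have hpos : ∀ w, 0 < 1 + sqGrad gv gy gη (a w) (b w) (c w) := fun w => by
    linarith [hnn (a w) (b w) (c w)]
  have hθ0 : ∀ w, 0 < θ w := fun w => mul_pos hτ0 (inv_pos.2 (hpos w))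
  have hθ1 : ∀ w, θ w ≤ τ := fun w =>
    mul_le_of_le_one_right hτ0.le (inv_le_one_of_one_le₀ (by linarith [hnn (a w) (b w) (c w)]))
  have hcz : Continuous fun w => (a w, b w, c w) :=
    hl.cont_a.prodMk (hl.cont_b.prodMk hl.cont_c)
  have cS : Continuous fun w => sqGrad gv gy gη (a w) (b w) (c w) := h.continuous_sqGrad.comp hcz
  have cθ : Continuous θ :=
    continuous_const.mul ((continuous_const.add cS).inv₀ fun w => (hpos w).ne')
  have cT : Continuous fun w => tang gv (a w) (b w) (c w) := h.continuous_tang.comp hcz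
  have cy : Continuous fun w => gy (a w) (b w) (c w) := h.cont_gy.comp hcz
  have cη : Continuous fun w => gη (a w) (b w) (c w) := h.cont_gη.comp hcz
  have hstep : ∀ w (g : W), ‖g‖ ^ 2 ≤ sqGrad gv gy gη (a w) (b w) (c w) → ‖θ w • g‖ ≤ 1 := by
    intro w g hg
    rw [norm_smul, Real.norm_of_nonneg (hθ0 w).le]
    have h1 : ‖g‖ ≤ 1 + sqGrad gv gy gη (a w) (b w) (c w) := by nlinarith [sq_nonneg (‖g‖ - 1)]
    calc _ ≤ 1 * (1 + sqGrad gv gy gη (a w) (b w) (c w))⁻¹ *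
          (1 + sqGrad gv gy gη (a w) (b w) (c w)) := by
          have h2 : θ w ≤ 1 * (1 + sqGrad gv gy gη (a w) (b w) (c w))⁻¹ :=
            mul_le_mul_of_nonneg_right hτ1 (inv_pos.2 (hpos w)).le
          exact mul_le_mul h2 h1 (norm_nonneg _) (by have := hpos w; positivity)
      _ = 1 := by rw [one_mul, inv_mul_cancel₀ (hpos w).ne']
  have horth : ∀ w, ⟪a w, tang gv (a w) (b w) (c w)⟫ = 0 := fun w => by
    rw [tang, inner_sub_right, inner_smul_right, real_inner_self_eq_norm_sq, hl.norm_a,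
      real_inner_comm]
    ring
  have hnorm := fun w => (normalize_sub_estimates (hl.norm_a w) (horth w) (θ w)).1
  have hmem : max (minimax Φ + ε - τ * κ / 2) (minimax Φ - δ / 2) ∈ linkedBounds Φ := by
    refine ⟨fun w => ‖a w - θ w • tang gv (a w) (b w) (c w)‖⁻¹ •
        (a w - θ w • tang gv (a w) (b w) (c w)), fun w => b w - θ w • gy (a w) (b w) (c w),
      fun w => c w - θ w • gη (a w) (b w) (c w), ⟨?_, hl.cont_b.sub (cθ.smul cy),
        hl.cont_c.sub (cθ.smul cη), hnorm, ?_⟩, fun w => ?_⟩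
    · have hcu : Continuous fun w => a w - θ w • tang gv (a w) (b w) (c w) :=
        hl.cont_a.sub (cθ.smul cT)
      refine (hcu.norm.inv₀ fun w h0 => ?_).smul hcu
      have := hnorm w
      rw [h0, inv_zero, zero_smul, norm_zero] at this
      exact zero_ne_one this
    · obtain ⟨R, hR⟩ := hl.bdd
      refine ⟨R + 1, fun w => ⟨?_, ?_⟩⟩
      · have e1 := hstep w (gy (a w) (b w) (c w)) (by
          rw [sqGrad]; nlinarith [sq_nonneg ‖tang gv (a w) (b w) (c w)‖,
            sq_nonneg ‖gη (a w) (b w) (c w)‖])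
        rw [sub_right_comm]
        exact (norm_sub_le _ _).trans (add_le_add (hR w).1 e1)
      · have e1 := hstep w (gη (a w) (b w) (c w)) (by
          rw [sqGrad]; nlinarith [sq_nonneg ‖tang gv (a w) (b w) (c w)‖,
            sq_nonneg ‖gy (a w) (b w) (c w)‖])
        rw [sub_add_eq_add_sub]
        exact (norm_sub_le _ _).trans (add_le_add (hR w).2 e1)
    · have hs := h.step (y := b w) (η := c w) (hl.norm_a w) (hθ0 w).le
        ((mul_le_mul_of_nonneg_left (hθ1 w) (by positivity)).trans hτL)
      refine hs.trans ?_
      have hMw := hM w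
      have hdec : 0 ≤ θ w * sqGrad gv gy gη (a w) (b w) (c w) / 2 := by
        have := (hθ0 w).le
        have := hnn (a w) (b w) (c w)
        positivity
      rcases le_or_gt (Φ (a w) (b w) (c w)) (minimax Φ - δ / 2) with h1 | h1
      · exact le_max_of_le_right (by linarith)
      · refine le_max_of_le_left ?_
        have h2 : |Φ (a w) (b w) (c w) - minimax Φ| ≤ δ / 2 :=
          abs_le.2 ⟨by linarith, by linarith⟩
        have h3 : δ / 2 ≤ sqGrad gv gy gη (a w) (b w) (c w) := by
          linarith [hle _ (b w) (c w) (hl.norm_a w)]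
        have h4 : κ ≤ (1 + sqGrad gv gy gη (a w) (b w) (c w))⁻¹
            * sqGrad gv gy gη (a w) (b w) (c w) := by
          rw [hκ, inv_mul_eq_div, div_le_div_iff₀ (by positivity) (hpos w)]
          nlinarith
        have h5 : τ * κ ≤ θ w * sqGrad gv gy gη (a w) (b w) (c w) := by
          rw [hθ, mul_assoc]
          gcongr
        linarith
  have := csInf_le hbelow hmem
  rcases le_max_iff.1 this with h1 | h1 <;> rw [minimax] at h1 <;> linarith

end Minimax

section Action

variable {V : Type*} [NormedAddCommGroup V] [InnerProductSpace ℝ V]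

/-- Time-dependent Hamiltonians on `V × V` with bounds on first derivatives, second order
bounds, and which are homogeneous of degree one in an annulus. -/
structure IsHam (L C : ℝ) (H : ℝ → V → V → ℝ) (Hx Hξ : ℝ → V → V → V) : Prop where
  nonneg : ∀ t x ξ, 0 ≤ H t x ξ
  cont : ∀ t, Continuous fun z : V × V => H t z.1 z.2
  cont_x : ∀ t, Continuous fun z : V × V => Hx t z.1 z.2
  cont_ξ : ∀ t, Continuous fun z : V × V => Hξ t z.1 z.2
  le : ∀ t x ξ, H t x ξ ≤ L
  le_x : ∀ t x ξ, ‖Hx t x ξ‖ ≤ L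
  le_ξ : ∀ t x ξ, ‖Hξ t x ξ‖ ≤ L
  lip_x : ∀ t x ξ t' x' ξ', ‖Hx t x ξ - Hx t' x' ξ'‖ ≤ L * (|t - t'| + ‖x - x'‖ + ‖ξ - ξ'‖)
  lip_ξ : ∀ t x ξ t' x' ξ', ‖Hξ t x ξ - Hξ t' x' ξ'‖ ≤ L * (|t - t'| + ‖x - x'‖ + ‖ξ - ξ'‖)
  quad : ∀ t x ξ x' ξ', H t x' ξ' ≤ H t x ξ + ⟪Hx t x ξ, x' - x⟫ + ⟪Hξ t x ξ, ξ' - ξ⟫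
    + L * (‖x' - x‖ ^ 2 + ‖ξ' - ξ‖ ^ 2)
  C_nonneg : 0 ≤ C
  le_norm : ∀ t x ξ, ‖Hx t x ξ‖ ≤ C * ‖ξ‖
  euler : ∀ t x ξ, Real.exp (-2 * C) ≤ ‖ξ‖ → ‖ξ‖ ≤ Real.exp C → H t x ξ = ⟪Hξ t x ξ, ξ⟫

/-- Functions with gradient data and a one-sided second order bound on the unit sphere. -/
structure IsTameOnSphere (L : ℝ) (G : V → ℝ) (g : V → V) : Prop where
  cont : Continuous G
  cont_g : Continuous g
  bound : ∀ v, ‖v‖ = 1 → |G v| ≤ L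
  bound_g : ∀ v, ‖v‖ = 1 → ‖g v‖ ≤ L
  quad : ∀ v v', ‖v‖ = 1 → ‖v'‖ = 1 → G v + ⟪g v, v' - v⟫ - L * ‖v' - v‖ ^ 2 ≤ G v'

lemma isTameOnSphere_zero : IsTameOnSphere 0 (0 : V → ℝ) 0 :=
  ⟨continuous_const, continuous_const, by simp, by simp, by simp⟩

variable [FiniteDimensional ℝ V] {W : Type*} [NormedAddCommGroup W] [InnerProductSpace ℝ W]
  [FiniteDimensional ℝ W] {ι : Type*} [Fintype ι]

/-- The discretised action. -/
def action (c t : ι → ℝ) (H : ℝ → V → V → ℝ) (A B : ι → W →L[ℝ] V) (q : V) (α : ℝ) (G : V → ℝ)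
    (v : V) (y η : W) : ℝ :=
  ⟪y, η⟫ + ∑ i, c i * H (t i) (A i y) (q + α • (v - q) - B i η) - G v

/-- The gradient of the action in the first variable. -/
def actionGradV (c t : ι → ℝ) (Hξ : ℝ → V → V → V) (A B : ι → W →L[ℝ] V) (q : V) (α : ℝ)
    (g : V → V) (v : V) (y η : W) : V :=
  ∑ i, c i • α • Hξ (t i) (A i y) (q + α • (v - q) - B i η) - g v

/-- The gradient of the action in the second variable. -/
def actionGradY (c t : ι → ℝ) (Hx : ℝ → V → V → V) (A B : ι → W →L[ℝ] V) (q : V) (α : ℝ)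
    (v : V) (y η : W) : W :=
  η + ∑ i, c i • (A i).adjoint (Hx (t i) (A i y) (q + α • (v - q) - B i η))

/-- The gradient of the action in the third variable. -/
def actionGradEta (c t : ι → ℝ) (Hξ : ℝ → V → V → V) (A B : ι → W →L[ℝ] V) (q : V) (α : ℝ)
    (v : V) (y η : W) : W :=
  y - ∑ i, c i • (B i).adjoint (Hξ (t i) (A i y) (q + α • (v - q) - B i η))

omit [InnerProductSpace ℝ V] [FiniteDimensional ℝ V] in
lemma norm_sum_smul_le_of_le [NormedSpace ℝ V] {c k : ι → ℝ} {L : ℝ} {f : ι → V}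
    (hc : ∀ i, 0 ≤ c i) (hf : ∀ i, ‖f i‖ ≤ L * k i) :
    ‖∑ i, c i • f i‖ ≤ L * ∑ i, c i * k i := by
  refine (norm_sum_le _ _).trans ?_
  rw [Finset.mul_sum]
  refine Finset.sum_le_sum fun i _ => ?_
  rw [norm_smul, Real.norm_of_nonneg (hc i)]
  calc c i * ‖f i‖ ≤ c i * (L * k i) := mul_le_mul_of_nonneg_left (hf i) (hc i)
    _ = _ := by ring

variable {L C : ℝ} {H : ℝ → V → V → ℝ} {Hx Hξ : ℝ → V → V → V} {G : V → ℝ} {g : V → V} {LG : ℝ}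

lemma isTame_action (hH : IsHam L C H Hx Hξ) (hG : IsTameOnSphere LG G g) {c : ι → ℝ}
    (hc : ∀ i, 0 ≤ c i) (t : ι → ℝ) (A B : ι → W →L[ℝ] V) (q : V) {α : ℝ} (h0 : 0 ≤ α)
    (h1 : α ≤ 1) :
    ∃ L', IsTame L' (action c t H A B q α G) (actionGradV c t Hξ A B q α g)
      (actionGradY c t Hx A B q α) (actionGradEta c t Hξ A B q α) := by
  have hL : 0 ≤ L := (norm_nonneg _).trans (hH.le_x 0 0 0)
  set k : ι → ℝ := fun i => 2 * (1 + ‖A i‖ + ‖B i‖) ^ 2 with hk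
  have hk1 : ∀ i, 1 ≤ k i := fun i => by
    have := norm_nonneg (A i); have := norm_nonneg (B i); simp only [hk]; nlinarith
  have hkA : ∀ i, ‖A i‖ ≤ k i := fun i => by
    have := norm_nonneg (A i); have := norm_nonneg (B i); simp only [hk]; nlinarith
  have hkB : ∀ i, ‖B i‖ ≤ k i := fun i => by
    have := norm_nonneg (A i); have := norm_nonneg (B i); simp only [hk]; nlinarith
  have hkA2 : ∀ i, ‖A i‖ ^ 2 ≤ k i := fun i => by
    have := norm_nonneg (A i); have := norm_nonneg (B i); simp only [hk]; nlinarith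
  have hk2 : ∀ i, 2 ≤ k i := fun i => by
    have := norm_nonneg (A i); have := norm_nonneg (B i); simp only [hk]; nlinarith
  have hkB2 : ∀ i, 2 * ‖B i‖ ^ 2 ≤ k i := fun i => by
    have := norm_nonneg (A i); have := norm_nonneg (B i); simp only [hk]; nlinarith
  set S := ∑ i, c i * k i with hS
  have hS0 : 0 ≤ S := Finset.sum_nonneg fun i _ => mul_nonneg (hc i) (by linarith [hk1 i])
  have hLS : 0 ≤ L * S := mul_nonneg hL hS0
  have cP : ∀ i, Continuous fun z : V × W × W => (A i z.2.1, q + α • (z.1 - q) - B i z.2.2) :=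
    fun i => by fun_prop
  refine ⟨L * S + |LG| + 1, ?_, ?_, ?_, ?_, ?_, ?_, ?_, ?_, ?_⟩
  · exact ((continuous_fst.comp continuous_snd).inner (continuous_snd.comp continuous_snd)).add
      (continuous_finsetSum _ fun i _ => continuous_const.mul ((hH.cont (t i)).comp (cP i)))
      |>.sub (hG.cont.comp continuous_fst)
  · exact (continuous_finsetSum _ fun i _ => (((hH.cont_ξ (t i)).comp (cP i)).const_smul
      α).const_smul (c i)).sub (hG.cont_g.comp continuous_fst)
  · exact (continuous_snd.comp continuous_snd).add (continuous_finsetSum _ fun i _ =>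
      ((A i).adjoint.continuous.comp ((hH.cont_x (t i)).comp (cP i))).const_smul (c i))
  · exact (continuous_fst.comp continuous_snd).sub (continuous_finsetSum _ fun i _ =>
      ((B i).adjoint.continuous.comp ((hH.cont_ξ (t i)).comp (cP i))).const_smul (c i))
  · intro v y η hv
    have e1 := norm_sum_smul_le_of_le (L := L) (k := k) hc
      (f := fun i => H (t i) (A i y) (q + α • (v - q) - B i η)) (fun i => by
        rw [Real.norm_of_nonneg (hH.nonneg _ _ _)]
        exact (hH.le _ _ _).trans (le_mul_of_one_le_right hL (hk1 i)))
    simp only [smul_eq_mul, Real.norm_eq_abs] at e1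
    have e2 := hG.bound v hv
    rw [action, add_sub_assoc, add_sub_cancel_left]
    exact (abs_sub _ _).trans (by linarith [le_abs_self LG])
  · intro v y η hv
    have e1 := norm_sum_smul_le_of_le (L := L) (k := k) hc
      (f := fun i => α • Hξ (t i) (A i y) (q + α • (v - q) - B i η)) (fun i => by
        rw [norm_smul, Real.norm_of_nonneg h0]
        exact (mul_le_of_le_one_left (norm_nonneg _) h1).trans
          ((hH.le_ξ _ _ _).trans (le_mul_of_one_le_right hL (hk1 i))))
    have e2 := hG.bound_g v hv
    exact (norm_sub_le _ _).trans (by linarith [le_abs_self LG])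
  · intro v y η hv
    have e1 := norm_sum_smul_le_of_le (L := L) (k := k) hc
      (f := fun i => (A i).adjoint (Hx (t i) (A i y) (q + α • (v - q) - B i η))) (fun i => by
        refine ((A i).adjoint.le_opNorm _).trans ?_
        rw [LinearIsometryEquiv.norm_map, mul_comm]
        exact mul_le_mul (hH.le_x _ _ _) (hkA i) (norm_nonneg _) hL)
    rw [actionGradY, add_sub_cancel_left]
    linarith [abs_nonneg LG]
  · intro v y η hv
    have e1 := norm_sum_smul_le_of_le (L := L) (k := k) hc
      (f := fun i => (B i).adjoint (Hξ (t i) (A i y) (q + α • (v - q) - B i η))) (fun i => by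
        refine ((B i).adjoint.le_opNorm _).trans ?_
        rw [LinearIsometryEquiv.norm_map, mul_comm]
        exact mul_le_mul (hH.le_ξ _ _ _) (hkB i) (norm_nonneg _) hL)
    rw [actionGradEta, sub_sub_cancel_left, norm_neg]
    linarith [abs_nonneg LG]
  · intro v y η v' y' η' hv hv'
    have e1 : ∀ i, H (t i) (A i y') (q + α • (v' - q) - B i η') ≤
        H (t i) (A i y) (q + α • (v - q) - B i η)
        + ⟪α • Hξ (t i) (A i y) (q + α • (v - q) - B i η), v' - v⟫
        + ⟪(A i).adjoint (Hx (t i) (A i y) (q + α • (v - q) - B i η)), y' - y⟫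
        - ⟪(B i).adjoint (Hξ (t i) (A i y) (q + α • (v - q) - B i η)), η' - η⟫
        + L * k i * (‖v' - v‖ ^ 2 + ‖y' - y‖ ^ 2 + ‖η' - η‖ ^ 2) := by
      intro i
      refine (hH.quad (t i) (A i y) (q + α • (v - q) - B i η) (A i y')
        (q + α • (v' - q) - B i η')).trans ?_
      have e2 : q + α • (v' - q) - B i η' - (q + α • (v - q) - B i η)
          = α • (v' - v) - B i (η' - η) := by rw [map_sub]; module
      rw [e2, ← map_sub, ContinuousLinearMap.adjoint_inner_left,
        ContinuousLinearMap.adjoint_inner_left, inner_sub_right, inner_smul_right,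
        real_inner_smul_left]
      have e3 : ‖A i (y' - y)‖ ^ 2 ≤ k i * ‖y' - y‖ ^ 2 := by
        calc _ ≤ (‖A i‖ * ‖y' - y‖) ^ 2 := by gcongr; exact (A i).le_opNorm _
          _ = ‖A i‖ ^ 2 * ‖y' - y‖ ^ 2 := by ring
          _ ≤ _ := by gcongr; exact hkA2 i
      have e4 : ‖α • (v' - v) - B i (η' - η)‖ ^ 2 ≤ k i * ‖v' - v‖ ^ 2 + k i * ‖η' - η‖ ^ 2 := by
        have e5 : ‖α • (v' - v)‖ ≤ ‖v' - v‖ := by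
          rw [norm_smul, Real.norm_of_nonneg h0]; exact mul_le_of_le_one_left (norm_nonneg _) h1
        calc _ ≤ (‖v' - v‖ + ‖B i‖ * ‖η' - η‖) ^ 2 := by
              gcongr
              exact (norm_sub_le _ _).trans (add_le_add e5 ((B i).le_opNorm _))
          _ ≤ 2 * ‖v' - v‖ ^ 2 + 2 * ‖B i‖ ^ 2 * ‖η' - η‖ ^ 2 := by
              nlinarith [sq_nonneg (‖v' - v‖ - ‖B i‖ * ‖η' - η‖)]
          _ ≤ _ := by
              gcongr
              exacts [hk2 i, hkB2 i]
      have e6 : L * (‖A i (y' - y)‖ ^ 2 + ‖α • (v' - v) - B i (η' - η)‖ ^ 2) ≤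
          L * (k i * ‖y' - y‖ ^ 2 + (k i * ‖v' - v‖ ^ 2 + k i * ‖η' - η‖ ^ 2)) := by gcongr
      linarith
    have e2 := Finset.sum_le_sum fun i (_ : i ∈ Finset.univ) =>
      mul_le_mul_of_nonneg_left (e1 i) (hc i)
    have e3 : ∑ i, c i * (H (t i) (A i y) (q + α • (v - q) - B i η)
        + ⟪α • Hξ (t i) (A i y) (q + α • (v - q) - B i η), v' - v⟫
        + ⟪(A i).adjoint (Hx (t i) (A i y) (q + α • (v - q) - B i η)), y' - y⟫
        - ⟪(B i).adjoint (Hξ (t i) (A i y) (q + α • (v - q) - B i η)), η' - η⟫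
        + L * k i * (‖v' - v‖ ^ 2 + ‖y' - y‖ ^ 2 + ‖η' - η‖ ^ 2))
        = ∑ i, c i * H (t i) (A i y) (q + α • (v - q) - B i η)
        + ⟪∑ i, c i • α • Hξ (t i) (A i y) (q + α • (v - q) - B i η), v' - v⟫
        + ⟪∑ i, c i • (A i).adjoint (Hx (t i) (A i y) (q + α • (v - q) - B i η)), y' - y⟫
        - ⟪∑ i, c i • (B i).adjoint (Hξ (t i) (A i y) (q + α • (v - q) - B i η)), η' - η⟫
        + L * S * (‖v' - v‖ ^ 2 + ‖y' - y‖ ^ 2 + ‖η' - η‖ ^ 2) := by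
      simp only [sum_inner, hS, Finset.mul_sum, Finset.sum_mul, ← Finset.sum_add_distrib,
        ← Finset.sum_sub_distrib]
      refine Finset.sum_congr rfl fun i _ => ?_
      simp only [real_inner_smul_left]
      ring
    rw [e3] at e2
    have e4 : ⟪y', η'⟫ ≤ ⟪y, η⟫ + ⟪η, y' - y⟫ + ⟪y, η' - η⟫
        + (‖y' - y‖ ^ 2 + ‖η' - η‖ ^ 2) := by
      have f1 : ⟪y', η'⟫ = ⟪y, η⟫ + ⟪η, y' - y⟫ + ⟪y, η' - η⟫ + ⟪y' - y, η' - η⟫ := by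
        simp only [inner_sub_right, inner_sub_left, real_inner_comm y η]
        rw [real_inner_comm y' η]
        ring
      have f2 := real_inner_le_norm (y' - y) (η' - η)
      nlinarith [sq_nonneg (‖y' - y‖ - ‖η' - η‖), norm_nonneg (y' - y), norm_nonneg (η' - η)]
    have e5 := hG.quad v v' hv hv'
    have e6 : LG * ‖v' - v‖ ^ 2 ≤ |LG| * ‖v' - v‖ ^ 2 := by gcongr; exact le_abs_self LG
    simp only [action, actionGradV, actionGradY, actionGradEta, inner_sub_left, inner_add_left]
    have e7 : 0 ≤ |LG| * (‖y' - y‖ ^ 2 + ‖η' - η‖ ^ 2) := by positivity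
    nlinarith [sq_nonneg ‖v' - v‖]

end Action

section Discrete

variable {V : Type*} [NormedAddCommGroup V] [InnerProductSpace ℝ V]

/-- Trajectories of the symplectic Euler scheme with step sizes `c n` at times `t n`. -/
structure IsDiscreteFlow (N : ℕ) (c t : ℕ → ℝ) (Hx Hξ : ℝ → V → V → V) (x ζ : ℕ → V) : Prop where
  zero : x 0 = 0
  step_x : ∀ n < N, x (n + 1) = x n + c n • Hξ (t n) (x n) (ζ (n + 1))
  step_ζ : ∀ n < N, ζ n = ζ (n + 1) + c n • Hx (t n) (x n) (ζ (n + 1))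

/-- The sum of the first `n` coordinates. -/
def partialSum (V : Type*) [NormedAddCommGroup V] [InnerProductSpace ℝ V] (N n : ℕ) :
    PiLp 2 (fun _ : Fin N => V) →L[ℝ] V :=
  ∑ j : Fin N, if (j : ℕ) < n then PiLp.proj 2 (fun _ => V) j else 0

lemma partialSum_apply (N n : ℕ) (y : PiLp 2 (fun _ : Fin N => V)) :
    partialSum V N n y = ∑ j : Fin N, if (j : ℕ) < n then y j else 0 := by
  rw [partialSum, sum_apply]
  refine Finset.sum_congr rfl fun j _ => ?_
  split_ifs <;> simp

lemma partialSum_zero (N : ℕ) (y : PiLp 2 (fun _ : Fin N => V)) : partialSum V N 0 y = 0 := by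
  simp [partialSum_apply]

lemma partialSum_self (N : ℕ) (y : PiLp 2 (fun _ : Fin N => V)) :
    partialSum V N N y = ∑ j, y j := by
  simp [partialSum_apply]

lemma partialSum_succ {N n : ℕ} (hn : n < N) (y : PiLp 2 (fun _ : Fin N => V)) :
    partialSum V N (n + 1) y = partialSum V N n y + y ⟨n, hn⟩ := by
  have h : y ⟨n, hn⟩ = ∑ j : Fin N, if j = ⟨n, hn⟩ then y j else 0 := by simp
  rw [partialSum_apply, partialSum_apply, h, ← Finset.sum_add_distrib]
  refine Finset.sum_congr rfl fun j _ => ?_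
  simp only [Fin.ext_iff]
  split_ifs <;> first | omega | simp

lemma partialSum_single {N n : ℕ} (j : Fin N) (z : V) :
    partialSum V N n (PiLp.single 2 j z) = if (j : ℕ) < n then z else 0 := by
  rw [partialSum_apply, Finset.sum_eq_single j]
  · simp
  · intro i _ hij
    simp [hij]
  · simp

variable [FiniteDimensional ℝ V] {L C : ℝ} {H : ℝ → V → V → ℝ} {Hx Hξ : ℝ → V → V → V}

/-- Critical points of the discretised action are discrete trajectories. -/
lemma exists_isDiscreteFlow_of_critical {N : ℕ} {c t : ℕ → ℝ} {q v : V} {α : ℝ}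
    {y η : PiLp 2 (fun _ : Fin N => V)}
    (hy : actionGradY (fun i : Fin N => c i) (fun i => t i) Hx (fun i => partialSum V N i)
      (fun i => PiLp.proj 2 (fun _ => V) i) q α v y η = 0)
    (hη : actionGradEta (fun i : Fin N => c i) (fun i => t i) Hξ (fun i => partialSum V N i)
      (fun i => PiLp.proj 2 (fun _ => V) i) q α v y η = 0) :
    ∃ x ζ : ℕ → V, IsDiscreteFlow N c t Hx Hξ x ζ ∧ ζ N = q + α • (v - q) ∧
      (∀ i : Fin N, y i = c i • Hξ (t i) (x i) (ζ (i + 1))) ∧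
      (∀ i : Fin N, η i = q + α • (v - q) - ζ (i + 1)) ∧ (∀ i, partialSum V N i y = x i) := by
  set b := q + α • (v - q) with hb
  set f : Fin N → V := fun i => c i • Hx (t i) (partialSum V N i y) (b - η i) with hf
  set ζ : ℕ → V := fun n => b + ∑ i : Fin N, if n ≤ i then f i else 0 with hζ
  have e1 : ∀ j : Fin N, b - η j = ζ (j + 1) := by
    intro j
    have h1 : ∀ z : V, ⟪η j + ∑ i : Fin N, (if (j : ℕ) + 1 ≤ i then f i else 0), z⟫ = 0 := by
      intro z
      have h2 : ⟪actionGradY (fun i : Fin N => c i) (fun i => t i) Hx (fun i => partialSum V N i)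
        (fun i => PiLp.proj 2 (fun _ => V) i) q α v y η, PiLp.single 2 j z⟫ = 0 := by
        rw [hy, inner_zero_left]
      rw [actionGradY, inner_add_left, sum_inner, PiLp.inner_apply,
        Finset.sum_eq_single j (by intro i _ hij; simp [hij]) (by simp)] at h2
      rw [inner_add_left, sum_inner, ← h2, PiLp.single_eq_same]
      congr 1
      refine Finset.sum_congr rfl fun i _ => ?_
      rw [real_inner_smul_left, ContinuousLinearMap.adjoint_inner_left, partialSum_single]
      split_ifs with h3 h4 h4
      · rw [hf]; simp only [real_inner_smul_left]; rfl
      · omega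
      · omega
      · simp
    have h2 := h1 (η j + ∑ i : Fin N, (if (j : ℕ) + 1 ≤ i then f i else 0))
    rw [inner_self_eq_zero] at h2
    rw [hζ, eq_neg_of_add_eq_zero_left h2, sub_neg_eq_add]
  have e2 : ∀ j : Fin N, y j = c j • Hξ (t j) (partialSum V N j y) (ζ (j + 1)) := by
    intro j
    have h1 : ∀ z : V, ⟪y j - c j • Hξ (t j) (partialSum V N j y) (ζ (j + 1)), z⟫ = 0 := by
      intro z
      have h2 : ⟪actionGradEta (fun i : Fin N => c i) (fun i => t i) Hξ
        (fun i => partialSum V N i) (fun i => PiLp.proj 2 (fun _ => V) i) q α v y η,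
          PiLp.single 2 j z⟫ = 0 := by
        rw [hη, inner_zero_left]
      rw [actionGradEta, inner_sub_left, sum_inner, PiLp.inner_apply,
        Finset.sum_eq_single j (by intro i _ hij; simp [hij]) (by simp),
        Finset.sum_eq_single j (by
          intro i _ hij
          rw [real_inner_smul_left, ContinuousLinearMap.adjoint_inner_left]
          simp [hij]) (by simp), real_inner_smul_left, ContinuousLinearMap.adjoint_inner_left] at h2
      rw [inner_sub_left, ← h2, real_inner_smul_left, ← e1 j]
      simp [hb]
    exact sub_eq_zero.1 (inner_self_eq_zero.1 (h1 _))
  refine ⟨fun n => partialSum V N n y, ζ, ⟨partialSum_zero N y, fun n hn => ?_, fun n hn => ?_⟩,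
    ?_, e2, fun i => by rw [← e1]; abel, fun _ => rfl⟩
  · rw [partialSum_succ hn, e2 ⟨n, hn⟩]
  · have h1 : c n • Hx (t n) (partialSum V N n y) (ζ (n + 1))
        = ∑ i : Fin N, if i = ⟨n, hn⟩ then f i else 0 := by
      rw [Finset.sum_ite_eq' Finset.univ, if_pos (Finset.mem_univ _), hf]
      simp only
      rw [e1]
    rw [h1]
    simp only [hζ]
    rw [add_assoc b, ← Finset.sum_add_distrib]
    congr 1
    refine Finset.sum_congr rfl fun j _ => ?_
    simp only [Fin.ext_iff]
    split_ifs <;> first | omega | simp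
  · rw [hζ]
    simp only [add_eq_left]
    exact Finset.sum_eq_zero fun i _ => if_neg (by omega)

end Discrete

section Discrete

variable {V : Type*} [NormedAddCommGroup V] [InnerProductSpace ℝ V]
  {L C : ℝ} {H : ℝ → V → V → ℝ} {Hx Hξ : ℝ → V → V → V}

lemma exp_neg_two_mul_le {a : ℝ} (h0 : 0 ≤ a) (h1 : a ≤ 1 / 2) : Real.exp (-2 * a) ≤ 1 - a := by
  rw [show -2 * a = -(2 * a) by ring, Real.exp_neg]
  have h2 := Real.add_one_le_exp (2 * a)
  rw [inv_le_comm₀ (Real.exp_pos _) (by linarith)]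
  refine le_trans ?_ h2
  rw [inv_le_iff_one_le_mul₀ (by linarith)]
  nlinarith

lemma IsDiscreteFlow.norm_bounds (hH : IsHam L C H Hx Hξ) {N : ℕ} (hN : 0 < N) (hNC : 2 * C ≤ N)
    {c t : ℕ → ℝ} (hc : ∀ n, 0 ≤ c n) (hcN : ∀ n, c n ≤ 1 / N) {x ζ : ℕ → V}
    (h : IsDiscreteFlow N c t Hx Hξ x ζ) (hζ : ‖ζ N‖ = 1) {n : ℕ} (hn : n ≤ N) :
    Real.exp (-2 * C) ≤ ‖ζ n‖ ∧ ‖ζ n‖ ≤ Real.exp C := by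
  have hN' : (0 : ℝ) < N := by exact_mod_cast hN
  have hC := hH.C_nonneg
  set a := C / N with ha
  have ha0 : 0 ≤ a := by positivity
  have ha1 : a ≤ 1 / 2 := by rw [ha, div_le_iff₀ hN']; linarith
  have key : ∀ j ≤ N, Real.exp (-2 * a) ^ j ≤ ‖ζ (N - j)‖ ∧ ‖ζ (N - j)‖ ≤ Real.exp a ^ j := by
    intro j
    induction j with
    | zero => intro _; simp [hζ]
    | succ j ih =>
      intro hj
      obtain ⟨i1, i2⟩ := ih (by omega)
      have hs := h.step_ζ (N - (j + 1)) (by omega)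
      rw [show N - (j + 1) + 1 = N - j by omega] at hs
      have e1 : ‖c (N - (j + 1)) • Hx (t (N - (j + 1))) (x (N - (j + 1))) (ζ (N - j))‖
          ≤ a * ‖ζ (N - j)‖ := by
        rw [norm_smul, Real.norm_of_nonneg (hc _)]
        calc _ ≤ 1 / N * (C * ‖ζ (N - j)‖) :=
              mul_le_mul (hcN _) (hH.le_norm _ _ _) (norm_nonneg _) (by positivity)
          _ = _ := by rw [ha]; ring
      rw [hs, pow_succ, pow_succ]
      constructor
      · have e2 := norm_le_add_norm_add (ζ (N - j))
          (c (N - (j + 1)) • Hx (t (N - (j + 1))) (x (N - (j + 1))) (ζ (N - j)))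
        have e3 := exp_neg_two_mul_le ha0 ha1
        calc _ ≤ ‖ζ (N - j)‖ * (1 - a) :=
              mul_le_mul i1 e3 (Real.exp_pos _).le (norm_nonneg _)
          _ ≤ _ := by linarith
      · refine (norm_add_le _ _).trans ?_
        have e3 := Real.add_one_le_exp a
        calc _ ≤ ‖ζ (N - j)‖ * (a + 1) := by linarith
          _ ≤ _ := mul_le_mul i2 e3 (by linarith) (by positivity)
  obtain ⟨k1, k2⟩ := key (N - n) (by omega)
  rw [show N - (N - n) = n by omega, ← Real.exp_nat_mul] at k1 k2
  have hle : ((N - n : ℕ) : ℝ) * a ≤ C := by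
    have : ((N - n : ℕ) : ℝ) ≤ N := by exact_mod_cast Nat.sub_le N n
    calc _ ≤ N * a := by gcongr
      _ = C := by rw [ha]; field_simp
  exact ⟨le_trans (Real.exp_le_exp.2 (by linarith)) k1, k2.trans (Real.exp_le_exp.2 hle)⟩

/-- Critical points obtained from the minimax principle, and their values. -/
lemma exists_discrete_critical [FiniteDimensional ℝ V] (hH : IsHam L C H Hx Hξ) {G : V → ℝ}
    {g : V → V} {LG : ℝ} (hG : IsTameOnSphere LG G g) {N : ℕ} (hN : 0 < N) (hNC : 2 * C ≤ N)
    {c : ℕ → ℝ} (t : ℕ → ℝ) (hc : ∀ n, 0 ≤ c n) (hcN : ∀ n, c n ≤ 1 / N) {q : V} {α : ℝ}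
    (h0 : 0 ≤ α) (h1 : α ≤ 1) (hq : ‖q‖ = 1) (hb : ∀ v, ‖v‖ = 1 → ‖q + α • (v - q)‖ = 1) :
    ∃ (v : V) (x ζ : ℕ → V), ‖v‖ = 1 ∧ IsDiscreteFlow N c t Hx Hξ x ζ ∧
      ζ N = q + α • (v - q) ∧ α • x N - g v - ⟪α • x N - g v, v⟫ • v = 0 ∧
      minimax (action (fun i : Fin N => c i) (fun i => t i) H (fun i => partialSum V N i)
        (fun i => PiLp.proj 2 (fun _ => V) i) q α G) = ⟪x N, ζ N⟫ - G v := by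
  obtain ⟨L', hL'⟩ := isTame_action hH hG (c := fun i : Fin N => c i) (fun i => hc i)
    (fun i => t i) (fun i => partialSum V N i) (fun i => PiLp.proj 2 (fun _ => V) i) q h0 h1
  obtain ⟨v, y, η, hv, hval, htan, hy, hη⟩ := hL'.exists_critical hq
  obtain ⟨x, ζ, hflow, hζ, hyi, hηi, hxi⟩ := exists_isDiscreteFlow_of_critical hy hη
  have hxN : ∑ i, y i = x N := by rw [← hxi, partialSum_self]
  have hsub : ∀ i : Fin N, q + α • (v - q) - η i = ζ (i + 1) := fun i => by rw [hηi]; abel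
  refine ⟨v, x, ζ, hv, hflow, hζ, ?_, ?_⟩
  · have e : actionGradV (fun i : Fin N => c i) (fun i => t i) Hξ (fun i => partialSum V N i)
        (fun i => PiLp.proj 2 (fun _ => V) i) q α g v y η = α • x N - g v := by
      rw [actionGradV, ← hxN, Finset.smul_sum]
      congr 1
      refine Finset.sum_congr rfl fun i _ => ?_
      rw [hyi, hxi, PiLp.proj_apply, hsub, smul_comm]
    rw [← e]
    exact htan
  · rw [← hval, action, PiLp.inner_apply, ← Finset.sum_add_distrib, ← hxN, sum_inner]
    congr 1
    refine Finset.sum_congr rfl fun i _ => ?_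
    have hbd := hflow.norm_bounds hH hN hNC hc hcN (by rw [hζ]; exact hb v hv)
      (n := i + 1) (by omega)
    rw [hxi, PiLp.proj_apply, hsub, hH.euler _ _ _ hbd.1 hbd.2, ← real_inner_smul_left, ← hyi,
      ← inner_add_right, hηi, hζ, sub_add_cancel]

lemma discrete_gronwall {e : ℕ → ℝ} {k : ℕ} {D M τ : ℝ} (hD : 0 ≤ D) (hM : 0 ≤ M) (hτ : 0 ≤ τ)
    (h0 : e 0 ≤ 0) (hs : ∀ n < k, e (n + 1) ≤ (1 + M * τ) * e n + D * τ ^ 2) (hk : k * τ ≤ 1) :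
    e k ≤ D * τ * Real.exp M := by
  have key : ∀ n ≤ k, e n ≤ n * (D * τ ^ 2) * (1 + M * τ) ^ n := by
    intro n
    induction n with
    | zero => intro _; simpa using h0
    | succ n ih =>
      intro hn
      have h1 := ih (by omega)
      have h2 : 1 ≤ (1 + M * τ) ^ (n + 1) := one_le_pow₀ (by nlinarith)
      calc e (n + 1) ≤ (1 + M * τ) * e n + D * τ ^ 2 := hs n (by omega)
        _ ≤ (1 + M * τ) * (n * (D * τ ^ 2) * (1 + M * τ) ^ n)
            + D * τ ^ 2 * (1 + M * τ) ^ (n + 1) := by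
            exact add_le_add (mul_le_mul_of_nonneg_left h1 (by positivity))
              (le_mul_of_one_le_right (by positivity) h2)
        _ = _ := by push_cast; ring
  have h1 : (1 + M * τ) ^ k ≤ Real.exp M := by
    calc (1 + M * τ) ^ k ≤ Real.exp (M * τ) ^ k := by
          gcongr
          rw [add_comm]
          exact Real.add_one_le_exp _
      _ = Real.exp (k * (M * τ)) := (Real.exp_nat_mul _ _).symm
      _ ≤ _ := Real.exp_le_exp.2 (by nlinarith)
  calc e k ≤ k * (D * τ ^ 2) * (1 + M * τ) ^ k := key k le_rfl
    _ = (k * τ) * (D * τ) * (1 + M * τ) ^ k := by ring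
    _ ≤ 1 * (D * τ) * Real.exp M := by gcongr
    _ = _ := by ring

lemma norm_sub_le_of_hasDerivWithinAt {U f : ℝ → V} {K : ℝ}
    (hU : ∀ t ∈ Icc (0 : ℝ) 1, HasDerivWithinAt U (f t) (Icc 0 1) t)
    (hf : ∀ t ∈ Icc (0 : ℝ) 1, ‖f t‖ ≤ K) {t r : ℝ} (ht : t ∈ Icc (0 : ℝ) 1)
    (hr : r ∈ Icc (0 : ℝ) 1) : ‖U r - U t‖ ≤ K * |r - t| :=
  (convex_Icc (0 : ℝ) 1).norm_image_sub_le_of_norm_hasDerivWithin_le hU hf ht hr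

/-- Local error of the Euler scheme. -/
lemma euler_local_error {F : ℝ → V → V → V} {X P U fX fP : ℝ → V} (hL : 0 ≤ L)
    (hF : ∀ t x ξ t' x' ξ', ‖F t x ξ - F t' x' ξ'‖ ≤ L * (|t - t'| + ‖x - x'‖ + ‖ξ - ξ'‖))
    (hX : ∀ t ∈ Icc (0 : ℝ) 1, HasDerivWithinAt X (fX t) (Icc 0 1) t)
    (hP : ∀ t ∈ Icc (0 : ℝ) 1, HasDerivWithinAt P (fP t) (Icc 0 1) t)
    (hfX : ∀ t ∈ Icc (0 : ℝ) 1, ‖fX t‖ ≤ L) (hfP : ∀ t ∈ Icc (0 : ℝ) 1, ‖fP t‖ ≤ L)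
    (hU : ∀ t ∈ Icc (0 : ℝ) 1, HasDerivWithinAt U (F t (X t) (P t)) (Icc 0 1) t)
    {t τ : ℝ} (ht : 0 ≤ t) (hτ : 0 ≤ τ) (htτ : t + τ ≤ 1) :
    ‖U (t + τ) - U t - τ • F t (X t) (P t)‖ ≤ L * (1 + 2 * L) * τ ^ 2 := by
  have hsub : Icc t (t + τ) ⊆ Icc (0 : ℝ) 1 := Icc_subset_Icc ht htτ
  have ht' : t ∈ Icc (0 : ℝ) 1 := hsub (left_mem_Icc.2 (by linarith))
  have h1 := (convex_Icc t (t + τ)).norm_image_sub_le_of_norm_hasDerivWithin_le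
    (f := fun r => U r - r • F t (X t) (P t))
    (f' := fun r => F r (X r) (P r) - (1 : ℝ) • F t (X t) (P t)) (C := L * (1 + 2 * L) * τ)
    (fun r hr => ((hU r (hsub hr)).mono hsub).sub
      ((hasDerivWithinAt_id r _).smul_const (F t (X t) (P t))))
    (fun r hr => by
      have e1 := norm_sub_le_of_hasDerivWithinAt hX hfX ht' (hsub hr)
      have e2 := norm_sub_le_of_hasDerivWithinAt hP hfP ht' (hsub hr)
      have e3 : |r - t| ≤ τ := by
        rw [abs_of_nonneg (by linarith [hr.1])]; linarith [hr.2]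
      rw [one_smul]
      calc _ ≤ L * (|r - t| + ‖X r - X t‖ + ‖P r - P t‖) := hF _ _ _ _ _ _
        _ ≤ L * (τ + L * τ + L * τ) := by
            gcongr
            · exact e1.trans (by gcongr)
            · exact e2.trans (by gcongr)
        _ = _ := by ring)
    (left_mem_Icc.2 (by linarith)) (right_mem_Icc.2 (by linarith))
  rw [add_sub_cancel_left, Real.norm_of_nonneg hτ] at h1
  calc _ = ‖U (t + τ) - (t + τ) • F t (X t) (P t) - (U t - t • F t (X t) (P t))‖ := by
        congr 1; module
    _ ≤ _ := h1
    _ = _ := by ring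

/-- `(X s, σ Q s)` are trajectories of the Hamiltonian, issuing from the zero section. -/
structure IsHamFlow (C : ℝ) (Hx Hξ : ℝ → V → V → V) (X Q : V → ℝ → V) : Prop where
  X_zero : ∀ s, ‖s‖ = 1 → X s 0 = 0
  Q_zero : ∀ s, ‖s‖ = 1 → Q s 0 = s
  norm_Q : ∀ s t, ‖s‖ = 1 → t ∈ Icc (0 : ℝ) 1 → ‖Q s t‖ = 1
  deriv_X : ∀ s σ t, ‖s‖ = 1 → Real.exp (-2 * C) ≤ σ → σ ≤ Real.exp C → t ∈ Icc (0 : ℝ) 1 →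
    HasDerivWithinAt (X s) (Hξ t (X s t) (σ • Q s t)) (Icc 0 1) t
  deriv_Q : ∀ s σ t, ‖s‖ = 1 → Real.exp (-2 * C) ≤ σ → σ ≤ Real.exp C → t ∈ Icc (0 : ℝ) 1 →
    HasDerivWithinAt (fun t => σ • Q s t) (-Hx t (X s t) (σ • Q s t)) (Icc 0 1) t

lemma discrete_const {x : ℕ → V} {f : ℕ → V} {k N : ℕ} {τ : ℝ}
    (h : ∀ n < N, x (n + 1) = x n + (if n < k then τ else 0) • f n) {n : ℕ} (hkn : k ≤ n)
    (hn : n ≤ N) : x n = x k := by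
  induction n, hkn using Nat.le_induction with
  | base => rfl
  | succ n hkn ih => rw [h n (by omega), if_neg (by omega), zero_smul, add_zero, ih (by omega)]

/-- Convergence of the discrete trajectories. -/
lemma IsHamFlow.exists_approx {X Q : V → ℝ → V} (hH : IsHam L C H Hx Hξ)
    (hf : IsHamFlow C Hx Hξ X Q) : ∃ E, ∀ (N k : ℕ) (x ζ : ℕ → V), 0 < N → 2 * C ≤ N → k ≤ N →
      IsDiscreteFlow N (fun n => if n < k then (1 / N : ℝ) else 0) (fun n => n / N) Hx Hξ x ζ →
      ‖ζ N‖ = 1 → ∃ s, ‖s‖ = 1 ∧ ‖x N - X s (k / N)‖ ≤ E / N ∧ ‖ζ N - Q s (k / N)‖ ≤ E / N := by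
  have hL : 0 ≤ L := (norm_nonneg _).trans (hH.le_x 0 0 0)
  set D := 2 * L ^ 2 + 2 * (L * (1 + 2 * L)) with hD
  have hD0 : 0 ≤ D := by positivity
  refine ⟨2 * (D * Real.exp (2 * L)), fun N k x ζ hN hNC hk h hζ => ?_⟩
  have hN' : (0 : ℝ) < N := by exact_mod_cast hN
  set τ : ℝ := 1 / N with hτ
  have hτ0 : 0 < τ := by positivity
  have hbd := h.norm_bounds hH hN hNC (fun n => by split_ifs <;> positivity)
    (fun n => by split_ifs; exacts [le_rfl, by positivity]) hζ (n := 0) (by omega)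
  set σ := ‖ζ 0‖ with hσ
  have hσ0 : 0 < σ := (Real.exp_pos _).trans_le hbd.1
  set s := σ⁻¹ • ζ 0 with hs
  have hs1 : ‖s‖ = 1 := by rw [hs, norm_smul, norm_inv, hσ, norm_norm, inv_mul_cancel₀ hσ0.ne']
  have hX := fun t ht => hf.deriv_X s σ t hs1 hbd.1 hbd.2 ht
  have hP := fun t ht => hf.deriv_Q s σ t hs1 hbd.1 hbd.2 ht
  have hF' : ∀ t x ξ t' x' ξ', ‖-Hx t x ξ - -Hx t' x' ξ'‖
      ≤ L * (|t - t'| + ‖x - x'‖ + ‖ξ - ξ'‖) := fun t x ξ t' x' ξ' => by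
    rw [← neg_sub', norm_neg]; exact hH.lip_x _ _ _ _ _ _
  have hnx : ∀ t x ξ, ‖-Hx t x ξ‖ ≤ L := fun t x ξ => by rw [norm_neg]; exact hH.le_x _ _ _
  set e : ℕ → ℝ := fun n => ‖x n - X s (n * τ)‖ + ‖ζ n - σ • Q s (n * τ)‖ with he
  have hkτ : k * τ ≤ 1 := by
    rw [hτ, mul_one_div, div_le_one hN']; exact_mod_cast hk
  have h0 : e 0 ≤ 0 := by
    have hζ0 : σ • s = ζ 0 := by rw [hs, smul_smul, mul_inv_cancel₀ hσ0.ne', one_smul]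
    simp only [he, Nat.cast_zero, zero_mul, h.zero, hf.X_zero s hs1, hf.Q_zero s hs1, hζ0]
    simp
  have hstep : ∀ n < k, e (n + 1) ≤ (1 + 2 * L * τ) * e n + D * τ ^ 2 := by
    intro n hn
    have hnτ : (0 : ℝ) ≤ n * τ := by positivity
    have hnτ1 : n * τ + τ ≤ 1 := by
      have : ((n : ℝ) + 1) ≤ k := by exact_mod_cast hn
      nlinarith
    have l1 := euler_local_error hL hH.lip_ξ hX hP (fun _ _ => hH.le_ξ _ _ _)
      (fun _ _ => hnx _ _ _) hX hnτ hτ0.le hnτ1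
    have l2 := euler_local_error hL hF' hX hP (fun _ _ => hH.le_ξ _ _ _)
      (fun _ _ => hnx _ _ _) hP hnτ hτ0.le hnτ1
    have ex := h.step_x n (by omega)
    have eζ := h.step_ζ n (by omega)
    simp only [if_pos hn] at ex eζ
    have htn : (n : ℝ) / N = n * τ := by rw [hτ, mul_one_div]
    rw [htn] at ex eζ
    have hdζ : ‖ζ (n + 1) - σ • Q s (n * τ)‖ ≤ ‖ζ n - σ • Q s (n * τ)‖ + τ * L := by
      have : ζ (n + 1) - σ • Q s (n * τ)
          = (ζ n - σ • Q s (n * τ)) - τ • Hx (n * τ) (x n) (ζ (n + 1)) := by rw [eζ]; abel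
      rw [this]
      refine (norm_sub_le _ _).trans (add_le_add le_rfl ?_)
      rw [norm_smul, Real.norm_of_nonneg hτ0.le]
      exact mul_le_mul_of_nonneg_left (hH.le_x _ _ _) hτ0.le
    have d1 : ‖Hξ (n * τ) (x n) (ζ (n + 1)) - Hξ (n * τ) (X s (n * τ)) (σ • Q s (n * τ))‖
        ≤ L * (e n + τ * L) := by
      refine (hH.lip_ξ _ _ _ _ _ _).trans (mul_le_mul_of_nonneg_left ?_ hL)
      simp only [he, sub_self, abs_zero]
      linarith
    have d2 : ‖Hx (n * τ) (x n) (ζ (n + 1)) - Hx (n * τ) (X s (n * τ)) (σ • Q s (n * τ))‖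
        ≤ L * (e n + τ * L) := by
      refine (hH.lip_x _ _ _ _ _ _).trans (mul_le_mul_of_nonneg_left ?_ hL)
      simp only [he, sub_self, abs_zero]
      linarith
    have hn1 : ((n + 1 : ℕ) : ℝ) * τ = n * τ + τ := by push_cast; ring
    have f1 : ‖x (n + 1) - X s (n * τ + τ)‖ ≤ ‖x n - X s (n * τ)‖ + τ * (L * (e n + τ * L))
        + L * (1 + 2 * L) * τ ^ 2 := by
      have : x (n + 1) - X s (n * τ + τ) = (x n - X s (n * τ))
        + τ • (Hξ (n * τ) (x n) (ζ (n + 1)) - Hξ (n * τ) (X s (n * τ)) (σ • Q s (n * τ)))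
        - (X s (n * τ + τ) - X s (n * τ) - τ • Hξ (n * τ) (X s (n * τ)) (σ • Q s (n * τ))) := by
        rw [ex]; module
      rw [this]
      refine (norm_sub_le _ _).trans (add_le_add ((norm_add_le _ _).trans
        (add_le_add le_rfl ?_)) l1)
      rw [norm_smul, Real.norm_of_nonneg hτ0.le]
      exact mul_le_mul_of_nonneg_left d1 hτ0.le
    have f2 : ‖ζ (n + 1) - σ • Q s (n * τ + τ)‖ ≤ ‖ζ n - σ • Q s (n * τ)‖
        + τ * (L * (e n + τ * L)) + L * (1 + 2 * L) * τ ^ 2 := by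
      have : ζ (n + 1) - σ • Q s (n * τ + τ) = (ζ n - σ • Q s (n * τ))
        - τ • (Hx (n * τ) (x n) (ζ (n + 1)) - Hx (n * τ) (X s (n * τ)) (σ • Q s (n * τ)))
        - (σ • Q s (n * τ + τ) - σ • Q s (n * τ)
          - τ • -Hx (n * τ) (X s (n * τ)) (σ • Q s (n * τ))) := by
        rw [eζ]; module
      rw [this]
      refine (norm_sub_le _ _).trans (add_le_add ((norm_sub_le _ _).trans
        (add_le_add le_rfl ?_)) l2)
      rw [norm_smul, Real.norm_of_nonneg hτ0.le]
      exact mul_le_mul_of_nonneg_left d2 hτ0.le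
    have f3 : e (n + 1) = ‖x (n + 1) - X s (n * τ + τ)‖ + ‖ζ (n + 1) - σ • Q s (n * τ + τ)‖ := by
      simp only [he, hn1]
    have f4 : e n = ‖x n - X s (n * τ)‖ + ‖ζ n - σ • Q s (n * τ)‖ := rfl
    rw [f3]
    calc _ ≤ e n + 2 * (τ * (L * (e n + τ * L))) + 2 * (L * (1 + 2 * L) * τ ^ 2) := by linarith
      _ = _ := by rw [hD]; ring
  have hfin := discrete_gronwall hD0 (by positivity) hτ0.le h0 hstep hkτ
  have hxN : x N = x k := discrete_const h.step_x hk le_rfl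
  have hζN : ζ N = ζ k := by
    refine discrete_const (τ := τ) (f := fun n => -Hx (n / N) (x n) (ζ (n + 1)))
      (fun n hn => ?_) hk le_rfl
    rw [h.step_ζ n hn, smul_neg]
    abel
  have hkt : (k : ℝ) / N = k * τ := by rw [hτ, mul_one_div]
  have hE : 2 * (D * Real.exp (2 * L)) / N = 2 * (D * τ * Real.exp (2 * L)) := by
    rw [hτ]; ring
  have hkI : k * τ ∈ Icc (0 : ℝ) 1 := ⟨by positivity, hkτ⟩
  have hQ1 := hf.norm_Q s _ hs1 hkI
  have b1 : ‖x N - X s (k * τ)‖ + ‖ζ N - σ • Q s (k * τ)‖ ≤ D * τ * Real.exp (2 * L) := by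
    rw [hxN, hζN]; exact hfin
  have b2 := norm_nonneg (x N - X s (k * τ))
  have b3 := norm_nonneg (ζ N - σ • Q s (k * τ))
  refine ⟨s, hs1, ?_, ?_⟩ <;> rw [hkt, hE]
  · linarith
  · have b4 : |1 - σ| ≤ ‖ζ N - σ • Q s (k * τ)‖ := by
      have := abs_norm_sub_norm_le (ζ N) (σ • Q s (k * τ))
      rwa [hζ, norm_smul, hQ1, mul_one, Real.norm_of_nonneg hσ0.le] at this
    have b5 : ζ N - Q s (k * τ) = (ζ N - σ • Q s (k * τ)) - (1 - σ) • Q s (k * τ) := by module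
    rw [b5]
    refine (norm_sub_le _ _).trans ?_
    rw [norm_smul, hQ1, mul_one, Real.norm_eq_abs]
    linarith

end Discrete

section Limit

open Filter Topology

variable {V : Type*} [NormedAddCommGroup V] [InnerProductSpace ℝ V] [FiniteDimensional ℝ V]
  {L C : ℝ} {H : ℝ → V → V → ℝ} {Hx Hξ : ℝ → V → V → V}

lemma IsHamFlow.exists_discrete_front {X Q : V → ℝ → V} (hH : IsHam L C H Hx Hξ)
    (hf : IsHamFlow C Hx Hξ X Q) {G : V → ℝ} {g : V → V} {LG : ℝ} (hG : IsTameOnSphere LG G g)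
    (hG0 : ∀ v, ‖v‖ = 1 → G v ≤ 0) {q₀ : V} (hq₀ : ‖q₀‖ = 1) (hGq₀ : G q₀ = 0) {ε : ℝ}
    (hε : 0 ≤ ε) (hX1 : ∀ s, ‖s‖ = 1 → X s 1 = ε • Q s 1) :
    ∃ E, ∀ N k : ℕ, 0 < N → 2 * C ≤ N → k ≤ N → ∃ s x ζ : V, ‖s‖ = 1 ∧
      ‖x - X s (k / N)‖ ≤ E / N ∧ ‖ζ - Q s (k / N)‖ ≤ E / N ∧
      x - g ζ - ⟪x - g ζ, ζ⟫ • ζ = 0 ∧ 0 ≤ ⟪x, ζ⟫ - G ζ ∧ ⟪x, ζ⟫ - G ζ ≤ ε + E / N := by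
  obtain ⟨E, hE⟩ := hf.exists_approx hH
  refine ⟨E, fun N k hN hNC hk => ?_⟩
  have hN' : (0 : ℝ) < N := by exact_mod_cast hN
  set c : ℕ → ℕ → ℝ := fun k n => if n < k then (1 / N : ℝ) else 0 with hc
  have hc0 : ∀ k n, 0 ≤ c k n := fun k n => by simp only [hc]; split_ifs <;> positivity
  have hcN : ∀ k n, c k n ≤ 1 / N := fun k n => by
    simp only [hc]; split_ifs; exacts [le_rfl, by positivity]
  obtain ⟨v, x, ζ, hv, hfl, hζ, htan, hval⟩ := exists_discrete_critical hH hG hN hNC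
    (fun n => n / N) (hc0 k) (hcN k) (q := q₀) (α := 1) zero_le_one le_rfl hq₀
    (fun v hv => by simpa using hv)
  obtain ⟨v', x', ζ', -, hfl', hζ', -, hval'⟩ := exists_discrete_critical hH
    (isTameOnSphere_zero (V := V)) hN hNC
    (fun n => n / N) (hc0 N) (hcN N) (q := q₀) (α := 0) le_rfl zero_le_one hq₀
    (fun v _ => by simpa using hq₀)
  have hζv : ζ N = v := by rw [hζ]; simp
  have hζq : ζ' N = q₀ := by rw [hζ']; simp
  obtain ⟨s, hs, hxs, hζs⟩ := hE N k x ζ hN hNC hk hfl (by rw [hζv, hv])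
  obtain ⟨s', hs', hxs', -⟩ := hE N N x' ζ' hN hNC le_rfl hfl' (by rw [hζq, hq₀])
  rw [hζv] at hζs hval
  rw [one_smul] at htan
  have hlow : ∀ (w : V) (y η : PiLp 2 (fun _ : Fin N => V)), ‖w‖ = 1 → ⟪y, η⟫ + 0 ≤
      action (fun i : Fin N => c k i) (fun i => (i : ℝ) / N) H (fun i => partialSum V N i)
        (fun i => PiLp.proj 2 (fun _ => V) i) q₀ 1 G w y η := by
    intro w y η hw
    have h1 : 0 ≤ ∑ i : Fin N, c k i * H ((i : ℝ) / N) (partialSum V N i y)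
        (q₀ + (1 : ℝ) • (w - q₀) - η i) :=
      Finset.sum_nonneg fun i _ => mul_nonneg (hc0 _ _) (hH.nonneg _ _ _)
    simp only [action, PiLp.proj_apply]
    linarith [hG0 w hw]
  obtain ⟨L₁, h₁⟩ := isTame_action hH hG (c := fun i : Fin N => c k i) (fun i => hc0 k i)
    (fun i => (i : ℝ) / N) (fun i => partialSum V N i) (fun i => PiLp.proj 2 (fun _ => V) i) q₀
    zero_le_one le_rfl
  obtain ⟨L₂, h₂⟩ := isTame_action hH (isTameOnSphere_zero (V := V))
    (c := fun i : Fin N => c N i) (fun i => hc0 N i)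
    (fun i => (i : ℝ) / N) (fun i => partialSum V N i) (fun i => PiLp.proj 2 (fun _ => V) i) q₀
    le_rfl zero_le_one
  have m0 := le_minimax hq₀ hlow
    (L := L₁)
    (fun w y η hw => sub_le_iff_le_add'.1 (abs_le.1 (h₁.bound w y η hw)).2)
  have m1 := minimax_le_minimax hq₀ hlow
    (L := L₂)
    (fun w y η hw => sub_le_iff_le_add'.1 (abs_le.1 (h₂.bound w y η hw)).2) (fun w y η _ => by
      simp only [action, hGq₀, sub_self, smul_zero, add_zero, zero_smul, Pi.zero_apply, sub_zero]
      refine add_le_add le_rfl (Finset.sum_le_sum fun i _ =>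
        mul_le_mul_of_nonneg_right ?_ (hH.nonneg _ _ _))
      simp only [hc, i.2, if_true]
      split_ifs
      exacts [le_rfl, by positivity])
  rw [hval] at m0 m1
  rw [hval', hζq] at m1
  refine ⟨s, x N, v, hs, hxs, hζs, htan, m0, m1.trans ?_⟩
  rw [div_self hN'.ne', hX1 s' hs'] at hxs'
  have h1 : ⟪x' N - ε • Q s' 1, q₀⟫ ≤ E / N := by
    refine (real_inner_le_norm _ _).trans ?_
    rwa [hq₀, mul_one]
  have h2 : ⟪Q s' 1, q₀⟫ ≤ 1 := by
    refine (real_inner_le_norm _ _).trans ?_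
    rw [hq₀, hf.norm_Q s' 1 hs' (by simp), mul_one]
  rw [inner_sub_left, real_inner_smul_left] at h1
  rw [Pi.zero_apply, sub_zero]
  nlinarith

lemma IsHamFlow.exists_front {X Q : V → ℝ → V} (hH : IsHam L C H Hx Hξ)
    (hf : IsHamFlow C Hx Hξ X Q) (hX : Continuous fun z : V × ℝ => X z.1 z.2)
    (hQ : Continuous fun z : V × ℝ => Q z.1 z.2)
    {G : V → ℝ} {g : V → V} {LG : ℝ} (hG : IsTameOnSphere LG G g)
    (hG0 : ∀ v, ‖v‖ = 1 → G v ≤ 0) {q₀ : V} (hq₀ : ‖q₀‖ = 1) (hGq₀ : G q₀ = 0) {ε : ℝ}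
    (hε : 0 ≤ ε) (hX1 : ∀ s, ‖s‖ = 1 → X s 1 = ε • Q s 1) {T : ℝ} (hT : T ∈ Icc (0 : ℝ) 1) :
    ∃ s, ‖s‖ = 1 ∧ X s T - g (Q s T) - ⟪X s T - g (Q s T), Q s T⟫ • Q s T = 0 ∧
      0 ≤ ⟪X s T, Q s T⟫ - G (Q s T) ∧ ⟪X s T, Q s T⟫ - G (Q s T) ≤ ε := by
  obtain ⟨E, hE⟩ := hf.exists_discrete_front hH hG hG0 hq₀ hGq₀ hε hX1
  have hM : ∃ M : ℕ → ℕ, Tendsto M atTop atTop ∧ ∀ j, 0 < M j ∧ 2 * C ≤ M j := by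
    refine ⟨fun j => j + (⌈2 * C⌉₊ + 1), tendsto_add_atTop_nat _, fun j => ⟨by simp, ?_⟩⟩
    refine (Nat.le_ceil _).trans ?_
    exact_mod_cast (by omega : ⌈2 * C⌉₊ ≤ j + (⌈2 * C⌉₊ + 1))
  obtain ⟨M, hMt, hM⟩ := hM
  have hfl : ∀ j, ⌊T * M j⌋₊ ≤ M j := fun j => by
    refine Nat.floor_le_of_le ?_
    nlinarith [hT.2, (Nat.cast_nonneg (M j) : (0 : ℝ) ≤ M j)]
  choose s x ζ hs hx hζ htan h0 h1 using fun j => hE (M j) ⌊T * M j⌋₊ (hM j).1 (hM j).2 (hfl j)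
  obtain ⟨s', hs', φ, hφ, hlim⟩ := (isCompact_sphere (0 : V) 1).tendsto_subseq
    (x := s) (fun j => by simpa using hs j)
  have hMφ : Tendsto (fun j => M (φ j)) atTop atTop := hMt.comp hφ.tendsto_atTop
  have hMr : Tendsto (fun j => (M (φ j) : ℝ)) atTop atTop := tendsto_natCast_atTop_atTop.comp hMφ
  have hEM : Tendsto (fun j => E / (M (φ j) : ℝ)) atTop (𝓝 0) := hMr.const_div_atTop E
  have ht : Tendsto (fun j => (⌊T * M (φ j)⌋₊ : ℝ) / M (φ j)) atTop (𝓝 T) :=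
    (tendsto_nat_floor_mul_div_atTop hT.1).comp hMr
  have hst : Tendsto (fun j => (s (φ j), (⌊T * M (φ j)⌋₊ : ℝ) / M (φ j))) atTop (𝓝 (s', T)) :=
    hlim.prodMk_nhds ht
  have hxl : Tendsto (fun j => x (φ j)) atTop (𝓝 (X s' T)) := by
    have := (squeeze_zero_norm (fun j => hx (φ j)) hEM).add ((hX.tendsto _).comp hst)
    simpa using this
  have hζl : Tendsto (fun j => ζ (φ j)) atTop (𝓝 (Q s' T)) := by
    have := (squeeze_zero_norm (fun j => hζ (φ j)) hEM).add ((hQ.tendsto _).comp hst)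
    simpa using this
  have hpair := hxl.prodMk_nhds hζl
  have hgc := hG.cont_g
  have hGc := hG.cont
  have c1 : Continuous fun z : V × V => z.1 - g z.2 - ⟪z.1 - g z.2, z.2⟫ • z.2 := by fun_prop
  have c2 : Continuous fun z : V × V => ⟪z.1, z.2⟫ - G z.2 := by fun_prop
  have l1 := (c1.tendsto _).comp hpair
  have l2 := (c2.tendsto _).comp hpair
  refine ⟨s', by simpa using hs', ?_, ?_, ?_⟩
  · refine tendsto_nhds_unique l1 ?_
    refine tendsto_const_nhds.congr fun j => (htan (φ j)).symm
  · exact ge_of_tendsto' l2 fun j => h0 (φ j)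
  · have := hEM.const_add ε
    rw [add_zero] at this
    exact le_of_tendsto_of_tendsto' l2 this fun j => h1 (φ j)

end Limit

section Front

open Filter Topology
open scoped ContDiff

variable {V : Type*} [NormedAddCommGroup V] [InnerProductSpace ℝ V]

/-- A parametrisation of a neighbourhood of the unit sphere which is the identity on the sphere
and whose derivative there is the tangential projection. -/
def retr (s : V) : V := ((3 - ‖s‖ ^ 2) / 2) • s

lemma retr_eq {s : V} (hs : ‖s‖ = 1) : retr s = s := by
  rw [retr, hs]; norm_num

lemma contDiff_retr {n : WithTop ℕ∞} : ContDiff ℝ n (retr : V → V) :=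
  ((contDiff_const.sub (contDiff_norm_sq ℝ)).div_const 2).smul contDiff_id

lemma hasFDerivAt_retr {s : V} (hs : ‖s‖ = 1) :
    HasFDerivAt retr (ContinuousLinearMap.id ℝ V - (innerSL ℝ s).smulRight s) s := by
  have h1 : HasFDerivAt (fun s : V => (3 - ‖s‖ ^ 2) / 2) (-innerSL ℝ s) s := by
    have h2 := ((hasStrictFDerivAt_norm_sq s).hasFDerivAt.const_sub 3).const_mul (1 / 2)
    refine (h2.congr_fderiv ?_).congr_of_eventuallyEq (Eventually.of_forall fun x => ?_)
    · ext v; simp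
    · simp only; ring
  refine (h1.smul (hasFDerivAt_id s)).congr_fderiv ?_
  ext v
  simp [hs]
  norm_num
  abel

lemma inner_fderiv_retr {s : V} (hs : ‖s‖ = 1) (v : V) : ⟪fderiv ℝ retr s v, s⟫ = 0 := by
  rw [(hasFDerivAt_retr hs).fderiv]
  simp only [sub_apply, ContinuousLinearMap.id_apply,
    ContinuousLinearMap.smulRight_apply, innerSL_apply_apply, inner_sub_left, real_inner_smul_left,
    real_inner_self_eq_norm_sq, hs, real_inner_comm v s]
  ring

/-- The front data of a Legendrian isotopy of spheres of cooriented contact elements: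
`⟪Q, dX⟫` vanishes along the slices and is at least `ε` in the time direction, the isotopy issues
from the origin, and ends at the front of radius `ε`. -/
structure IsFront (ε : ℝ) (X Q : V × ℝ → V) : Prop where
  smooth_X : ContDiff ℝ ∞ X
  smooth_Q : ContDiff ℝ ∞ Q
  norm_Q : ∀ s t, ‖s‖ = 1 → t ∈ Icc (0 : ℝ) 1 → ‖Q (s, t)‖ = 1
  leg : ∀ s t v, ‖s‖ = 1 → t ∈ Icc (0 : ℝ) 1 → ⟪v, s⟫ = 0 → ⟪Q (s, t), fderiv ℝ X (s, t) (v, 0)⟫ = 0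
  inj : ∀ s s' t, ‖s‖ = 1 → ‖s'‖ = 1 → t ∈ Icc (0 : ℝ) 1 → X (s, t) = X (s', t) →
    Q (s, t) = Q (s', t) → s = s'
  imm : ∀ s t v, ‖s‖ = 1 → t ∈ Icc (0 : ℝ) 1 → ⟪v, s⟫ = 0 → fderiv ℝ X (s, t) (v, 0) = 0 →
    fderiv ℝ Q (s, t) (v, 0) = 0 → v = 0
  pos : ∀ s t, ‖s‖ = 1 → t ∈ Icc (0 : ℝ) 1 → ε ≤ ⟪Q (s, t), fderiv ℝ X (s, t) (0, 1)⟫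
  X_zero : ∀ s, ‖s‖ = 1 → X (s, 0) = 0
  Q_zero : ∀ s, ‖s‖ = 1 → Q (s, 0) = s
  X_one : ∀ s, ‖s‖ = 1 → X (s, 1) = ε • Q (s, 1)

variable {ε : ℝ} {X Q : V × ℝ → V}

/-- The trace of the isotopy in space-time. -/
def trace (X Q : V × ℝ → V) (z : V × ℝ) : ℝ × V × V := (z.2, X z, Q z)

lemma IsFront.continuous_trace (h : IsFront ε X Q) : Continuous (trace X Q) := by
  have := h.smooth_X.continuous
  have := h.smooth_Q.continuous
  unfold trace
  fun_prop

lemma IsFront.injOn_trace (h : IsFront ε X Q) :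
    InjOn (trace X Q) (sphere (0 : V) 1 ×ˢ Icc (0 : ℝ) 1) := by
  rintro ⟨s, t⟩ ⟨hs, ht⟩ ⟨s', t'⟩ ⟨hs', -⟩ he
  simp only [trace, Prod.mk.injEq] at he
  obtain ⟨rfl, hX, hQ⟩ := he
  rw [h.inj s s' t (by simpa using hs) (by simpa using hs') ht hX hQ]

lemma isCompact_domain [FiniteDimensional ℝ V] :
    IsCompact (sphere (0 : V) 1 ×ˢ Icc (0 : ℝ) 1) := (isCompact_sphere _ _).prod isCompact_Icc

lemma IsFront.eventually_of_trace [FiniteDimensional ℝ V] (h : IsFront ε X Q) {s₀ : V} {t₀ : ℝ}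
    (hs : ‖s₀‖ = 1) (ht : t₀ ∈ Icc (0 : ℝ) 1) {p : V × ℝ → Prop} (hp : ∀ᶠ z in 𝓝 (s₀, t₀), p z) :
    ∀ᶠ w in 𝓝 (trace X Q (s₀, t₀)), ∀ s t, ‖s‖ = 1 → t ∈ Icc (0 : ℝ) 1 →
      trace X Q (s, t) = w → p (s, t) := by
  obtain ⟨U, hU, hUo, hmem⟩ := _root_.eventually_nhds_iff.1 hp
  have hK : IsClosed (trace X Q '' ((sphere (0 : V) 1 ×ˢ Icc (0 : ℝ) 1) \ U)) :=
    ((isCompact_domain.diff hUo).image h.continuous_trace).isClosed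
  have hnot : trace X Q (s₀, t₀) ∉ trace X Q '' ((sphere (0 : V) 1 ×ˢ Icc (0 : ℝ) 1) \ U) := by
    rintro ⟨z, ⟨hz, hzU⟩, he⟩
    rw [h.injOn_trace hz ⟨by simpa using hs, ht⟩ he] at hzU
    exact hzU hmem
  filter_upwards [hK.isOpen_compl.mem_nhds hnot] with w hw s t hs' ht' he
  refine hU _ ?_
  by_contra hn
  exact hw ⟨(s, t), ⟨⟨by simpa using hs', ht'⟩, hn⟩, he⟩

lemma IsFront.exists_local_inverse [FiniteDimensional ℝ V] (h : IsFront ε X Q) {s₀ : V} {t₀ : ℝ}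
    (hs : ‖s₀‖ = 1) (ht : t₀ ∈ Icc (0 : ℝ) 1) :
    ∃ f : ℝ × V × V → V, ContDiffAt ℝ 2 f (trace X Q (s₀, t₀)) ∧
      ∀ᶠ z in 𝓝 (s₀, t₀), ‖z.1‖ = 1 → f (trace X Q z) = z.1 := by
  set Y : V × ℝ → V × V := fun z => (X z, Q z) with hY
  have hYs : ContDiff ℝ ∞ Y := h.smooth_X.prodMk h.smooth_Q
  have hYd := (hYs.differentiable (by simp) (s₀, t₀)).hasFDerivAt
  set D := fderiv ℝ Y (s₀, t₀) with hD
  set P : V →L[ℝ] V := ContinuousLinearMap.id ℝ V - (innerSL ℝ s₀).smulRight s₀ with hP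
  have hDX : ∀ v, (D v).1 = fderiv ℝ X (s₀, t₀) v := fun v => by
    rw [hD, hY, DifferentiableAt.fderiv_prodMk (h.smooth_X.differentiable (by simp) _)
      (h.smooth_Q.differentiable (by simp) _)]; rfl
  have hDQ : ∀ v, (D v).2 = fderiv ℝ Q (s₀, t₀) v := fun v => by
    rw [hD, hY, DifferentiableAt.fderiv_prodMk (h.smooth_X.differentiable (by simp) _)
      (h.smooth_Q.differentiable (by simp) _)]; rfl
  set A : V →L[ℝ] (V × V) × ℝ :=
    (D.comp (P.prod (0 : V →L[ℝ] ℝ))).prod (innerSL ℝ s₀) with hA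
  have hAinj : LinearMap.ker (A : V →ₗ[ℝ] (V × V) × ℝ) = ⊥ := by
    rw [LinearMap.ker_eq_bot']
    intro v hv
    have h1 : D (P v, 0) = 0 ∧ ⟪s₀, v⟫ = 0 := by simpa [hA] using hv
    have hPv : P v = v := by simp [hP, h1.2]
    rw [hPv] at h1
    refine h.imm s₀ t₀ v hs ht (by rw [real_inner_comm]; exact h1.2) ?_ ?_
    · rw [← hDX, h1.1]; rfl
    · rw [← hDQ, h1.1]; rfl
  obtain ⟨ℓ', hℓ'⟩ := LinearMap.exists_leftInverse_of_injective (A : V →ₗ[ℝ] (V × V) × ℝ) hAinj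
  set ℓ : (V × V) × ℝ →L[ℝ] V := LinearMap.toContinuousLinearMap ℓ' with hℓdef
  have hℓ : ∀ v, ℓ (A v) = v := fun v => LinearMap.congr_fun hℓ' v
  set Ψ : V × ℝ → V × ℝ := fun z => (ℓ (Y (retr z.1, z.2), ‖z.1‖ ^ 2 / 2), z.2) with hΨ
  have hΨs : ContDiff ℝ ∞ Ψ := by
    have h1 : ContDiff ℝ ∞ fun z : V × ℝ => Y (retr z.1, z.2) :=
      hYs.comp ((contDiff_retr.comp contDiff_fst).prodMk contDiff_snd)
    have h2 : ContDiff ℝ ∞ fun z : V × ℝ => ‖z.1‖ ^ 2 / 2 :=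
      ((contDiff_norm_sq ℝ).comp contDiff_fst).div_const 2
    exact (ℓ.contDiff.comp (h1.prodMk h2)).prodMk contDiff_snd
  set e : (V × ℝ) ≃L[ℝ] (V × ℝ) := ContinuousLinearEquiv.equivOfInverse
    ((ContinuousLinearMap.fst ℝ V ℝ + (ℓ.comp ((D.comp
      ((0 : (V × ℝ) →L[ℝ] V).prod (ContinuousLinearMap.snd ℝ V ℝ))).prod 0))).prod
        (ContinuousLinearMap.snd ℝ V ℝ))
    ((ContinuousLinearMap.fst ℝ V ℝ - (ℓ.comp ((D.comp
      ((0 : (V × ℝ) →L[ℝ] V).prod (ContinuousLinearMap.snd ℝ V ℝ))).prod 0))).prod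
        (ContinuousLinearMap.snd ℝ V ℝ))
    (fun z => by simp) (fun z => by simp) with he
  have hΨd : HasFDerivAt Ψ (e : (V × ℝ) →L[ℝ] (V × ℝ)) (s₀, t₀) := by
    have h0 : HasFDerivAt (fun z : V × ℝ => (retr z.1, z.2))
        ((P.comp (ContinuousLinearMap.fst ℝ V ℝ)).prod (ContinuousLinearMap.snd ℝ V ℝ))
        (s₀, t₀) :=
      (HasFDerivAt.comp (s₀, t₀) (f := Prod.fst) (hasFDerivAt_retr hs) hasFDerivAt_fst).prodMk
        (f₂ := Prod.snd) hasFDerivAt_snd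
    have h1 : HasFDerivAt (fun z : V × ℝ => Y (retr z.1, z.2)) (D.comp
        ((P.comp (ContinuousLinearMap.fst ℝ V ℝ)).prod (ContinuousLinearMap.snd ℝ V ℝ)))
        (s₀, t₀) := by
      have h3 : HasFDerivAt Y D (retr s₀, t₀) := by rw [retr_eq hs]; exact hYd
      exact HasFDerivAt.comp (f := fun z : V × ℝ => (retr z.1, z.2)) (s₀, t₀) h3 h0
    have h2 : HasFDerivAt (fun z : V × ℝ => ‖z.1‖ ^ 2 / 2)
        ((innerSL ℝ s₀).comp (ContinuousLinearMap.fst ℝ V ℝ)) (s₀, t₀) := by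
      have h3 := (((hasStrictFDerivAt_norm_sq s₀).hasFDerivAt.comp (s₀, t₀)
        (hasFDerivAt_fst (𝕜 := ℝ) (E := V) (F := ℝ)))).const_mul (1 / 2)
      refine (h3.congr_fderiv ?_).congr_of_eventuallyEq (Eventually.of_forall fun x => ?_)
      · ext v <;> simp
      · simp only [Function.comp]; ring
    refine ((ℓ.hasFDerivAt.comp (s₀, t₀) (h1.prodMk h2)).prodMk hasFDerivAt_snd).congr_fderiv ?_
    ext1
    · ext1 v
      have h5 := hℓ v
      have h6 : ℓ (D (0, 0), 0) = 0 := by rw [show D (0, 0) = 0 from map_zero D]; exact map_zero ℓ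
      simp only [hA] at h5
      simpa [he, h6] using h5
    · ext <;> simp [he]
  have hΨa : ContDiffAt ℝ 2 Ψ (s₀, t₀) := (hΨs.of_le (WithTop.coe_le_coe.2 le_top)).contDiffAt
  set Φ := hΨa.localInverse hΨd (by simp) with hΦ
  have hΦs : ContDiffAt ℝ 2 Φ (Ψ (s₀, t₀)) := hΨa.to_localInverse hΨd (by simp)
  have hΦl : ∀ᶠ z in 𝓝 (s₀, t₀), Φ (Ψ z) = z :=
    (hΨa.hasStrictFDerivAt' hΨd (by simp)).eventually_left_inverse
  have hmodel : ∀ z : V × ℝ, ‖z.1‖ = 1 → Ψ z = (ℓ (Y z, 1 / 2), z.2) := fun z hz => by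
    simp only [hΨ, retr_eq hz, hz, one_pow]
  refine ⟨fun w => (Φ (ℓ (w.2, 1 / 2), w.1)).1, ?_, ?_⟩
  · have h1 : ContDiff ℝ 2 fun w : ℝ × V × V => (ℓ (w.2, (1 / 2 : ℝ)), w.1) :=
      (ℓ.contDiff.comp (contDiff_snd.prodMk contDiff_const)).prodMk contDiff_fst
    refine contDiffAt_fst.comp _ (ContDiffAt.comp _ ?_ h1.contDiffAt)
    have h2 := hmodel (s₀, t₀) hs
    simp only [trace]
    rw [h2] at hΦs
    exact hΦs
  · filter_upwards [hΦl] with z hz h1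
    rw [hmodel z h1] at hz
    simp only [trace]
    exact congrArg Prod.fst hz

/-- The parameter in the sphere is a function of class `C²` of the point of the trace. -/
lemma IsFront.exists_param [FiniteDimensional ℝ V] (h : IsFront ε X Q) :
    ∃ f : ℝ × V × V → V, ContDiff ℝ 2 f ∧
      ∀ s t, ‖s‖ = 1 → t ∈ Icc (0 : ℝ) 1 → f (t, X (s, t), Q (s, t)) = s := by
  obtain ⟨f, hf⟩ := exists_contMDiffMap_forall_mem_convex_of_local (n := (2 : ℕ∞))
    (modelWithCornersSelf ℝ (ℝ × V × V)) (F := V)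
    (t := fun w => {v | ∀ s t, ‖s‖ = 1 → t ∈ Icc (0 : ℝ) 1 → trace X Q (s, t) = w → v = s})
    (fun w => by
      intro v hv v' hv' a b _ _ hab s t hs ht he
      rw [hv s t hs ht he, hv' s t hs ht he, ← add_smul, hab, one_smul])
    (fun w => by
      by_cases hw : w ∈ trace X Q '' (sphere (0 : V) 1 ×ˢ Icc (0 : ℝ) 1)
      · obtain ⟨⟨s₀, t₀⟩, ⟨hs, ht⟩, rfl⟩ := hw
        rw [mem_sphere_zero_iff_norm] at hs
        obtain ⟨g, hg, hgl⟩ := h.exists_local_inverse hs ht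
        have h1 := hg.eventually (by simp)
        have h2 := h.eventually_of_trace hs ht hgl
        refine ⟨_, h1.and h2, g, ?_, ?_⟩
        · exact ContDiffOn.contMDiffOn fun y hy => hy.1.contDiffWithinAt
        · rintro y ⟨-, hy⟩ s t hs' ht' he
          rw [← he]
          exact hy s t hs' ht' he hs'
      · refine ⟨_, ((isCompact_domain.image h.continuous_trace).isClosed.isOpen_compl).mem_nhds hw,
          fun _ => 0, contMDiffOn_const, ?_⟩
        intro y hy s t hs ht he
        exact absurd ⟨(s, t), ⟨by simpa using hs, ht⟩, he⟩ hy)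
  exact ⟨f, f.contMDiff.contDiff, fun s t hs ht => hf _ s t hs ht rfl⟩

end Front

section Hamiltonian

open Filter Topology
open scoped ContDiff

variable {V : Type*} [NormedAddCommGroup V] [InnerProductSpace ℝ V] [FiniteDimensional ℝ V]
  {K : ℝ × V × V → ℝ}

/-- The vector representing the restriction of a functional to the second factor. -/
def reprSnd (a : ℝ × V × V →L[ℝ] ℝ) : V := (InnerProductSpace.toDual ℝ V).symm
  (a.comp ((ContinuousLinearMap.inr ℝ ℝ (V × V)).comp (ContinuousLinearMap.inl ℝ V V)))

/-- The vector representing the restriction of a functional to the third factor. -/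
def reprThd (a : ℝ × V × V →L[ℝ] ℝ) : V := (InnerProductSpace.toDual ℝ V).symm
  (a.comp ((ContinuousLinearMap.inr ℝ ℝ (V × V)).comp (ContinuousLinearMap.inr ℝ V V)))

lemma inner_reprSnd (a : ℝ × V × V →L[ℝ] ℝ) (v : V) : ⟪reprSnd a, v⟫ = a (0, v, 0) := by
  simp [reprSnd]

lemma inner_reprThd (a : ℝ × V × V →L[ℝ] ℝ) (v : V) : ⟪reprThd a, v⟫ = a (0, 0, v) := by
  simp [reprThd]

lemma continuous_reprSnd : Continuous (reprSnd (V := V)) :=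
  (InnerProductSpace.toDual ℝ V).symm.continuous.comp
    (ContinuousLinearMap.precomp ℝ ((ContinuousLinearMap.inr ℝ ℝ (V × V)).comp
      (ContinuousLinearMap.inl ℝ V V))).continuous

lemma norm_reprSnd_sub_le (a b : ℝ × V × V →L[ℝ] ℝ) : ‖reprSnd a - reprSnd b‖ ≤ ‖a - b‖ := by
  rw [reprSnd, reprSnd, ← map_sub, LinearIsometryEquiv.norm_map]
  refine ContinuousLinearMap.opNorm_le_bound _ (norm_nonneg (a - b)) fun v => ?_
  have h : ‖((0 : ℝ), v, (0 : V))‖ = ‖v‖ := by simp [Prod.norm_def]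
  simpa [h] using (a - b).le_opNorm (0, v, 0)

lemma continuous_reprThd : Continuous (reprThd (V := V)) :=
  (InnerProductSpace.toDual ℝ V).symm.continuous.comp
    (ContinuousLinearMap.precomp ℝ ((ContinuousLinearMap.inr ℝ ℝ (V × V)).comp
      (ContinuousLinearMap.inr ℝ V V))).continuous

lemma norm_reprThd_sub_le (a b : ℝ × V × V →L[ℝ] ℝ) : ‖reprThd a - reprThd b‖ ≤ ‖a - b‖ := by
  rw [reprThd, reprThd, ← map_sub, LinearIsometryEquiv.norm_map]
  refine ContinuousLinearMap.opNorm_le_bound _ (norm_nonneg (a - b)) fun v => ?_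
  have h : ‖((0 : ℝ), (0 : V), v)‖ = ‖v‖ := by simp [Prod.norm_def]
  simpa [h] using (a - b).le_opNorm (0, 0, v)

lemma reprSnd_zero : reprSnd (0 : ℝ × V × V →L[ℝ] ℝ) = 0 := by simp [reprSnd]

lemma reprThd_zero : reprThd (0 : ℝ × V × V →L[ℝ] ℝ) = 0 := by simp [reprThd]

lemma abs_sub_sub_fderiv_le {E : Type*} [NormedAddCommGroup E] [NormedSpace ℝ E] {K : E → ℝ}
    {L : ℝ} (hK : Differentiable ℝ K) (hL : 0 ≤ L)
    (hlip : ∀ z z', ‖fderiv ℝ K z - fderiv ℝ K z'‖ ≤ L * ‖z - z'‖) (z z' : E) :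
    |K z' - K z - fderiv ℝ K z (z' - z)| ≤ L * ‖z' - z‖ ^ 2 := by
  have hd := (convex_segment z z').norm_image_sub_le_of_norm_hasFDerivWithin_le' (f := K)
    (f' := fderiv ℝ K) (φ := fderiv ℝ K z) (C := L * ‖z' - z‖)
    (fun w _ => (hK w).hasFDerivAt.hasFDerivWithinAt)
    (fun w hw => (hlip w z).trans (mul_le_mul_of_nonneg_left (norm_sub_le_of_mem_segment hw) hL))
    (left_mem_segment ℝ z z') (right_mem_segment ℝ z z')
  rwa [mul_assoc, ← sq] at hd

lemma quadratic_upper_bound {L : ℝ} (hK : Differentiable ℝ K) (hL : 0 ≤ L)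
    (hlip : ∀ z z' : ℝ × V × V, ‖fderiv ℝ K z - fderiv ℝ K z'‖ ≤ L * ‖z - z'‖) (t : ℝ)
    (x ξ x' ξ' : V) :
    K (t, x', ξ') ≤ K (t, x, ξ) + ⟪reprSnd (fderiv ℝ K (t, x, ξ)), x' - x⟫
      + ⟪reprThd (fderiv ℝ K (t, x, ξ)), ξ' - ξ⟫ + L * (‖x' - x‖ ^ 2 + ‖ξ' - ξ‖ ^ 2) := by
  have hzz : ‖(t, x', ξ') - (t, x, ξ)‖ ^ 2 ≤ ‖x' - x‖ ^ 2 + ‖ξ' - ξ‖ ^ 2 := by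
    have : ‖(t, x', ξ') - (t, x, ξ)‖ = max ‖x' - x‖ ‖ξ' - ξ‖ := by simp [Prod.norm_def]
    rw [this]
    rcases max_cases ‖x' - x‖ ‖ξ' - ξ‖ with h | h <;> rw [h.1] <;>
      nlinarith [sq_nonneg ‖x' - x‖, sq_nonneg ‖ξ' - ξ‖]
  have hsplit : fderiv ℝ K (t, x, ξ) ((t, x', ξ') - (t, x, ξ))
      = ⟪reprSnd (fderiv ℝ K (t, x, ξ)), x' - x⟫ + ⟪reprThd (fderiv ℝ K (t, x, ξ)), ξ' - ξ⟫ := by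
    rw [inner_reprSnd, inner_reprThd, ← map_add]
    simp
  have h1 := (le_abs_self _).trans (abs_sub_sub_fderiv_le hK hL hlip (t, x, ξ) (t, x', ξ'))
  rw [hsplit] at h1
  have := mul_le_mul_of_nonneg_left hzz hL
  linarith

lemma exists_bounds_of_hasCompactSupport {E : Type*} [NormedAddCommGroup E] [NormedSpace ℝ E]
    {K : E → ℝ} (hK : ContDiff ℝ 2 K) (hc : HasCompactSupport K) :
    ∃ L, 0 ≤ L ∧ (∀ z, |K z| ≤ L) ∧ (∀ z, ‖fderiv ℝ K z‖ ≤ L) ∧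
      ∀ z z', ‖fderiv ℝ K z - fderiv ℝ K z'‖ ≤ L * ‖z - z'‖ := by
  have hK1 : ContDiff ℝ 1 (fderiv ℝ K) := hK.fderiv_right (by norm_num)
  have hc1 : HasCompactSupport (fderiv ℝ K) := hc.fderiv ℝ
  obtain ⟨M, hM⟩ := hK1.lipschitzWith_of_hasCompactSupport hc1 (by simp)
  obtain ⟨B₀, hB₀⟩ := hc.exists_bound_of_continuous hK.continuous
  obtain ⟨B₁, hB₁⟩ := hc1.exists_bound_of_continuous hK1.continuous
  refine ⟨max (M : ℝ) (max B₀ B₁), M.2.trans (le_max_left _ _), fun z => ?_, fun z => ?_,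
    fun z z' => (hM.norm_sub_le z z').trans ?_⟩
  · exact (hB₀ _).trans ((le_max_left _ _).trans (le_max_right _ _))
  · exact (hB₁ _).trans ((le_max_right _ _).trans (le_max_right _ _))
  · gcongr
    exact le_max_left _ _

lemma exists_isHam (hK : ContDiff ℝ 2 K) (hc : HasCompactSupport K) (h0 : ∀ z, 0 ≤ K z) {C : ℝ}
    (hC : 0 ≤ C) (hle : ∀ t x ξ v, fderiv ℝ K (t, x, ξ) (0, v, 0) ≤ C * ‖ξ‖ * ‖v‖)
    (heuler : ∀ t x ξ, Real.exp (-2 * C) ≤ ‖ξ‖ → ‖ξ‖ ≤ Real.exp C →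
      K (t, x, ξ) = fderiv ℝ K (t, x, ξ) (0, 0, ξ)) :
    ∃ L, IsHam L C (fun t x ξ => K (t, x, ξ)) (fun t x ξ => reprSnd (fderiv ℝ K (t, x, ξ)))
      (fun t x ξ => reprThd (fderiv ℝ K (t, x, ξ))) := by
  have hK1 : ContDiff ℝ 1 (fderiv ℝ K) := hK.fderiv_right (by norm_num)
  obtain ⟨L, hL0, hB₀, hB₁, hlip⟩ := exists_bounds_of_hasCompactSupport hK hc
  have hn : ∀ (t : ℝ) (x ξ : V), ‖(t, x, ξ)‖ ≤ |t| + ‖x‖ + ‖ξ‖ := fun t x ξ => by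
    rw [Prod.norm_def, Prod.norm_def, Real.norm_eq_abs]
    have := abs_nonneg t; have := norm_nonneg x; have := norm_nonneg ξ
    exact max_le (by linarith) (max_le (by linarith) (by linarith))
  have hlip' : ∀ t x ξ t' x' ξ', ‖fderiv ℝ K (t, x, ξ) - fderiv ℝ K (t', x', ξ')‖
      ≤ L * (|t - t'| + ‖x - x'‖ + ‖ξ - ξ'‖) := fun t x ξ t' x' ξ' =>
    (hlip _ _).trans (mul_le_mul_of_nonneg_left (hn _ _ _) hL0)
  have hcz : ∀ t : ℝ, Continuous fun z : V × V => (t, z.1, z.2) := fun t => by fun_prop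
  have hcS : Continuous (reprSnd (V := V)) :=
    continuous_reprSnd
  have hcT : Continuous (reprThd (V := V)) :=
    continuous_reprThd
  refine ⟨L, fun t x ξ => h0 _, fun t => hK.continuous.comp (hcz t),
    fun t => hcS.comp (hK1.continuous.comp (hcz t)),
    fun t => hcT.comp (hK1.continuous.comp (hcz t)), fun t x ξ => ?_, fun t x ξ => ?_,
    fun t x ξ => ?_, fun t x ξ t' x' ξ' => (norm_reprSnd_sub_le _ _).trans (hlip' _ _ _ _ _ _),
    fun t x ξ t' x' ξ' => (norm_reprThd_sub_le _ _).trans (hlip' _ _ _ _ _ _),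
    fun t x ξ x' ξ' => ?_, hC, fun t x ξ => ?_, fun t x ξ h1 h2 => ?_⟩
  · exact (le_abs_self _).trans (hB₀ _)
  · have := norm_reprSnd_sub_le (fderiv ℝ K (t, x, ξ)) 0
    rw [reprSnd_zero, sub_zero, sub_zero] at this
    exact this.trans (hB₁ _)
  · have := norm_reprThd_sub_le (fderiv ℝ K (t, x, ξ)) 0
    rw [reprThd_zero, sub_zero, sub_zero] at this
    exact this.trans (hB₁ _)
  · exact quadratic_upper_bound (hK.differentiable (by simp)) hL0 hlip t x ξ x' ξ'
  · by_contra! hlt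
    have h1 := hle t x ξ (reprSnd (fderiv ℝ K (t, x, ξ)))
    rw [← inner_reprSnd, real_inner_self_eq_norm_sq, sq] at h1
    have h2 : 0 < ‖reprSnd (fderiv ℝ K (t, x, ξ))‖ := lt_of_le_of_lt (by positivity) hlt
    exact absurd (le_of_mul_le_mul_right h1 h2) (not_le.2 hlt)
  · rw [inner_reprThd]
    exact heuler t x ξ h1 h2

end Hamiltonian

section Homogenization

open Filter Topology
open scoped ContDiff

variable {V : Type*} [NormedAddCommGroup V] [InnerProductSpace ℝ V]
  {B : ℝ × V × V → ℝ} {C : ℝ}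

/-- A cutoff function equal to one on the annulus `exp (-2 C) ≤ ‖ξ‖ ≤ exp C`. -/
def annulusCutoff (C : ℝ) (ξ : V) : ℝ :=
  Real.smoothTransition (4 / Real.exp (-2 * C) ^ 2 * ‖ξ‖ ^ 2 - 1) *
    Real.smoothTransition (2 + Real.exp C ^ 2 - ‖ξ‖ ^ 2)

lemma contDiff_annulusCutoff : ContDiff ℝ 2 (annulusCutoff C : V → ℝ) := by
  have h := contDiff_norm_sq ℝ (E := V) (n := 2)
  exact (Real.smoothTransition.contDiff.comp ((contDiff_const.mul h).sub contDiff_const)).mul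
    (Real.smoothTransition.contDiff.comp (contDiff_const.sub h))

omit [InnerProductSpace ℝ V] in
lemma annulusCutoff_nonneg (ξ : V) : 0 ≤ annulusCutoff C ξ :=
  mul_nonneg (Real.smoothTransition.nonneg _) (Real.smoothTransition.nonneg _)

omit [InnerProductSpace ℝ V] in
lemma annulusCutoff_le_one (ξ : V) : annulusCutoff C ξ ≤ 1 :=
  mul_le_one₀ (Real.smoothTransition.le_one _) (Real.smoothTransition.nonneg _)
    (Real.smoothTransition.le_one _)

omit [InnerProductSpace ℝ V] in
lemma annulusCutoff_eventually_eq_zero : ∀ᶠ ξ : V in 𝓝 0, annulusCutoff C ξ = 0 := by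
  have hc : Continuous fun ξ : V => 4 / Real.exp (-2 * C) ^ 2 * ‖ξ‖ ^ 2 - 1 := by fun_prop
  filter_upwards [(hc.tendsto 0).eventually_lt_const (u := 0) (by norm_num)] with ξ hξ
  rw [annulusCutoff, Real.smoothTransition.zero_of_nonpos hξ.le, zero_mul]

omit [InnerProductSpace ℝ V] in
lemma annulusCutoff_eq_zero {ξ : V} (h : 2 + Real.exp C ≤ ‖ξ‖) : annulusCutoff C ξ = 0 := by
  rw [annulusCutoff, Real.smoothTransition.zero_of_nonpos (x := 2 + _ - _), mul_zero]
  nlinarith [Real.exp_pos C]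

omit [InnerProductSpace ℝ V] in
lemma annulusCutoff_eventually_eq_one {ξ : V} (h1 : Real.exp (-2 * C) ≤ ‖ξ‖)
    (h2 : ‖ξ‖ ≤ Real.exp C) : ∀ᶠ ζ in 𝓝 ξ, annulusCutoff C ζ = 1 := by
  have hc : Continuous fun ξ : V => 4 / Real.exp (-2 * C) ^ 2 * ‖ξ‖ ^ 2 - 1 := by fun_prop
  have hd : Continuous fun ξ : V => 2 + Real.exp C ^ 2 - ‖ξ‖ ^ 2 := by fun_prop
  have hpos := Real.exp_pos (-2 * C)
  have e1 : 1 < 4 / Real.exp (-2 * C) ^ 2 * ‖ξ‖ ^ 2 - 1 := by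
    have : 4 ≤ 4 / Real.exp (-2 * C) ^ 2 * ‖ξ‖ ^ 2 := by
      rw [div_mul_eq_mul_div, le_div_iff₀ (by positivity)]
      gcongr
    linarith
  have e2 : 1 < 2 + Real.exp C ^ 2 - ‖ξ‖ ^ 2 := by
    have := pow_le_pow_left₀ (norm_nonneg ξ) h2 2
    linarith
  filter_upwards [hc.continuousAt.eventually (lt_mem_nhds e1),
    hd.continuousAt.eventually (lt_mem_nhds e2)] with ζ h3 h4
  rw [annulusCutoff, Real.smoothTransition.one_of_one_le h3.le,
    Real.smoothTransition.one_of_one_le h4.le, one_mul]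

/-- The extension of a function of unit covectors to one which is homogeneous of degree one on an
annulus. -/
def homogenize (C : ℝ) (B : ℝ × V × V → ℝ) (z : ℝ × V × V) : ℝ :=
  annulusCutoff C z.2.2 * ‖z.2.2‖ * B (z.1, z.2.1, ‖z.2.2‖⁻¹ • z.2.2)

lemma contDiff_homogenize (hB : ContDiff ℝ 2 B) : ContDiff ℝ 2 (homogenize C B) := by
  rw [contDiff_iff_contDiffAt]
  rintro ⟨t, x, ξ⟩
  by_cases hξ : ξ = 0
  · have hc : Continuous fun z : ℝ × V × V => z.2.2 := by fun_prop
    have h1 : ∀ᶠ z in 𝓝 (t, x, ξ), annulusCutoff C z.2.2 = 0 :=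
      (hc.tendsto (t, x, ξ)).eventually (p := fun ζ => annulusCutoff C ζ = 0)
        (by rw [hξ]; exact annulusCutoff_eventually_eq_zero)
    refine (contDiffAt_const (c := (0 : ℝ))).congr_of_eventuallyEq ?_
    filter_upwards [h1] with z hz
    rw [homogenize, hz, zero_mul, zero_mul]
  · have h2 : ContDiffAt ℝ 2 (fun z : ℝ × V × V => z.2.2) (t, x, ξ) :=
      (contDiff_snd.comp contDiff_snd).contDiffAt
    have h3 : ContDiffAt ℝ 2 (fun z : ℝ × V × V => ‖z.2.2‖) (t, x, ξ) := h2.norm ℝ hξ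
    have h4 : ContDiffAt ℝ 2 (fun z : ℝ × V × V => (z.1, z.2.1, ‖z.2.2‖⁻¹ • z.2.2)) (t, x, ξ) :=
      contDiffAt_fst.prodMk ((contDiff_fst.comp contDiff_snd).contDiffAt.prodMk
        ((h3.inv (norm_ne_zero_iff.2 hξ)).smul h2))
    exact ((contDiff_annulusCutoff.contDiffAt.comp _ h2).mul h3).mul (hB.contDiffAt.comp _ h4)

lemma hasCompactSupport_homogenize [FiniteDimensional ℝ V] (hc : HasCompactSupport B) :
    HasCompactSupport (homogenize C B) := by
  obtain ⟨R, hR⟩ := hc.isCompact.isBounded.subset_closedBall 0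
  refine HasCompactSupport.intro (K := closedBall (0 : ℝ) R ×ˢ closedBall (0 : V) R ×ˢ
    closedBall (0 : V) (2 + Real.exp C)) ((isCompact_closedBall _ _).prod
      ((isCompact_closedBall _ _).prod (isCompact_closedBall _ _))) ?_
  rintro ⟨t, x, ξ⟩ hz
  by_contra hne
  have h1 : annulusCutoff C ξ ≠ 0 := fun h => hne (by simp [homogenize, h])
  have h2 : B (t, x, ‖ξ‖⁻¹ • ξ) ≠ 0 := fun h => hne (by simp [homogenize, h])
  have h3 := hR (subset_tsupport B h2)
  rw [mem_closedBall_zero_iff, Prod.norm_def, Prod.norm_def] at h3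
  refine hz ⟨?_, ?_, ?_⟩
  · rw [mem_closedBall_zero_iff]; exact (le_max_left _ _).trans h3
  · rw [mem_closedBall_zero_iff]
    exact (le_max_left _ _).trans ((le_max_right _ _).trans h3)
  · rw [mem_closedBall_zero_iff]
    by_contra! h4
    exact h1 (annulusCutoff_eq_zero h4.le)

lemma fderiv_homogenize_snd (hB : ContDiff ℝ 2 B) (t : ℝ) (x ξ v : V) :
    fderiv ℝ (homogenize C B) (t, x, ξ) (0, v, 0)
      = annulusCutoff C ξ * ‖ξ‖ * fderiv ℝ B (t, x, ‖ξ‖⁻¹ • ξ) (0, v, 0) := by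
  have h1 := (((contDiff_homogenize (C := C) hB).differentiable (by simp)
    (t, x, ξ)).hasFDerivAt.hasLineDerivAt (0, v, 0))
  have h2 := ((hB.differentiable (by simp)
    (t, x, ‖ξ‖⁻¹ • ξ)).hasFDerivAt.hasLineDerivAt (0, v, 0))
  rw [HasLineDerivAt] at h1 h2
  refine h1.unique ((h2.const_mul (annulusCutoff C ξ * ‖ξ‖)).congr_of_eventuallyEq
    (Eventually.of_forall fun r => ?_))
  simp [homogenize]

lemma hasDerivAt_norm_line {q : V} (hq : ‖q‖ = 1) {σ : ℝ} (hσ : 0 < σ) (w : V) :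
    HasDerivAt (fun r : ℝ => ‖σ • q + r • w‖) ⟪q, w⟫ 0 := by
  have h1 : HasDerivAt (fun r : ℝ => σ • q + r • w) w 0 := by
    simpa using ((hasDerivAt_id (0 : ℝ)).smul_const w).const_add (σ • q)
  have h2 := h1.norm_sq.sqrt (by simp [norm_smul, hq, hσ.ne'])
  simp only [Real.sqrt_sq (norm_nonneg _)] at h2
  refine h2.congr_deriv ?_
  simp only [zero_smul, add_zero, norm_smul, hq, mul_one, real_inner_smul_left, Real.norm_eq_abs,
    abs_of_pos hσ]
  field_simp

lemma fderiv_homogenize_thd (hB : ContDiff ℝ 2 B) (t : ℝ) (x : V) {q : V} (hq : ‖q‖ = 1) {σ : ℝ}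
    (h1 : Real.exp (-2 * C) ≤ σ) (h2 : σ ≤ Real.exp C) (w : V) :
    fderiv ℝ (homogenize C B) (t, x, σ • q) (0, 0, w)
      = ⟪q, w⟫ * B (t, x, q) + fderiv ℝ B (t, x, q) (0, 0, w - ⟪q, w⟫ • q) := by
  have hσ : 0 < σ := (Real.exp_pos _).trans_le h1
  have hn : ‖σ • q‖ = σ := by rw [norm_smul, hq, mul_one, Real.norm_eq_abs, abs_of_pos hσ]
  have h3 := (((contDiff_homogenize (C := C) hB).differentiable (by simp)
    (t, x, σ • q)).hasFDerivAt.hasLineDerivAt (0, 0, w))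
  rw [HasLineDerivAt] at h3
  have h4 : HasDerivAt (fun r : ℝ => σ • q + r • w) w 0 := by
    simpa using ((hasDerivAt_id (0 : ℝ)).smul_const w).const_add (σ • q)
  have h5 := hasDerivAt_norm_line hq hσ w
  have h6 := ((hasDerivAt_const (0 : ℝ) t).prodMk ((hasDerivAt_const (0 : ℝ) x).prodMk
    ((h5.inv (by simp [hn, hσ.ne'])).smul h4)))
  have hpt : (t, x, ((fun r : ℝ => ‖σ • q + r • w‖)⁻¹ • fun r : ℝ => σ • q + r • w) 0)
      = (t, x, q) := by
    simp [hn, smul_smul, hσ.ne']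
  have h7 : HasFDerivAt B (fderiv ℝ B (t, x, q))
      (t, x, ((fun r : ℝ => ‖σ • q + r • w‖)⁻¹ • fun r : ℝ => σ • q + r • w) 0) := by
    rw [hpt]
    exact (hB.differentiable (by simp) _).hasFDerivAt
  have h8 := h5.mul (h7.comp_hasDerivAt (0 : ℝ) h6)
  have hev : ∀ᶠ r : ℝ in 𝓝 0, annulusCutoff C (σ • q + r • w) = 1 := by
    refine h4.continuousAt.tendsto.eventually (p := fun ζ => annulusCutoff C ζ = 1) ?_
    rw [zero_smul, add_zero]
    exact annulusCutoff_eventually_eq_one (by rwa [hn]) (by rwa [hn])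
  refine (h3.unique (h8.congr_of_eventuallyEq ?_)).trans ?_
  · filter_upwards [hev] with r hr
    simp [homogenize, hr]
  · simp only [Function.comp_apply, hpt]
    simp only [zero_smul, add_zero, hn, Pi.inv_apply, neg_div]
    congr 1
    rw [← smul_eq_mul, ← map_smul]
    congr 1
    simp only [Prod.smul_mk, smul_zero, Prod.mk.injEq, true_and]
    rw [smul_add, smul_smul, smul_smul, smul_smul, mul_inv_cancel₀ hσ.ne', one_smul, sub_eq_add_neg,
      ← neg_smul]
    congr 2
    field_simp

variable [FiniteDimensional ℝ V]

lemma exists_isHam_of_contDiff (hB : ContDiff ℝ 2 B) (hc : HasCompactSupport B)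
    (h0 : ∀ z, 0 ≤ B z) : ∃ (L C : ℝ) (H : ℝ → V → V → ℝ) (Hx Hξ : ℝ → V → V → V),
      IsHam L C H Hx Hξ ∧ ∀ t x q σ, ‖q‖ = 1 → Real.exp (-2 * C) ≤ σ → σ ≤ Real.exp C →
        Hx t x (σ • q) = σ • reprSnd (fderiv ℝ B (t, x, q)) ∧
        ∀ w, ⟪Hξ t x (σ • q), w⟫
          = ⟪q, w⟫ * B (t, x, q) + fderiv ℝ B (t, x, q) (0, 0, w - ⟪q, w⟫ • q) := by
  obtain ⟨C, hC, -, hC1, -⟩ := exists_bounds_of_hasCompactSupport hB hc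
  have hn : ∀ v : V, ‖((0 : ℝ), v, (0 : V))‖ = ‖v‖ := fun v => by simp [Prod.norm_def]
  obtain ⟨L, hL⟩ := exists_isHam (K := homogenize C B) (C := C) (contDiff_homogenize hB)
    (hasCompactSupport_homogenize hc)
    (fun z => mul_nonneg (mul_nonneg (annulusCutoff_nonneg _) (norm_nonneg _)) (h0 _)) hC
    (fun t x ξ v => by
      rw [fderiv_homogenize_snd hB]
      have h1 := (le_abs_self _).trans
        ((fderiv ℝ B (t, x, ‖ξ‖⁻¹ • ξ)).le_of_opNorm_le (hC1 _) (0, v, 0))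
      rw [hn] at h1
      have h2 : annulusCutoff C ξ * ‖ξ‖ ≤ ‖ξ‖ :=
        mul_le_of_le_one_left (norm_nonneg _) (annulusCutoff_le_one _)
      have h3 : 0 ≤ annulusCutoff C ξ * ‖ξ‖ := mul_nonneg (annulusCutoff_nonneg _) (norm_nonneg _)
      calc _ ≤ annulusCutoff C ξ * ‖ξ‖ * (C * ‖v‖) := mul_le_mul_of_nonneg_left h1 h3
        _ ≤ ‖ξ‖ * (C * ‖v‖) := mul_le_mul_of_nonneg_right h2 (by positivity)
        _ = C * ‖ξ‖ * ‖v‖ := by ring)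
    (fun t x ξ h1 h2 => by
      have hpos : 0 < ‖ξ‖ := (Real.exp_pos _).trans_le h1
      have hq : ‖‖ξ‖⁻¹ • ξ‖ = 1 := by
        rw [norm_smul, norm_inv, norm_norm, inv_mul_cancel₀ hpos.ne']
      have h3 := fderiv_homogenize_thd hB t x hq h1 h2 ξ
      have h4 : ‖ξ‖ • ‖ξ‖⁻¹ • ξ = ξ := by rw [smul_smul, mul_inv_cancel₀ hpos.ne', one_smul]
      have h5 : ⟪‖ξ‖⁻¹ • ξ, ξ⟫ = ‖ξ‖ := by
        rw [real_inner_smul_left, real_inner_self_eq_norm_sq]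
        field_simp
      have h6 : ((0 : ℝ), (0 : V), (0 : V)) = 0 := rfl
      rw [h4, h5, h4, sub_self, h6, map_zero, add_zero] at h3
      rw [h3, homogenize, (annulusCutoff_eventually_eq_one h1 h2).self_of_nhds, one_mul])
  refine ⟨L, C, _, _, _, hL, fun t x q σ hq h1 h2 => ⟨?_, fun w => ?_⟩⟩
  · have hσ : 0 < σ := (Real.exp_pos _).trans_le h1
    have hn : ‖σ • q‖ = σ := by rw [norm_smul, hq, mul_one, Real.norm_eq_abs, abs_of_pos hσ]
    refine ext_inner_right ℝ fun v => ?_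
    rw [inner_reprSnd, real_inner_smul_left, inner_reprSnd, fderiv_homogenize_snd hB,
      (annulusCutoff_eventually_eq_one (by rwa [hn]) (by rwa [hn])).self_of_nhds, hn, smul_smul,
      inv_mul_cancel₀ hσ.ne', one_smul, one_mul]
  · rw [inner_reprThd, fderiv_homogenize_thd hB t x hq h1 h2]

end Homogenization

section FrontHamiltonian

open Filter Topology
open scoped ContDiff

lemma eq_zero_of_hasDerivAt_of_eqOn_Icc {f : ℝ → ℝ} {f' t : ℝ} (ht : t ∈ Icc (0 : ℝ) 1)
    (hf : HasDerivAt f f' t) (h0 : ∀ τ ∈ Icc (0 : ℝ) 1, f τ = 0) : f' = 0 :=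
  (uniqueDiffOn_Icc one_pos t ht).eq_deriv _ hf.hasDerivWithinAt
    ((hasDerivWithinAt_const t _ 0).congr h0 (h0 t ht))

variable {V : Type*} [NormedAddCommGroup V] [InnerProductSpace ℝ V]
  {ε : ℝ} {X Q : V × ℝ → V}

lemma hasDerivAt_slice {E : Type*} [NormedAddCommGroup E] [NormedSpace ℝ E] {Y : V × ℝ → E}
    {s : V} {t : ℝ} (hY : DifferentiableAt ℝ Y (s, t)) :
    HasDerivAt (fun τ => Y (s, τ)) (fderiv ℝ Y (s, t) (0, 1)) t :=
  hY.hasFDerivAt.comp_hasDerivAt t ((hasDerivAt_const t s).prodMk (hasDerivAt_id t))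

lemma hasDerivAt_comp_of_eq {E : Type*} [NormedAddCommGroup E] [NormedSpace ℝ E] {Y : V × ℝ → E}
    (hY : ContDiff ℝ ∞ Y) {p : ℝ → V × ℝ} {p' z : V × ℝ} {r : ℝ} (hp : HasDerivAt p p' r)
    (hz : p r = z) : HasDerivAt (fun r => Y (p r)) (fderiv ℝ Y z p') r := by
  subst hz
  exact (hY.differentiable (by simp) _).hasFDerivAt.comp_hasDerivAt r hp

/-- The value of the contact form on the velocity of the isotopy. -/
def speed (X Q : V × ℝ → V) (z : V × ℝ) : ℝ := ⟪Q z, fderiv ℝ X z (0, 1)⟫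

lemma contDiff_fderiv_apply {Y : V × ℝ → V} (hY : ContDiff ℝ ∞ Y) (v : V × ℝ) :
    ContDiff ℝ ∞ fun z => fderiv ℝ Y z v :=
  (hY.fderiv_right (m := ∞) (by simp)).clm_apply contDiff_const

lemma hasFDerivAt_fderiv_apply {Y : V × ℝ → V} (hY : ContDiff ℝ ∞ Y) (v z : V × ℝ) :
    HasFDerivAt (fun z => fderiv ℝ Y z v) ((fderiv ℝ (fderiv ℝ Y) z).flip v) z := by
  have h : ContDiff ℝ ∞ (fderiv ℝ Y) := hY.fderiv_right (m := ∞) (by simp)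
  exact ((h.differentiable (by simp) z).hasFDerivAt.clm_apply (hasFDerivAt_const v z)).congr_fderiv
    (by ext <;> simp)

lemma IsFront.fderiv_speed (h : IsFront ε X Q) {s w : V} {t : ℝ} (hs : ‖s‖ = 1)
    (ht : t ∈ Icc (0 : ℝ) 1) (hw : ⟪w, s⟫ = 0) :
    fderiv ℝ (speed X Q) (s, t) (w, 0) = ⟪fderiv ℝ Q (s, t) (w, 0), fderiv ℝ X (s, t) (0, 1)⟫
      - ⟪fderiv ℝ Q (s, t) (0, 1), fderiv ℝ X (s, t) (w, 0)⟫ := by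
  have hQ := (h.smooth_Q.differentiable (by simp) (s, t)).hasFDerivAt
  have h1 := hQ.inner ℝ (hasFDerivAt_fderiv_apply h.smooth_X (0, 1) (s, t))
  have h2 := hQ.inner ℝ (hasFDerivAt_fderiv_apply h.smooth_X (w, 0) (s, t))
  have h3 := h2.comp_hasDerivAt t ((hasDerivAt_const t s).prodMk (hasDerivAt_id t))
  have h4 := eq_zero_of_hasDerivAt_of_eqOn_Icc ht h3 fun τ hτ => h.leg s τ w hs hτ hw
  have hsymm : fderiv ℝ (fderiv ℝ X) (s, t) (w, 0) (0, 1)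
      = fderiv ℝ (fderiv ℝ X) (s, t) (0, 1) (w, 0) :=
    (h.smooth_X.contDiffAt.isSymmSndFDerivAt
      (by
        rw [minSmoothness_of_isRCLikeNormedField]
        exact WithTop.coe_le_coe.2 le_top)) _ _
  have h5 : fderiv ℝ (speed X Q) (s, t) = _ := h1.fderiv
  rw [h5]
  simp [fderivInnerCLM_apply] at h4 ⊢
  rw [hsymm]
  linarith

/-- The first order extension of the speed of a front from its trace. -/
def extendSpeed (X Q : V × ℝ → V) (f : ℝ × V × V → V) (y : ℝ × V × V) : ℝ :=
  speed X Q (retr (f y), y.1)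
    - ⟪fderiv ℝ Q (retr (f y), y.1) (0, 1), y.2.1 - X (retr (f y), y.1)⟫
    + ⟪fderiv ℝ X (retr (f y), y.1) (0, 1), y.2.2 - Q (retr (f y), y.1)⟫

variable {f : ℝ × V × V → V}

lemma IsFront.contDiff_speed (h : IsFront ε X Q) : ContDiff ℝ ∞ (speed X Q) :=
  h.smooth_Q.inner ℝ (contDiff_fderiv_apply h.smooth_X _)

lemma IsFront.contDiff_extendSpeed (h : IsFront ε X Q) (hf : ContDiff ℝ 2 f) :
    ContDiff ℝ 2 (extendSpeed X Q f) := by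
  have hp : ContDiff ℝ 2 fun y : ℝ × V × V => (retr (f y), y.1) :=
    (contDiff_retr.comp hf).prodMk contDiff_fst
  have hle : (2 : WithTop ℕ∞) ≤ ∞ := WithTop.coe_le_coe.2 le_top
  have hx : ContDiff ℝ 2 fun y : ℝ × V × V => y.2.1 := contDiff_fst.comp contDiff_snd
  have hq : ContDiff ℝ 2 fun y : ℝ × V × V => y.2.2 := contDiff_snd.comp contDiff_snd
  exact (((h.contDiff_speed.of_le hle).comp hp).sub
    ((((contDiff_fderiv_apply h.smooth_Q (0, 1)).of_le hle).comp hp).inner ℝ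
      (hx.sub ((h.smooth_X.of_le hle).comp hp)))).add
    ((((contDiff_fderiv_apply h.smooth_X (0, 1)).of_le hle).comp hp).inner ℝ
      (hq.sub ((h.smooth_Q.of_le hle).comp hp)))

lemma extendSpeed_trace {s : V} {t : ℝ} (hs : ‖s‖ = 1) (hf : f (t, X (s, t), Q (s, t)) = s) :
    extendSpeed X Q f (t, X (s, t), Q (s, t)) = speed X Q (s, t) := by
  simp [extendSpeed, hf, retr_eq hs]

lemma IsFront.fderiv_extendSpeed (h : IsFront ε X Q) (hf : ContDiff ℝ 2 f) {s : V} {t : ℝ}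
    (hs : ‖s‖ = 1) (ht : t ∈ Icc (0 : ℝ) 1) (hfs : f (t, X (s, t), Q (s, t)) = s) (v w : V) :
    fderiv ℝ (extendSpeed X Q f) (t, X (s, t), Q (s, t)) (0, v, w)
      = ⟪fderiv ℝ X (s, t) (0, 1), w⟫ - ⟪fderiv ℝ Q (s, t) (0, 1), v⟫ := by
  set y : ℝ × V × V := (t, X (s, t), Q (s, t)) with hy
  have hL := ((h.contDiff_extendSpeed hf).differentiable (by simp) y).hasFDerivAt.hasLineDerivAt
    (0, v, w)
  rw [HasLineDerivAt] at hL
  have hγ : HasDerivAt (fun r : ℝ => y + r • ((0 : ℝ), v, w)) (0, v, w) 0 := by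
    simpa using ((hasDerivAt_id (0 : ℝ)).smul_const ((0 : ℝ), v, w)).const_add y
  have hy0 : y + (0 : ℝ) • ((0 : ℝ), v, w) = y := by simp
  set u := fderiv ℝ retr s (fderiv ℝ f y (0, v, w)) with hu
  have hus : ⟪u, s⟫ = 0 := inner_fderiv_retr hs _
  have hfγ : HasDerivAt (fun r : ℝ => f (y + r • ((0 : ℝ), v, w))) (fderiv ℝ f y (0, v, w)) 0 := by
    refine HasFDerivAt.comp_hasDerivAt (l := f) (0 : ℝ) ?_ hγ
    rw [hy0]
    exact (hf.differentiable (by simp) y).hasFDerivAt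
  have hrγ : HasDerivAt (fun r : ℝ => retr (f (y + r • ((0 : ℝ), v, w)))) u 0 := by
    refine HasFDerivAt.comp_hasDerivAt (l := retr) (0 : ℝ) ?_ hfγ
    rw [hy0, hfs]
    exact (contDiff_retr.differentiable (n := 1) (by simp) s).hasFDerivAt
  have hp : HasDerivAt (fun r : ℝ => (retr (f (y + r • ((0 : ℝ), v, w))),
      (y + r • ((0 : ℝ), v, w)).1)) (u, 0) 0 := by
    refine hrγ.prodMk ?_
    simpa using hasDerivAt_const (0 : ℝ) y.1
  have hp0 : (retr (f (y + (0 : ℝ) • ((0 : ℝ), v, w))), (y + (0 : ℝ) • ((0 : ℝ), v, w)).1)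
      = (s, t) := by rw [hy0, hfs, retr_eq hs]
  have hx : HasDerivAt (fun r : ℝ => (y + r • ((0 : ℝ), v, w)).2.1) v 0 :=
    ((ContinuousLinearMap.fst ℝ V V).comp
      (ContinuousLinearMap.snd ℝ ℝ (V × V))).hasFDerivAt.comp_hasDerivAt (0 : ℝ) hγ
  have hq : HasDerivAt (fun r : ℝ => (y + r • ((0 : ℝ), v, w)).2.2) w 0 :=
    ((ContinuousLinearMap.snd ℝ V V).comp
      (ContinuousLinearMap.snd ℝ ℝ (V × V))).hasFDerivAt.comp_hasDerivAt (0 : ℝ) hγ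
  have hall := ((hasDerivAt_comp_of_eq h.contDiff_speed hp hp0).sub
    ((hasDerivAt_comp_of_eq (contDiff_fderiv_apply h.smooth_Q (0, 1)) hp hp0).inner ℝ
      (hx.sub (hasDerivAt_comp_of_eq h.smooth_X hp hp0)))).add
    ((hasDerivAt_comp_of_eq (contDiff_fderiv_apply h.smooth_X (0, 1)) hp hp0).inner ℝ
      (hq.sub (hasDerivAt_comp_of_eq h.smooth_Q hp hp0)))
  refine (hL.unique hall).trans ?_
  rw [h.fderiv_speed hs ht hus]
  have hy1 : y.1 = t := rfl
  have hy2 : y.2.1 = X (s, t) := rfl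
  have hy3 : y.2.2 = Q (s, t) := rfl
  simp only [hy0, hfs, retr_eq hs, hy1, hy2, hy3, Pi.sub_apply, sub_self, inner_zero_right,
    add_zero, inner_sub_right]
  rw [real_inner_comm (fderiv ℝ X (s, t) (0, 1)) (fderiv ℝ Q (s, t) (u, 0))]
  ring

variable [FiniteDimensional ℝ V]

lemma exists_cutoff {E : Type*} [NormedAddCommGroup E] [NormedSpace ℝ E] [FiniteDimensional ℝ E]
    {K U : Set E} (hK : IsCompact K) (hU : IsOpen U) (hKU : K ⊆ U) :
    ∃ χ : E → ℝ, ContDiff ℝ 2 χ ∧ HasCompactSupport χ ∧ (∀ x ∈ K, ∀ᶠ y in 𝓝 x, χ y = 1) ∧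
      (∀ x, 0 ≤ χ x) ∧ ∀ x ∉ U, χ x = 0 := by
  obtain ⟨R, hR⟩ := hK.isBounded.subset_ball (0 : E)
  obtain ⟨χ, h1, h0, hI⟩ := exists_contMDiffMap_one_nhds_of_subset_interior (n := (2 : ℕ∞))
    (modelWithCornersSelf ℝ E) hK.isClosed
    (show K ⊆ interior (U ∩ ball 0 R) by
      rw [(hU.inter isOpen_ball).interior_eq]
      exact subset_inter hKU hR)
  refine ⟨χ, χ.contMDiff.contDiff, HasCompactSupport.intro (isCompact_closedBall 0 R) fun x hx =>
    h0 x fun h => hx (ball_subset_closedBall h.2), fun x hx => ?_, fun x => (hI x).1,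
    fun x hx => h0 x fun h => hx h.1⟩
  exact h1.filter_mono (nhds_le_nhdsSet hx)

theorem IsFront.exists_isHamFlow (h : IsFront ε X Q) (hε : 0 < ε) :
    ∃ (L C : ℝ) (H : ℝ → V → V → ℝ) (Hx Hξ : ℝ → V → V → V), IsHam L C H Hx Hξ ∧
      IsHamFlow C Hx Hξ (fun s t => X (s, t)) (fun s t => Q (s, t)) := by
  obtain ⟨f, hf, hfp⟩ := h.exists_param
  have hE := h.contDiff_extendSpeed hf
  obtain ⟨χ, hχ, hχc, hχ1, hχ0, hχU⟩ := exists_cutoff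
    (isCompact_domain.image h.continuous_trace) (isOpen_lt continuous_const hE.continuous)
    (by
      rintro _ ⟨⟨s, t⟩, ⟨hs, ht⟩, rfl⟩
      rw [mem_sphere_zero_iff_norm] at hs
      rw [mem_ofPred_eq, trace, extendSpeed_trace hs (hfp s t hs ht)]
      exact hε.trans_le (h.pos s t hs ht))
  have hev : ∀ s t, ‖s‖ = 1 → t ∈ Icc (0 : ℝ) 1 →
      (fun y => χ y * extendSpeed X Q f y) =ᶠ[𝓝 (t, X (s, t), Q (s, t))] extendSpeed X Q f :=
    fun s t hs ht => by
      filter_upwards [hχ1 _ (mem_image_of_mem (trace X Q) (x := (s, t)) ⟨by simpa using hs, ht⟩)]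
        with y hy
      rw [hy, one_mul]
  obtain ⟨L, C, H, Hx, Hξ, hH, hd⟩ := exists_isHam_of_contDiff (hχ.mul hE) hχc.mul_right
    (fun z => by
      by_cases hz : 0 < extendSpeed X Q f z
      · exact mul_nonneg (hχ0 z) hz.le
      · exact (by simp [hχU z hz] : χ z * extendSpeed X Q f z = 0).ge)
  refine ⟨L, C, H, Hx, Hξ, hH, h.X_zero, h.Q_zero, h.norm_Q, ?_, ?_⟩
  · intro s σ t hs h1 h2 ht
    have hX := hasDerivAt_slice (h.smooth_X.differentiable (by simp) (s, t))
    have hχs : χ (t, X (s, t), Q (s, t)) = 1 :=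
      (hχ1 _ (mem_image_of_mem (trace X Q) (x := (s, t)) ⟨by simpa using hs, ht⟩)).self_of_nhds
    refine (hX.congr_deriv (ext_inner_right ℝ fun w => ?_)).hasDerivWithinAt
    rw [(hd t (X (s, t)) (Q (s, t)) σ (h.norm_Q s t hs ht) h1 h2).2, (hev s t hs ht).fderiv_eq,
      hχs, one_mul, h.fderiv_extendSpeed hf hs ht (hfp s t hs ht),
      extendSpeed_trace hs (hfp s t hs ht), speed, inner_zero_right, inner_sub_right,
      real_inner_smul_right, real_inner_comm (fderiv ℝ X (s, t) (0, 1)) (Q (s, t))]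
    ring
  · intro s σ t hs h1 h2 ht
    have hQ := (hasDerivAt_slice (h.smooth_Q.differentiable (by simp) (s, t))).const_smul σ
    refine (hQ.congr_deriv (ext_inner_right ℝ fun w => ?_)).hasDerivWithinAt
    rw [(hd t (X (s, t)) (Q (s, t)) σ (h.norm_Q s t hs ht) h1 h2).1, inner_neg_left,
      real_inner_smul_left, real_inner_smul_left, inner_reprSnd, (hev s t hs ht).fderiv_eq,
      h.fderiv_extendSpeed hf hs ht (hfp s t hs ht), inner_zero_right]
    ring

end FrontHamiltonian

section Shift

open Filter Topology
open scoped ContDiff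

variable {V : Type*} [NormedAddCommGroup V] [InnerProductSpace ℝ V]
  {ε : ℝ} {X Q : V × ℝ → V}

lemma eq_zero_of_hasFDerivAt_of_eqOn_sphere {f : V → ℝ} {f' : V →L[ℝ] ℝ} {s v : V} (hs : ‖s‖ = 1)
    (hv : ⟪v, s⟫ = 0) (hf : HasFDerivAt f f' s) (h0 : ∀ x, ‖x‖ = 1 → f x = 0) : f' v = 0 := by
  have h1 : HasDerivAt (fun r : ℝ => (1 : ℝ) • s + r • v) v 0 := by
    simpa using ((hasDerivAt_id (0 : ℝ)).smul_const v).const_add s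
  have h2 := hasDerivAt_norm_line hs one_pos v
  rw [real_inner_comm, hv] at h2
  have hn : ‖(1 : ℝ) • s + (0 : ℝ) • v‖ = 1 := by simpa using hs
  have h3 := (h2.inv (by rw [hn]; exact one_ne_zero)).smul h1
  have h4 := HasFDerivAt.comp_hasDerivAt (l := f) (l' := f') (0 : ℝ) (by simpa [hs] using hf) h3
  have h5 : ∀ᶠ r : ℝ in 𝓝 0, f (((fun r : ℝ => ‖(1 : ℝ) • s + r • v‖)⁻¹ •
      fun r : ℝ => (1 : ℝ) • s + r • v) r) = 0 := by
    filter_upwards [h2.continuousAt.eventually_ne (by rw [hn]; exact one_ne_zero)] with r hr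
    refine h0 _ ?_
    simp only [Pi.smul_apply', Pi.inv_apply, norm_smul, norm_inv, norm_norm]
    exact inv_mul_cancel₀ hr
  have h6 := h4.unique ((hasDerivAt_const (0 : ℝ) (0 : ℝ)).congr_of_eventuallyEq h5)
  simpa [hs] using h6

lemma IsFront.inner_fderiv_Q_fst (h : IsFront ε X Q) {s v : V} {t : ℝ} (hs : ‖s‖ = 1)
    (ht : t ∈ Icc (0 : ℝ) 1) (hv : ⟪v, s⟫ = 0) : ⟪Q (s, t), fderiv ℝ Q (s, t) (v, 0)⟫ = 0 := by
  have hQ := (h.smooth_Q.differentiable (by simp) (s, t)).hasFDerivAt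
  have h1 := HasFDerivAt.comp (f := fun s : V => (s, t)) s (hQ.norm_sq.sub_const 1)
    (hasFDerivAt_prodMk_left s t)
  have h2 := eq_zero_of_hasFDerivAt_of_eqOn_sphere hs hv h1
    (fun x hx => by simp [h.norm_Q x t hx ht])
  simpa using h2

lemma IsFront.inner_fderiv_Q_snd (h : IsFront ε X Q) {s : V} {t : ℝ} (hs : ‖s‖ = 1)
    (ht : t ∈ Icc (0 : ℝ) 1) : ⟪Q (s, t), fderiv ℝ Q (s, t) (0, 1)⟫ = 0 := by
  have h1 := (hasDerivAt_slice (h.smooth_Q.differentiable (by simp) (s, t))).norm_sq.sub_const 1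
  have h2 := eq_zero_of_hasDerivAt_of_eqOn_Icc ht h1
    (fun τ hτ => by simp [h.norm_Q s τ hs hτ])
  simpa using h2

lemma IsFront.fderiv_shift (h : IsFront ε X Q) (δ : ℝ) (z w : V × ℝ) :
    fderiv ℝ (fun z => X z + (δ * z.2) • Q z) z w
      = fderiv ℝ X z w + ((δ * z.2) • fderiv ℝ Q z w + (δ * w.2) • Q z) := by
  have h1 : HasFDerivAt (fun z : V × ℝ => δ * z.2) (δ • ContinuousLinearMap.snd ℝ V ℝ) z :=
    hasFDerivAt_snd.const_mul δ
  have h2 : HasFDerivAt (fun z => X z + (δ * z.2) • Q z) _ z :=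
    (h.smooth_X.differentiable (by simp) z).hasFDerivAt.add
      (h1.smul (h.smooth_Q.differentiable (by simp) z).hasFDerivAt)
  rw [h2.fderiv]
  simp

lemma IsFront.shift (h : IsFront 0 X Q) (δ : ℝ) :
    IsFront δ (fun z => X z + (δ * z.2) • Q z) Q where
  smooth_X := h.smooth_X.add ((contDiff_const.mul contDiff_snd).smul h.smooth_Q)
  smooth_Q := h.smooth_Q
  norm_Q := h.norm_Q
  leg s t v hs ht hv := by
    rw [h.fderiv_shift, inner_add_right, inner_add_right, h.leg s t v hs ht hv,
      real_inner_smul_right, h.inner_fderiv_Q_fst hs ht hv]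
    simp
  inj s s' t hs hs' ht hX hQ := h.inj s s' t hs hs' ht (by simpa [hQ] using hX) hQ
  imm s t v hs ht hv hX hQ := h.imm s t v hs ht hv (by simpa [h.fderiv_shift, hQ] using hX) hQ
  pos s t hs ht := by
    rw [h.fderiv_shift, inner_add_right, inner_add_right, real_inner_smul_right,
      h.inner_fderiv_Q_snd hs ht, real_inner_smul_right, real_inner_self_eq_norm_sq,
      h.norm_Q s t hs ht]
    linarith [h.pos s t hs ht]
  X_zero s hs := by simp [h.X_zero s hs]
  Q_zero := h.Q_zero
  X_one s hs := by simp [h.X_one s hs]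

variable [FiniteDimensional ℝ V]

/-- A non-negative front meets every graph dominated by the zero function and touching it. -/
theorem IsFront.exists_mem_graph (h : IsFront 0 X Q) {LG : ℝ} {G : V → ℝ} {g : V → V}
    (hG : IsTameOnSphere LG G g) (hG0 : ∀ v, ‖v‖ = 1 → G v ≤ 0) {q₀ : V} (hq₀ : ‖q₀‖ = 1)
    (hGq₀ : G q₀ = 0) {T : ℝ} (hT : T ∈ Icc (0 : ℝ) 1) :
    ∃ s, ‖s‖ = 1 ∧
      X (s, T) = g (Q (s, T)) + (G (Q (s, T)) - ⟪g (Q (s, T)), Q (s, T)⟫) • Q (s, T) := by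
  set J : V → ℝ := fun s =>
    ‖X (s, T) - g (Q (s, T)) - ⟪X (s, T) - g (Q (s, T)), Q (s, T)⟫ • Q (s, T)‖
      + |⟪X (s, T), Q (s, T)⟫ - G (Q (s, T))| with hJ
  have hJ0 : ∀ s, 0 ≤ J s := fun s => by positivity
  have hJc : Continuous J := by
    have := h.smooth_X.continuous
    have := h.smooth_Q.continuous
    have := hG.cont
    have := hG.cont_g
    fun_prop
  have hJε : ∀ ε, 0 < ε → ∃ s, ‖s‖ = 1 ∧ J s ≤ ε := fun ε hε => by
    have hf := h.shift ε
    obtain ⟨L, C, H, Hx, Hξ, hH, hfl⟩ := hf.exists_isHamFlow hε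
    obtain ⟨s, hs, h1, h2, h3⟩ := hfl.exists_front hH hf.smooth_X.continuous hf.smooth_Q.continuous
      hG hG0 hq₀ hGq₀ hε.le hf.X_one hT
    refine ⟨s, hs, ?_⟩
    have hn := h.norm_Q s T hs hT
    have hqq : ⟪Q (s, T), Q (s, T)⟫ = 1 := by rw [real_inner_self_eq_norm_sq, hn, one_pow]
    simp only [inner_sub_left, inner_add_left, real_inner_smul_left, hqq, mul_one] at h1 h2 h3
    have h4 : X (s, T) - g (Q (s, T)) - ⟪X (s, T) - g (Q (s, T)), Q (s, T)⟫ • Q (s, T) = 0 := by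
      rw [← h1, inner_sub_left]
      module
    simp only [hJ]
    rw [h4, norm_zero, zero_add, abs_le]
    have := mul_le_mul_of_nonneg_left hT.2 hε.le
    have := mul_nonneg hε.le hT.1
    constructor <;> linarith
  obtain ⟨s, hs, hmin⟩ := (isCompact_sphere (0 : V) 1).exists_isMinOn
    ⟨q₀, by simpa using hq₀⟩ hJc.continuousOn
  rw [mem_sphere_zero_iff_norm] at hs
  have hJs : J s = 0 := le_antisymm (le_of_forall_pos_le_add fun ε hε => by
    obtain ⟨s', hs', h1⟩ := hJε ε hε
    rw [zero_add]
    exact (hmin (by simpa using hs')).trans h1) (hJ0 s)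
  obtain ⟨h1, h2⟩ := (add_eq_zero_iff_of_nonneg (norm_nonneg _) (abs_nonneg _)).1 hJs
  rw [norm_eq_zero, inner_sub_left] at h1
  rw [abs_eq_zero, sub_eq_zero] at h2
  rw [h2] at h1
  exact ⟨s, hs, by rw [← sub_eq_zero, ← h1]; module⟩

end Shift

section Conclusion

open Filter Topology
open scoped ContDiff

variable {V : Type*} [NormedAddCommGroup V] [InnerProductSpace ℝ V] [FiniteDimensional ℝ V]
  {X Q : V × ℝ → V}

lemma exists_isTameOnSphere {K : V → ℝ} (hK : ContDiff ℝ 2 K) (hc : HasCompactSupport K) (a : V)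
    (δ : ℝ) : ∃ L, IsTameOnSphere L (fun v => K v + (⟪a, v⟫ - δ)) (fun v => gradient K v + a) := by
  obtain ⟨L, hL, hL0, hL1, hlip⟩ := exists_bounds_of_hasCompactSupport hK hc
  have hg : Continuous (gradient K) := (InnerProductSpace.toDual ℝ V).symm.continuous.comp
    (hK.continuous_fderiv (by simp))
  have hn : ∀ v, ‖gradient K v‖ = ‖fderiv ℝ K v‖ := fun v => LinearIsometryEquiv.norm_map _ _
  have hKc := hK.continuous
  refine ⟨L + (‖a‖ + |δ|), by fun_prop, by fun_prop, fun v hv => ?_, fun v hv => ?_,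
    fun v v' hv hv' => ?_⟩
  · have h1 := abs_real_inner_le_norm a v
    rw [hv, mul_one] at h1
    exact (abs_add_le _ _).trans (add_le_add (hL0 v) ((abs_sub _ _).trans (by linarith)))
  · refine (norm_add_le _ _).trans ?_
    rw [hn]
    linarith [hL1 v, abs_nonneg δ]
  · have h1 := (abs_le.1 (abs_sub_sub_fderiv_le (hK.differentiable (by simp)) hL hlip v v')).1
    have h2 : ⟪gradient K v, v' - v⟫ = fderiv ℝ K v (v' - v) := by simp [gradient]
    rw [inner_add_left, h2, inner_sub_right a]
    have : 0 ≤ (‖a‖ + |δ|) * ‖v' - v‖ ^ 2 := by positivity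
    nlinarith

lemma exists_notMem_image_sphere {φ : V → V} (hφ : Differentiable ℝ φ) {r : ℝ} (hr : 0 < r) :
    ∃ a, ‖a‖ < r ∧ ∀ s, ‖s‖ = 1 → φ s ≠ a := by
  let _ : MeasurableSpace V := borel V
  have : BorelSpace V := ⟨rfl⟩
  have h1 := MeasureTheory.addHaar_image_eq_zero_of_differentiableOn_of_addHaar_eq_zero
    (MeasureTheory.volume : MeasureTheory.Measure V) (hφ.differentiableOn (s := sphere 0 1))
    (MeasureTheory.Measure.addHaar_sphere_of_ne_zero _ _ one_ne_zero)
  have h2 := measure_ball_pos (MeasureTheory.volume : MeasureTheory.Measure V) 0 hr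
  have h3 : ¬ ball (0 : V) r ⊆ φ '' sphere 0 1 := fun h =>
    h2.ne' (MeasureTheory.measure_mono_null h h1)
  obtain ⟨a, ha, hna⟩ := not_subset.1 h3
  exact ⟨a, by simpa using ha, fun s hs he => hna ⟨s, by simpa using hs, he⟩⟩

theorem IsFront.exists_eq_zero (h : IsFront 0 X Q) {q₀ : V} (hq₀ : ‖q₀‖ = 1) {T : ℝ}
    (hT : T ∈ Icc (0 : ℝ) 1) : ∃ s, ‖s‖ = 1 ∧ X (s, T) = 0 ∧ Q (s, T) = q₀ := by
  by_contra! hno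
  have hXc := h.smooth_X.continuous
  have hQc := h.smooth_Q.continuous
  obtain ⟨s₀, hs₀, hmin⟩ := (isCompact_sphere (0 : V) 1).exists_isMinOn
    ⟨q₀, by simpa using hq₀⟩
    (show Continuous fun s => ‖X (s, T)‖ + ‖Q (s, T) - q₀‖ by fun_prop).continuousOn
  set r := ‖X (s₀, T)‖ + ‖Q (s₀, T) - q₀‖ with hr
  have hr0 : 0 < r := by
    refine lt_of_le_of_ne (by positivity) fun h0 => ?_
    obtain ⟨h1, h2⟩ := (add_eq_zero_iff_of_nonneg (norm_nonneg _) (norm_nonneg _)).1 h0.symm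
    exact hno s₀ (by simpa using hs₀) (norm_eq_zero.1 h1) (sub_eq_zero.1 (norm_eq_zero.1 h2))
  have hle : ∀ s, ‖s‖ = 1 → r ≤ ‖X (s, T)‖ + ‖Q (s, T) - q₀‖ := fun s hs =>
    hmin (by simpa using hs)
  let ρ : ContDiffBump q₀ := ⟨r / 4, r / 2, by positivity, by linarith⟩
  have hρ : ContDiff ℝ 2 ρ := ρ.contDiff
  obtain ⟨M, hM0, -, hM, -⟩ := exists_bounds_of_hasCompactSupport hρ ρ.hasCompactSupport
  set δ := r / (8 * (M + 2)) with hδ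
  have hδ0 : 0 < δ := by positivity
  have hδr : δ * (8 * (M + 2)) = r := by rw [hδ]; field_simp
  obtain ⟨a, ha, hna⟩ := exists_notMem_image_sphere (φ := fun s => X (s, T) + δ • Q (s, T))
    (((h.smooth_X.comp (contDiff_id.prodMk contDiff_const)).add
      (contDiff_const.smul (h.smooth_Q.comp (contDiff_id.prodMk contDiff_const)))).differentiable
        (by simp)) hδ0
  set K : V → ℝ := fun v => ρ v * (δ - ⟪a, v⟫) with hK
  have hKs : ContDiff ℝ 2 K := hρ.mul (contDiff_const.sub (contDiff_const.inner ℝ contDiff_id))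
  obtain ⟨L, hL⟩ := exists_isTameOnSphere hKs ρ.hasCompactSupport.mul_right a δ
  have hav : ∀ v, ‖v‖ = 1 → |⟪a, v⟫| < δ := fun v hv => by
    refine (abs_real_inner_le_norm a v).trans_lt ?_
    rwa [hv, mul_one]
  have hKd : ∀ v w, ⟪gradient K v, w⟫ = fderiv ℝ ρ v w * (δ - ⟪a, v⟫) - ρ v * ⟪a, w⟫ := by
    intro v w
    have h1 : HasFDerivAt (fun v => δ - ⟪a, v⟫) (-innerSL ℝ a) v :=
      (innerSL ℝ a).hasFDerivAt.const_sub δ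
    have h2 : HasFDerivAt K _ v := (hρ.differentiable (by simp) v).hasFDerivAt.mul h1
    rw [gradient, InnerProductSpace.toDual_symm_apply, h2.fderiv]
    simp
    ring
  obtain ⟨s, hs, he⟩ := h.exists_mem_graph hL (fun v hv => by
    have h1 := ρ.le_one (x := v)
    have h2 := (abs_lt.1 (hav v hv)).2
    simp only [hK]
    nlinarith) hq₀
      (by simp [hK, ρ.one_of_mem_closedBall (x := q₀) (mem_closedBall_self ρ.rIn_pos.le)]) hT
  set q := Q (s, T) with hq
  have hqn : ‖q‖ = 1 := h.norm_Q s T hs hT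
  have haq := abs_lt.1 (hav q hqn)
  by_cases hfar : r / 2 ≤ ‖q - q₀‖
  · have hρ0 : ρ q = 0 := ρ.zero_of_le_dist (by rwa [dist_eq_norm])
    have hdρ : fderiv ℝ ρ q = 0 := IsLocalMin.fderiv_eq_zero
      (Eventually.of_forall fun x => by rw [hρ0]; exact ρ.nonneg)
    have hg : gradient K q = 0 := ext_inner_right ℝ fun w => by rw [hKd, hρ0, hdρ]; simp
    refine hna s hs ?_
    have hKq : K q = 0 := by simp [hK, hρ0]
    simp only [← hq, he, hg, hKq, zero_add]
    module
  · rw [not_le] at hfar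
    have h1 := hle s hs
    have hρ1 := ρ.le_one (x := q)
    have hρ0 := ρ.nonneg (x := q)
    set g := gradient K q + a with hg
    have hgn : ‖g‖ ≤ (2 * M + 1) * δ := by
      by_contra! hlt
      have hpos : 0 < ‖g‖ := lt_of_le_of_lt (by positivity) hlt
      have h2 : ‖g‖ ^ 2 = fderiv ℝ ρ q g * (δ - ⟪a, q⟫) + (1 - ρ q) * ⟪a, g⟫ := by
        rw [← real_inner_self_eq_norm_sq]
        nth_rw 1 [hg]
        rw [inner_add_left, hKd]
        ring
      have h3 : fderiv ℝ ρ q g * (δ - ⟪a, q⟫) ≤ M * ‖g‖ * (2 * δ) :=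
        mul_le_mul ((le_abs_self _).trans ((fderiv ℝ ρ q).le_of_opNorm_le (hM q) g)) (by linarith)
          (by linarith) (by positivity)
      have h4 : (1 - ρ q) * ⟪a, g⟫ ≤ 1 * (δ * ‖g‖) :=
        (mul_le_mul_of_nonneg_left ((real_inner_le_norm a g).trans
          (mul_le_mul_of_nonneg_right ha.le hpos.le)) (by linarith)).trans
          (mul_le_mul_of_nonneg_right (by linarith) (by positivity))
      nlinarith
    have hGn : |K q + (⟪a, q⟫ - δ)| ≤ 2 * δ := by
      simp only [hK]
      rw [abs_le]
      constructor <;> nlinarith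
    have hgq : |⟪g, q⟫| ≤ ‖g‖ := by
      have := abs_real_inner_le_norm g q
      rwa [hqn, mul_one] at this
    have h2 : ‖X (s, T)‖ ≤ ‖g‖ + (2 * δ + ‖g‖) := by
      rw [he]
      refine (norm_add_le _ _).trans ?_
      rw [norm_smul, hqn, mul_one, Real.norm_eq_abs]
      have := abs_sub (K q + (⟪a, q⟫ - δ)) ⟪g, q⟫
      linarith
    nlinarith

/-- A non-negative front which issues from the origin and returns to it stays there. -/
theorem IsFront.eq_zero (h : IsFront 0 X Q) (hV : 1 < Module.rank ℝ V) {T : ℝ}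
    (hT : T ∈ Icc (0 : ℝ) 1) {s : V} (hs : ‖s‖ = 1) : X (s, T) = 0 := by
  obtain ⟨f, hf, hfp⟩ := h.exists_param
  set n : V → V := fun x => ‖x‖⁻¹ • x with hn
  have hn1 : ∀ {x}, x ≠ 0 → ‖n x‖ = 1 := fun hx => by
    rw [hn, norm_smul, norm_inv, norm_norm, inv_mul_cancel₀ (norm_ne_zero_iff.2 hx)]
  have hns : ∀ {x}, ‖x‖ = 1 → n x = x := fun hx => by rw [hn]; simp [hx]
  have hnc : ∀ {x}, x ≠ 0 → ContDiffAt ℝ 1 n x := fun {x} hx =>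
    ((contDiffAt_id.norm ℝ hx).inv (norm_ne_zero_iff.2 hx)).smul contDiffAt_id
  have h0 : ∀ {x : V}, ‖x‖ = 1 → x ≠ 0 := fun hx h => by simp [h] at hx
  have hj : ∀ q, ‖q‖ = 1 → ‖f (T, 0, q)‖ = 1 ∧ X (f (T, 0, q), T) = 0 ∧ Q (f (T, 0, q), T) = q := by
    intro q hq
    obtain ⟨s, hs, h1, h2⟩ := h.exists_eq_zero hq hT
    have h3 := hfp s T hs hT
    rw [h1, h2] at h3
    rw [h3]
    exact ⟨hs, h1, h2⟩
  set j : V → V := fun x => ‖x‖ • f (T, 0, n x) with hjdef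
  set R : V → V := fun x => ‖x‖ • Q (n x, T) with hR
  have hnj : ∀ {x}, x ≠ 0 → ‖j x‖ = ‖x‖ ∧ n (j x) = f (T, 0, n x) := fun {x} hx => by
    have h1 : ‖j x‖ = ‖x‖ := by rw [hjdef, norm_smul, norm_norm, (hj _ (hn1 hx)).1, mul_one]
    refine ⟨h1, ?_⟩
    rw [hn]
    simp only [h1]
    rw [hjdef]
    simp only [smul_smul]
    rw [inv_mul_cancel₀ (norm_ne_zero_iff.2 hx), one_smul]
  have hRj : ∀ {x}, x ≠ 0 → R (j x) = x := fun {x} hx => by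
    simp only [hR]
    rw [(hnj hx).1, (hnj hx).2, (hj _ (hn1 hx)).2.2, hn, smul_smul,
      mul_inv_cancel₀ (norm_ne_zero_iff.2 hx), one_smul]
  have hjs : ∀ {q}, q ≠ 0 → ContDiffAt ℝ 1 j q := fun {q} hq =>
    (contDiffAt_id.norm ℝ hq).smul (ContDiffAt.comp q (hf.of_le (by norm_num)).contDiffAt
      (contDiffAt_const.prodMk (contDiffAt_const.prodMk (hnc hq))))
  have hRs : ∀ {q}, q ≠ 0 → DifferentiableAt ℝ R q := fun {q} hq =>
    ((contDiffAt_id.norm ℝ hq).smul (ContDiffAt.comp q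
      (h.smooth_Q.of_le (WithTop.coe_le_coe.2 le_top)).contDiffAt
      ((hnc hq).prodMk contDiffAt_const))).differentiableAt (by simp)
  have hmap : ∀ {q}, ‖q‖ = 1 → map j (𝓝 q) = 𝓝 (j q) := by
    intro q hq
    have hq0 := h0 hq
    have hjq : j q ≠ 0 := norm_ne_zero_iff.1 (by rw [(hnj hq0).1, hq]; exact one_ne_zero)
    have h1 := (hjs hq0).hasStrictFDerivAt (by simp)
    have h2 := (hRs hjq).hasFDerivAt.comp q h1.hasFDerivAt
    have h3 := h2.unique ((hasFDerivAt_id q).congr_of_eventuallyEq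
      ((eventually_ne_nhds hq0).mono fun x hx => hRj hx))
    have h4 : Function.Injective (fderiv ℝ j q) := fun v w hvw => by
      have h5 := DFunLike.congr_fun h3 v
      have h6 := DFunLike.congr_fun h3 w
      simp only [ContinuousLinearMap.comp_apply, ContinuousLinearMap.id_apply] at h5 h6
      rw [← h5, ← h6, hvw]
    let e := (LinearEquiv.ofInjectiveEndo (fderiv ℝ j q : V →ₗ[ℝ] V) h4).toContinuousLinearEquiv
    exact HasStrictFDerivAt.map_nhds_eq_of_equiv (f' := e) h1
  set U : Set V := {x | ∀ᶠ y in 𝓝 x, X (n y, T) = 0} with hU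
  have hUo : IsOpen U := isOpen_setOfPred_eventually_nhds
  set W : Set V := {x | x ≠ 0 ∧ X (n x, T) ≠ 0} with hW
  have hXn : ∀ {x}, x ≠ 0 → ContinuousAt (fun x => X (n x, T)) x := fun hx =>
    h.smooth_X.continuous.continuousAt.comp ((hnc hx).continuousAt.prodMk continuousAt_const)
  have hWo : IsOpen W := isOpen_iff_mem_nhds.2 fun x hx =>
    (eventually_ne_nhds hx.1).and ((hXn hx.1).eventually_ne hx.2)
  have hSU : ∀ {x}, ‖x‖ = 1 → X (x, T) = 0 → x ∈ U := by
    intro x hx hX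
    have hq := h.norm_Q x T hx hT
    have hxq : f (T, 0, Q (x, T)) = x := by
      have := hfp x T hx hT
      rwa [hX] at this
    have hjx : j (Q (x, T)) = x := by
      simp only [hjdef]
      rw [hns hq, hq, one_smul, hxq]
    have := hmap hq
    rw [hjx] at this
    show ∀ᶠ y in 𝓝 x, X (n y, T) = 0
    rw [← this, eventually_map]
    filter_upwards [eventually_ne_nhds (h0 hq)] with y hy
    rw [(hnj hy).2]
    exact (hj _ (hn1 hy)).2.1
  by_contra hne
  obtain ⟨x, -, hxU, hx0, hxW⟩ := (isConnected_sphere hV (0 : V) zero_le_one).isPreconnected U W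
    hUo hWo (fun x hx => by
      rw [mem_sphere_zero_iff_norm] at hx
      by_cases hX : X (x, T) = 0
      · exact Or.inl (hSU hx hX)
      · exact Or.inr ⟨h0 hx, by rwa [hns hx]⟩)
    ⟨f (T, 0, s), by simpa using (hj s hs).1, hSU (hj s hs).1 (hj s hs).2.1⟩
    ⟨s, by simpa using hs, h0 hs, by rwa [hns hs]⟩
  exact hxW hxU.self_of_nhds

end Conclusion

section JetSpace

open scoped ContDiff

variable {m : ℕ} {F : EuclideanSpace ℝ (Fin m) × ℝ → JetSp m}

lemma mem_sph {s : EuclideanSpace ℝ (Fin m)} : s ∈ sph m ↔ ‖s‖ = 1 :=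
  mem_sphere_zero_iff_norm

/-- The point `u q + p` of the hyperplane `{x | ⟪x, q⟫ = u}` corresponding to `(q, p, u)` under the
contactomorphism between `J¹(S^{m-1})` and the cooriented contact elements of `ℝ^m`. -/
def front (F : EuclideanSpace ℝ (Fin m) × ℝ → JetSp m) (z : EuclideanSpace ℝ (Fin m) × ℝ) :
    EuclideanSpace ℝ (Fin m) :=
  (F z).2.2 • (F z).1 + (F z).2.1

lemma fderiv_fst_apply (hF : Differentiable ℝ F) (z w : EuclideanSpace ℝ (Fin m) × ℝ) :
    fderiv ℝ (fun z => (F z).1) z w = (fderiv ℝ F z w).1 := by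
  rw [(hF z).hasFDerivAt.fst.fderiv]
  rfl

lemma fderiv_front (hF : Differentiable ℝ F) (z w : EuclideanSpace ℝ (Fin m) × ℝ) :
    fderiv ℝ (front F) z w = (F z).2.2 • (fderiv ℝ F z w).1 + (fderiv ℝ F z w).2.2 • (F z).1
      + (fderiv ℝ F z w).2.1 := by
  have h := (hF z).hasFDerivAt
  have h1 : HasFDerivAt (front F) _ z := (h.snd.snd.smul h.fst).add h.snd.fst
  rw [h1.fderiv]
  rfl

lemma inner_front {z : EuclideanSpace ℝ (Fin m) × ℝ} (hq : ‖(F z).1‖ = 1)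
    (hp : ⟪(F z).2.1, (F z).1⟫ = 0) : ⟪front F z, (F z).1⟫ = (F z).2.2 := by
  rw [front, inner_add_left, real_inner_smul_left, hp, real_inner_self_eq_norm_sq, hq]
  norm_num

lemma eq_of_front_eq_zero {z : EuclideanSpace ℝ (Fin m) × ℝ} (hq : ‖(F z).1‖ = 1)
    (hp : ⟪(F z).2.1, (F z).1⟫ = 0) (h : front F z = 0) : F z = ((F z).1, 0, 0) := by
  have hu := inner_front hq hp
  rw [h, inner_zero_left] at hu
  rw [front, ← hu, zero_smul, zero_add] at h
  exact Prod.ext rfl (Prod.ext h hu.symm)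

lemma fderiv_slice (hF : Differentiable ℝ F) (s v : EuclideanSpace ℝ (Fin m)) (t : ℝ) :
    fderiv ℝ (fun s' => F (s', t)) s v = fderiv ℝ F (s, t) (v, 0) := by
  have h : HasFDerivAt (fun s' => F (s', t)) _ s :=
    HasFDerivAt.comp (f := fun s' => (s', t)) s (hF (s, t)).hasFDerivAt
      (hasFDerivAt_prodMk_left s t)
  rw [h.fderiv]
  rfl

end JetSpace

end LegendrianIsotopy

namespace IsLegIsotopyJet

open LegendrianIsotopy
open scoped ContDiff

variable {m : ℕ} {F : EuclideanSpace ℝ (Fin m) × ℝ → JetSp m}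

lemma norm_fst (hF : IsLegIsotopyJet m F) {s : EuclideanSpace ℝ (Fin m)} {t : ℝ} (hs : ‖s‖ = 1)
    (ht : t ∈ Icc (0 : ℝ) 1) : ‖(F (s, t)).1‖ = 1 :=
  mem_sph.1 (hF.mem_sphere s (mem_sph.2 hs) t ht)

lemma inner_fderiv_slice (hF : IsLegIsotopyJet m F) {s v : EuclideanSpace ℝ (Fin m)} {t : ℝ}
    (hs : ‖s‖ = 1) (ht : t ∈ Icc (0 : ℝ) 1) (hv : ⟪v, s⟫ = 0) :
    ⟪(F (s, t)).1, (fderiv ℝ F (s, t) (v, 0)).1⟫ = 0 ∧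
      ⟪(F (s, t)).2.1, (fderiv ℝ F (s, t) (v, 0)).1⟫
        + ⟪(fderiv ℝ F (s, t) (v, 0)).2.1, (F (s, t)).1⟫ = 0 := by
  have hd : Differentiable ℝ F := hF.smooth.differentiable (by simp)
  have h : HasFDerivAt (fun s' => F (s', t)) _ s :=
    HasFDerivAt.comp (f := fun s' => (s', t)) s (hd (s, t)).hasFDerivAt
      (hasFDerivAt_prodMk_left s t)
  have h1 := eq_zero_of_hasFDerivAt_of_eqOn_sphere hs hv (h.fst.norm_sq.sub_const 1)
    (fun x hx => by simp [hF.norm_fst hx ht])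
  have h2 := eq_zero_of_hasFDerivAt_of_eqOn_sphere hs hv (h.snd.fst.inner ℝ h.fst)
    (fun x hx => hF.mem_jet x (mem_sph.2 hx) t ht)
  exact ⟨by simpa using h1, by simpa [fderivInnerCLM_apply] using h2⟩

lemma inner_deriv (hF : IsLegIsotopyJet m F) {s : EuclideanSpace ℝ (Fin m)} {t : ℝ}
    (hs : ‖s‖ = 1) (ht : t ∈ Icc (0 : ℝ) 1) :
    ⟪(F (s, t)).1, (fderiv ℝ F (s, t) (0, 1)).1⟫ = 0 ∧
      ⟪(F (s, t)).2.1, (fderiv ℝ F (s, t) (0, 1)).1⟫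
        + ⟪(fderiv ℝ F (s, t) (0, 1)).2.1, (F (s, t)).1⟫ = 0 := by
  have h := hasDerivAt_slice (hF.smooth.differentiable (by simp) (s, t))
  have hq := hasFDerivAt_fst.comp_hasDerivAt t h
  have hp := hasFDerivAt_fst.comp_hasDerivAt t (hasFDerivAt_snd.comp_hasDerivAt t h)
  have h1 := eq_zero_of_hasDerivAt_of_eqOn_Icc ht (hq.norm_sq.sub_const 1)
    (fun τ hτ => by simp [hF.norm_fst hs hτ])
  have h2 := eq_zero_of_hasDerivAt_of_eqOn_Icc ht (hp.inner ℝ hq)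
    (fun τ hτ => hF.mem_jet s (mem_sph.2 hs) τ hτ)
  exact ⟨by simpa using h1, h2⟩

lemma inner_fst_fderiv_front (hF : IsLegIsotopyJet m F) {s : EuclideanSpace ℝ (Fin m)} {t : ℝ}
    {w : EuclideanSpace ℝ (Fin m) × ℝ} (hs : ‖s‖ = 1) (ht : t ∈ Icc (0 : ℝ) 1)
    (hw : ⟪(F (s, t)).1, (fderiv ℝ F (s, t) w).1⟫ = 0 ∧ ⟪(F (s, t)).2.1, (fderiv ℝ F (s, t) w).1⟫
      + ⟪(fderiv ℝ F (s, t) w).2.1, (F (s, t)).1⟫ = 0) :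
    ⟪(F (s, t)).1, fderiv ℝ (front F) (s, t) w⟫
      = (fderiv ℝ F (s, t) w).2.2 - ⟪(F (s, t)).2.1, (fderiv ℝ F (s, t) w).1⟫ := by
  rw [fderiv_front (hF.smooth.differentiable (by simp)), inner_add_right, inner_add_right,
    real_inner_smul_right, real_inner_smul_right, hw.1, real_inner_self_eq_norm_sq,
    hF.norm_fst hs ht, real_inner_comm]
  linarith [hw.2]

/-- A non-negative Legendrian loop based at the zero section yields a front which issues from the
origin and returns to it. -/
theorem isFront (hF : IsLegIsotopyJet m F) (hnn : NonnegJet m F)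
    (hF0 : ∀ s ∈ sph m, F (s, 0) = (s, 0, 0)) (hF1 : jetSlice m F 1 = zeroSection m) :
    IsFront 0 (front F) (fun z => (F z).1) where
  smooth_X := (hF.smooth.snd.snd.smul hF.smooth.fst).add hF.smooth.snd.fst
  smooth_Q := hF.smooth.fst
  norm_Q s t hs ht := hF.norm_fst hs ht
  leg s t v hs ht hv := by
    have h := hF.leg t ht s (mem_sph.2 hs) v hv
    rw [fderiv_slice (hF.smooth.differentiable (by simp))] at h
    rw [hF.inner_fst_fderiv_front hs ht (hF.inner_fderiv_slice hs ht hv), h, sub_self]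
  inj s s' t hs hs' ht hX hQ := by
    refine hF.inj t ht (mem_sph.2 hs) (mem_sph.2 hs') ?_
    have h1 := inner_front (hF.norm_fst hs ht) (hF.mem_jet s (mem_sph.2 hs) t ht)
    have h2 := inner_front (hF.norm_fst hs' ht) (hF.mem_jet s' (mem_sph.2 hs') t ht)
    have hu : (F (s, t)).2.2 = (F (s', t)).2.2 := by rw [← h1, ← h2, hX, hQ]
    refine Prod.ext hQ (Prod.ext ?_ hu)
    simp only [front] at hX
    rw [hu, hQ] at hX
    exact add_left_cancel hX
  imm s t v hs ht hv hX hQ := by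
    by_contra hne
    have hd : Differentiable ℝ F := hF.smooth.differentiable (by simp)
    refine hF.imm t ht s (mem_sph.2 hs) v hv hne ?_
    have hl := hF.leg t ht s (mem_sph.2 hs) v hv
    rw [fderiv_slice hd] at hl ⊢
    rw [fderiv_fst_apply hd] at hQ
    rw [hQ, inner_zero_right] at hl
    rw [fderiv_front hd, hQ, hl, smul_zero, zero_smul, zero_add, zero_add] at hX
    exact Prod.ext hQ (Prod.ext hX hl)
  pos s t hs ht := by
    have h := hasDerivAt_slice (hF.smooth.differentiable (by simp) (s, t))
    have hq : HasDerivAt (fun τ => (F (s, τ)).1) _ t := hasFDerivAt_fst.comp_hasDerivAt t h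
    have hu : HasDerivAt (fun τ => (F (s, τ)).2.2) _ t :=
      hasFDerivAt_snd.comp_hasDerivAt t (hasFDerivAt_snd.comp_hasDerivAt t h)
    have hp := hnn s (mem_sph.2 hs) t ht
    rw [hu.deriv, hq.deriv] at hp
    rwa [hF.inner_fst_fderiv_front hs ht (hF.inner_deriv hs ht)]
  X_zero s hs := by simp [front, hF0 s (mem_sph.2 hs)]
  Q_zero s hs := by rw [hF0 s (mem_sph.2 hs)]
  X_one s hs := by
    obtain ⟨q, -, hq⟩ := hF1.subset (mem_image_of_mem (fun s => F (s, 1)) (mem_sph.2 hs))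
    simp [front, ← show _ = F (s, 1) from hq]

end IsLegIsotopyJet

theorem nonneg_isotopy_zero_section_constant (m : ℕ) (hm : 2 ≤ m)
    (F : EuclideanSpace ℝ (Fin m) × ℝ → JetSp m)
    (hF : IsLegIsotopyJet m F) (hnn : NonnegJet m F)
    (hF0 : ∀ s ∈ sph m, F (s, 0) = (s, 0, 0))
    (hF1 : jetSlice m F 1 = zeroSection m) :
    ∀ t ∈ Icc (0:ℝ) 1, jetSlice m F t = zeroSection m := by
  intro t ht
  have h := hF.isFront hnn hF0 hF1
  have hrank : 1 < Module.rank ℝ (EuclideanSpace ℝ (Fin m)) := by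
    rw [← Module.finrank_eq_rank, finrank_euclideanSpace_fin]
    exact_mod_cast hm
  have hjet : ∀ s, ‖s‖ = 1 → LegendrianIsotopy.front F (s, t) = 0 →
      F (s, t) = ((F (s, t)).1, 0, 0) := fun s hs =>
    LegendrianIsotopy.eq_of_front_eq_zero (hF.norm_fst hs ht)
      (hF.mem_jet s (LegendrianIsotopy.mem_sph.2 hs) t ht)
  apply Subset.antisymm
  · rintro _ ⟨s, hs, rfl⟩
    exact ⟨_, hF.mem_sphere s hs t ht,
      (hjet s (LegendrianIsotopy.mem_sph.1 hs) (h.eq_zero hrank ht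
        (LegendrianIsotopy.mem_sph.1 hs))).symm⟩
  · rintro _ ⟨q, hq, rfl⟩
    obtain ⟨s, hs, hX, rfl⟩ := h.exists_eq_zero (LegendrianIsotopy.mem_sph.1 hq) ht
    exact ⟨s, LegendrianIsotopy.mem_sph.2 hs, hjet s hs hX⟩
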